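/- Let ε = 1/(32κ²√d), ξ = 6, and let σ ≤ (δ/κ²)·‖A‖·√n/(√(nd)+√m+√(2γ n log n)) with δ ≤ (1−ε²d)ε/12. Fix T ≥ 1. Conditioned on the leave-one-out bounds ‖W_i (W^(i))^T S^{i,t}‖_F ≤ √d(√(nd)+√m+√(2γ n log n))² for all 0 ≤ t ≤ T and 1 ≤ i ≤ n, the following hold with high probability for all 1 ≤ t ≤ T: (i) d_F(Sᵗ, S^{i,t}) ≤ ε√d for all 1 ≤ i ≤ n; (ii) max_{1≤i≤n} ‖W_i W^T Sᵗ‖_F ≤ (ξ/2)√d(√(nd)+√m+√(2γ n log n))²; (iii) d_F(Sᵗ, Z) ≤ ε√(nd)/2; and consequently d_F(S^{t+1}, Sᵗ) ≤ (1/2)·d_F(Sᵗ, S^{t−1}) ≤ 2^{−t}·d_F(S¹, S⁰). -/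

import Mathlib

open MeasureTheory Matrix Filter

namespace GOPP

/-- Frobenius norm of a real matrix. -/
noncomputable def frob {α β : Type*} [Fintype α] [Fintype β] (X : Matrix α β ℝ) : ℝ :=
  Real.sqrt (∑ i, ∑ j, X i j ^ 2)

/-- Euclidean norm of a vector. -/
noncomputable def vnorm {β : Type*} [Fintype β] (v : β → ℝ) : ℝ :=
  Real.sqrt (∑ j, v j ^ 2)

/-- Operator (spectral) norm: the supremum of ‖Xu‖ over unit vectors u. -/
noncomputable def opNorm {α β : Type*} [Fintype α] [Fintype β] (X : Matrix α β ℝ) : ℝ :=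
  sSup {r : ℝ | ∃ u : β → ℝ, vnorm u = 1 ∧ r = vnorm (X.mulVec u)}

/-- Smallest singular value: the infimum of ‖uᵀX‖ over unit vectors u (for a d×m matrix
with d ≤ m this is the d-th largest singular value; for square matrices it is σ_min). -/
noncomputable def sigmaMin {α β : Type*} [Fintype α] [Fintype β] (X : Matrix α β ℝ) : ℝ :=
  sInf {r : ℝ | ∃ u : α → ℝ, vnorm u = 1 ∧ r = vnorm (Matrix.vecMul u X)}

/-- Condition number κ = σ_max/σ_min. -/
noncomputable def kappa {d m : ℕ} (A : Matrix (Fin d) (Fin m) ℝ) : ℝ :=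
  opNorm A / sigmaMin A

/-- Q is an orthogonal matrix. -/
def IsOrth {d : ℕ} (Q : Matrix (Fin d) (Fin d) ℝ) : Prop :=
  Qᵀ * Q = 1 ∧ Q * Qᵀ = 1

/-- Nuclear norm, via the dual characterization ‖M‖_* = max_{Q ∈ O(d)} ⟨Q, M⟩. -/
noncomputable def nuclearNorm {d : ℕ} (M : Matrix (Fin d) (Fin d) ℝ) : ℝ :=
  sSup {r : ℝ | ∃ Q : Matrix (Fin d) (Fin d) ℝ, IsOrth Q ∧ r = Matrix.trace (Qᵀ * M)}

/-- The i-th d×k block of an (nd)×k block matrix. -/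
def blk {n d k : ℕ} (S : Matrix (Fin n × Fin d) (Fin k) ℝ) (i : Fin n) :
    Matrix (Fin d) (Fin k) ℝ :=
  Matrix.of fun a b => S (i, a) b

/-- The i-th diagonal d×d block of an (nd)×(nd) matrix. -/
def dblk {n d : ℕ} (G : Matrix (Fin n × Fin d) (Fin n × Fin d) ℝ) (i : Fin n) :
    Matrix (Fin d) (Fin d) ℝ :=
  Matrix.of fun a b => G (i, a) (i, b)

/-- S ∈ O(d)^{⊗n}: each of the n d×d blocks of S is orthogonal. -/
def OrthBlocks {n d : ℕ} (S : Matrix (Fin n × Fin d) (Fin d) ℝ) : Prop :=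
  ∀ i, IsOrth (blk S i)

/-- Z ∈ ℝ^{nd×d}: the vertical stack of n copies of I_d. -/
def ZStack (n d : ℕ) : Matrix (Fin n × Fin d) (Fin d) ℝ :=
  Matrix.of fun p j => if p.2 = j then 1 else 0

/-- Vertical stack of n given d×k matrices. -/
def stack {n d k : ℕ} (B : Fin n → Matrix (Fin d) (Fin k) ℝ) :
    Matrix (Fin n × Fin d) (Fin k) ℝ :=
  Matrix.of fun p b => B p.1 p.2 b

/-- d_F(X,Y) = min_{Q ∈ O(d)} ‖X − YQ‖_F. -/
noncomputable def dF {n d : ℕ} (X Y : Matrix (Fin n × Fin d) (Fin d) ℝ) : ℝ :=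
  sInf {r : ℝ | ∃ Q, IsOrth Q ∧ r = frob (X - Y * Q)}

/-- R is a polar factor P(X) of X: an orthogonal global minimizer of ‖X − Q‖_F over O(d). -/
def IsPolar {d : ℕ} (X R : Matrix (Fin d) (Fin d) ℝ) : Prop :=
  IsOrth R ∧ ∀ Q : Matrix (Fin d) (Fin d) ℝ, IsOrth Q → frob (X - R) ≤ frob (X - Q)

/-- S = P_n(X): blockwise polar factor. -/
def IsPolarBlocks {n d : ℕ} (X S : Matrix (Fin n × Fin d) (Fin d) ℝ) : Prop :=
  ∀ i, IsPolar (blk X i) (blk S i)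

/-- U collects (an orthonormal basis of the span of) the top d left singular vectors of D:
U has orthonormal columns and maximizes the Ky Fan quantity trace(Uᵀ(DDᵀ)U). -/
def IsTopSingVecs {N : Type*} [Fintype N] {d m : ℕ} (D : Matrix N (Fin m) ℝ)
    (U : Matrix N (Fin d) ℝ) : Prop :=
  Uᵀ * U = 1 ∧ ∀ Q : Matrix N (Fin d) ℝ, Qᵀ * Q = 1 →
    Matrix.trace (Qᵀ * (D * Dᵀ) * Q) ≤ Matrix.trace (Uᵀ * (D * Dᵀ) * U)

/-- (U, S, V) is a top-d singular triple of D: orthonormal U, V, diagonal nonnegative S,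
DV = US, DᵀU = VS, and U spans a top-d left singular subspace. -/
def IsSVDTriple {N : Type*} [Fintype N] {d m : ℕ} (D : Matrix N (Fin m) ℝ)
    (U : Matrix N (Fin d) ℝ) (S : Matrix (Fin d) (Fin d) ℝ)
    (V : Matrix (Fin m) (Fin d) ℝ) : Prop :=
  Vᵀ * V = 1 ∧ (∀ a b, a ≠ b → S a b = 0) ∧ (∀ a, 0 ≤ S a a) ∧
    D * V = U * S ∧ Dᵀ * U = V * S ∧ IsTopSingVecs D U

/-- The generalized power method sequence with spectral initialization, run on the data
matrix D (so with C = DDᵀ): S⁰ = P_n(U) for top singular vectors U of D, and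
S^{t+1} = P_n(C Sᵗ). -/
def IsGPM {n d m : ℕ} (D : Matrix (Fin n × Fin d) (Fin m) ℝ)
    (S : ℕ → Matrix (Fin n × Fin d) (Fin d) ℝ) : Prop :=
  (∃ U, IsTopSingVecs D U ∧ IsPolarBlocks U (S 0)) ∧
    ∀ t, IsPolarBlocks (D * Dᵀ * S t) (S (t + 1))

/-- W^(i): W with its i-th block row replaced by 0. -/
def mask {n d m : ℕ} (W : Matrix (Fin n × Fin d) (Fin m) ℝ) (i : Fin n) :
    Matrix (Fin n × Fin d) (Fin m) ℝ :=
  Matrix.of fun p b => if p.1 = i then 0 else W p b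

/-- The noise matrix Δ = WAᵀZᵀ + ZAWᵀ + σWWᵀ. -/
noncomputable def delta {n d m : ℕ} (A : Matrix (Fin d) (Fin m) ℝ)
    (W : Matrix (Fin n × Fin d) (Fin m) ℝ) (σ : ℝ) :
    Matrix (Fin n × Fin d) (Fin n × Fin d) ℝ :=
  W * Aᵀ * (ZStack n d)ᵀ + ZStack n d * A * Wᵀ + σ • (W * Wᵀ)

/-- The i-th block column Δ_i = WAᵀ + ZAW_iᵀ + σWW_iᵀ of Δ. -/
noncomputable def deltaCol {n d m : ℕ} (A : Matrix (Fin d) (Fin m) ℝ)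
    (W : Matrix (Fin n × Fin d) (Fin m) ℝ) (σ : ℝ) (i : Fin n) :
    Matrix (Fin n × Fin d) (Fin d) ℝ :=
  W * Aᵀ + ZStack n d * A * (blk W i)ᵀ + σ • (W * (blk W i)ᵀ)

/-- The operator L S = C S/(n‖A‖²) with C = ZAAᵀZᵀ + σΔ. -/
noncomputable def Lop {n d m : ℕ} (A : Matrix (Fin d) (Fin m) ℝ)
    (W : Matrix (Fin n × Fin d) (Fin m) ℝ) (σ : ℝ)
    (S : Matrix (Fin n × Fin d) (Fin d) ℝ) : Matrix (Fin n × Fin d) (Fin d) ℝ :=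
  ((n : ℝ) * opNorm A ^ 2)⁻¹ •
    ((ZStack n d * A * Aᵀ * (ZStack n d)ᵀ + σ • delta A W σ) * S)

/-- √(nd) + √m + √(2γ n log n). -/
noncomputable def bnd1 (n d m : ℕ) (γ : ℝ) : ℝ :=
  Real.sqrt ((n : ℝ) * d) + Real.sqrt (m : ℝ) + Real.sqrt (2 * γ * n * Real.log n)

/-- √(nd) + √m + √(2γ log n). -/
noncomputable def bnd2 (n d m : ℕ) (γ : ℝ) : ℝ :=
  Real.sqrt ((n : ℝ) * d) + Real.sqrt (m : ℝ) + Real.sqrt (2 * γ * Real.log n)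

/-- The basin of attraction N_ε. -/
def memNeps {n d : ℕ} (ε : ℝ) (S : Matrix (Fin n × Fin d) (Fin d) ℝ) : Prop :=
  OrthBlocks S ∧ dF S (ZStack n d) ≤ ε * Real.sqrt ((n : ℝ) * d)

/-- The basin of attraction N_{ξ,∞}. -/
def memNxi {n d m : ℕ} (W : Matrix (Fin n × Fin d) (Fin m) ℝ) (γ ξ : ℝ)
    (S : Matrix (Fin n × Fin d) (Fin d) ℝ) : Prop :=
  OrthBlocks S ∧ ∀ i, frob (blk W i * Wᵀ * S) ≤ ξ * Real.sqrt (d : ℝ) * bnd1 n d m γ ^ 2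

/-- The distribution of a matrix with i.i.d. standard Gaussian N(0,1) entries. -/
noncomputable def stdGaussian (ι κ : Type*) [Fintype ι] [Fintype κ] :
    Measure (ι → κ → ℝ) :=
  Measure.pi fun _ : ι => Measure.pi fun _ : κ => ProbabilityTheory.gaussianReal 0 1

section Norms

variable {α β ι : Type*} [Fintype α] [Fintype β] [Fintype ι]

lemma vnorm_eq_norm (v : β → ℝ) : vnorm v = ‖WithLp.toLp 2 v‖ := by
  simp [vnorm, EuclideanSpace.norm_eq]

lemma vnorm_nonneg (v : β → ℝ) : 0 ≤ vnorm v := Real.sqrt_nonneg _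

lemma vnorm_sq (v : β → ℝ) : vnorm v ^ 2 = v ⬝ᵥ v := by
  rw [vnorm, Real.sq_sqrt (Finset.sum_nonneg fun _ _ => sq_nonneg _)]
  simp [dotProduct, sq]

lemma vnorm_add_le (v w : β → ℝ) : vnorm (v + w) ≤ vnorm v + vnorm w := by
  simp only [vnorm_eq_norm, WithLp.toLp_add]
  exact norm_add_le _ _

lemma vnorm_smul (c : ℝ) (v : β → ℝ) : vnorm (c • v) = |c| * vnorm v := by
  simp only [vnorm_eq_norm, WithLp.toLp_smul, norm_smul, Real.norm_eq_abs]

lemma vnorm_neg (v : β → ℝ) : vnorm (-v) = vnorm v := by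
  simp [vnorm]

lemma vnorm_eq_zero {v : β → ℝ} : vnorm v = 0 ↔ v = 0 := by
  simp [vnorm_eq_norm]

lemma dotProduct_le_vnorm (v w : β → ℝ) : v ⬝ᵥ w ≤ vnorm v * vnorm w := by
  have h := real_inner_le_norm (WithLp.toLp 2 v) (WithLp.toLp 2 w)
  rw [← vnorm_eq_norm, ← vnorm_eq_norm] at h
  refine le_trans (le_of_eq ?_) h
  simp [PiLp.inner_apply, dotProduct, mul_comm]

lemma frob_eq_vnorm (X : Matrix α β ℝ) : frob X = vnorm fun p : α × β => X p.1 p.2 := by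
  simp [frob, vnorm, Fintype.sum_prod_type]

lemma frob_nonneg (X : Matrix α β ℝ) : 0 ≤ frob X := Real.sqrt_nonneg _

lemma frob_add_le (X Y : Matrix α β ℝ) : frob (X + Y) ≤ frob X + frob Y := by
  simp only [frob_eq_vnorm]
  exact vnorm_add_le (fun p : α × β => X p.1 p.2) fun p => Y p.1 p.2

lemma frob_neg (X : Matrix α β ℝ) : frob (-X) = frob X := by
  simp [frob]

lemma frob_sub_comm (X Y : Matrix α β ℝ) : frob (X - Y) = frob (Y - X) := by
  rw [← frob_neg, neg_sub]

lemma frob_sub_le_add (X Y V : Matrix α β ℝ) : frob (X - V) ≤ frob (X - Y) + frob (Y - V) := by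
  simpa using frob_add_le (X - Y) (Y - V)

lemma frob_smul (c : ℝ) (X : Matrix α β ℝ) : frob (c • X) = |c| * frob X := by
  simp only [frob_eq_vnorm]
  exact vnorm_smul c fun p : α × β => X p.1 p.2

lemma frob_zero : frob (0 : Matrix α β ℝ) = 0 := by simp [frob]

lemma frob_eq_zero {X : Matrix α β ℝ} (h : frob X = 0) : X = 0 := by
  rw [frob_eq_vnorm, vnorm_eq_zero] at h
  ext i j
  exact congrFun h (i, j)

lemma frob_sq_eq_sum (X : Matrix α β ℝ) : frob X ^ 2 = ∑ i, ∑ j, X i j ^ 2 :=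
  Real.sq_sqrt (Finset.sum_nonneg fun _ _ => Finset.sum_nonneg fun _ _ => sq_nonneg _)

lemma frob_transpose (X : Matrix α β ℝ) : frob Xᵀ = frob X := by
  simp only [frob, transpose_apply]
  rw [Finset.sum_comm]

lemma trace_transpose_mul_eq_sum (X Y : Matrix α β ℝ) :
    trace (Xᵀ * Y) = ∑ p : α × β, X p.1 p.2 * Y p.1 p.2 := by
  simp only [trace, diag_apply, mul_apply, transpose_apply, Fintype.sum_prod_type]
  rw [Finset.sum_comm]

lemma frob_sq (X : Matrix α β ℝ) : frob X ^ 2 = trace (Xᵀ * X) := by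
  rw [trace_transpose_mul_eq_sum, frob_sq_eq_sum, Fintype.sum_prod_type]
  simp [sq]

lemma trace_le_frob (X Y : Matrix α β ℝ) : trace (Xᵀ * Y) ≤ frob X * frob Y := by
  rw [trace_transpose_mul_eq_sum, frob_eq_vnorm, frob_eq_vnorm]
  exact dotProduct_le_vnorm (fun p : α × β => X p.1 p.2) fun p => Y p.1 p.2

lemma trace_transpose_mul_comm (X Y : Matrix α β ℝ) : trace (Xᵀ * Y) = trace (Yᵀ * X) := by
  rw [← trace_transpose (Xᵀ * Y), transpose_mul, transpose_transpose]

lemma frob_sub_sq (X Y : Matrix α β ℝ) :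
    frob (X - Y) ^ 2 = frob X ^ 2 - 2 * trace (Yᵀ * X) + frob Y ^ 2 := by
  simp only [frob_sq, transpose_sub, Matrix.sub_mul, Matrix.mul_sub, trace_sub]
  rw [trace_transpose_mul_comm X Y]
  ring

/-- `X` is bounded by `c` in operator norm. -/
def OpLe (X : Matrix α β ℝ) (c : ℝ) : Prop := ∀ v : β → ℝ, vnorm (X *ᵥ v) ≤ c * vnorm v

/-- `X` is bounded below by `c`: its smallest singular value (on the right) is at least `c`. -/
def OpGe (X : Matrix α β ℝ) (c : ℝ) : Prop := ∀ v : β → ℝ, c * vnorm v ≤ vnorm (X *ᵥ v)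

lemma OpLe.mono {X : Matrix α β ℝ} {c c' : ℝ} (h : OpLe X c) (hc : c ≤ c') : OpLe X c' :=
  fun v => (h v).trans (mul_le_mul_of_nonneg_right hc (vnorm_nonneg v))

lemma OpGe.mono {X : Matrix α β ℝ} {c c' : ℝ} (h : OpGe X c) (hc : c' ≤ c) : OpGe X c' :=
  fun v => (mul_le_mul_of_nonneg_right hc (vnorm_nonneg v)).trans (h v)

lemma OpLe.mul {X : Matrix α β ℝ} {Y : Matrix β ι ℝ} {c c' : ℝ} (hc : 0 ≤ c)
    (h : OpLe X c) (h' : OpLe Y c') : OpLe (X * Y) (c * c') := fun v => by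
  rw [← mulVec_mulVec, mul_assoc]
  exact (h _).trans (mul_le_mul_of_nonneg_left (h' v) hc)

lemma OpGe.mul {X : Matrix α β ℝ} {Y : Matrix β ι ℝ} {c c' : ℝ} (hc : 0 ≤ c)
    (h : OpGe X c) (h' : OpGe Y c') : OpGe (X * Y) (c * c') := fun v => by
  rw [← mulVec_mulVec, mul_assoc]
  exact (mul_le_mul_of_nonneg_left (h' v) hc).trans (h _)

lemma OpLe.add {X Y : Matrix α β ℝ} {c c' : ℝ} (h : OpLe X c) (h' : OpLe Y c') :
    OpLe (X + Y) (c + c') := fun v => by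
  rw [add_mulVec, add_mul]
  exact (vnorm_add_le _ _).trans (add_le_add (h v) (h' v))

lemma OpLe.smul {X : Matrix α β ℝ} {c r : ℝ} (hr : 0 ≤ r) (h : OpLe X c) :
    OpLe (r • X) (r * c) := fun v => by
  rw [smul_mulVec, vnorm_smul, abs_of_nonneg hr, mul_assoc]
  exact mul_le_mul_of_nonneg_left (h v) hr

lemma OpLe.neg {X : Matrix α β ℝ} {c : ℝ} (h : OpLe X c) : OpLe (-X) c := fun v => by
  rw [neg_mulVec, vnorm_neg]
  exact h v

lemma OpGe.smul {X : Matrix α β ℝ} {c r : ℝ} (hr : 0 ≤ r) (h : OpGe X c) :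
    OpGe (r • X) (r * c) := fun v => by
  rw [smul_mulVec, vnorm_smul, abs_of_nonneg hr, mul_assoc]
  exact mul_le_mul_of_nonneg_left (h v) hr

lemma OpGe.of_sub {X Y : Matrix α β ℝ} {c c' : ℝ} (h : OpGe Y c) (h' : OpLe (X - Y) c') :
    OpGe X (c - c') := fun v => by
  have h1 := h v
  have h2 := h' v
  have h3 : Y *ᵥ v = X *ᵥ v + -((X - Y) *ᵥ v) := by rw [sub_mulVec]; abel
  have h4 := vnorm_add_le (X *ᵥ v) (-((X - Y) *ᵥ v))
  rw [← h3, vnorm_neg] at h4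
  nlinarith

lemma OpLe.transpose {X : Matrix α β ℝ} {c : ℝ} (hc : 0 ≤ c) (h : OpLe X c) :
    OpLe Xᵀ c := fun v => by
  have h1 : vnorm (Xᵀ *ᵥ v) ^ 2 ≤ c * vnorm v * vnorm (Xᵀ *ᵥ v) := by
    calc vnorm (Xᵀ *ᵥ v) ^ 2 = v ⬝ᵥ (X *ᵥ (Xᵀ *ᵥ v)) := by
          rw [vnorm_sq, mulVec_transpose, ← dotProduct_mulVec]
      _ ≤ vnorm v * vnorm (X *ᵥ (Xᵀ *ᵥ v)) := dotProduct_le_vnorm _ _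
      _ ≤ vnorm v * (c * vnorm (Xᵀ *ᵥ v)) :=
          mul_le_mul_of_nonneg_left (h _) (vnorm_nonneg _)
      _ = _ := by ring
  rcases (vnorm_nonneg (Xᵀ *ᵥ v)).eq_or_lt with h0 | h0
  · rw [← h0]
    exact mul_nonneg hc (vnorm_nonneg v)
  · nlinarith

lemma vnorm_col_sq_sum (X : Matrix α β ℝ) : frob X ^ 2 = ∑ j, vnorm (fun i => X i j) ^ 2 := by
  rw [frob_sq_eq_sum, Finset.sum_comm]
  simp only [vnorm_sq]
  simp only [dotProduct, sq]

lemma OpLe.frob_mul {X : Matrix α β ℝ} {c : ℝ} (hc : 0 ≤ c) (h : OpLe X c) (Y : Matrix β ι ℝ) :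
    frob (X * Y) ≤ c * frob Y := by
  refine le_of_sq_le_sq ?_ (mul_nonneg hc (frob_nonneg _))
  rw [mul_pow, vnorm_col_sq_sum, vnorm_col_sq_sum, Finset.mul_sum]
  refine Finset.sum_le_sum fun j _ => ?_
  rw [← mul_pow]
  exact pow_le_pow_left₀ (vnorm_nonneg _) (h fun i => Y i j) 2

lemma OpGe.frob_mul {X : Matrix α β ℝ} {c : ℝ} (hc : 0 ≤ c) (h : OpGe X c) (Y : Matrix β ι ℝ) :
    c * frob Y ≤ frob (X * Y) := by
  refine le_of_sq_le_sq ?_ (frob_nonneg _)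
  rw [mul_pow, vnorm_col_sq_sum, vnorm_col_sq_sum, Finset.mul_sum]
  refine Finset.sum_le_sum fun j _ => ?_
  rw [← mul_pow]
  exact pow_le_pow_left₀ (mul_nonneg hc (vnorm_nonneg _)) (h fun i => Y i j) 2

lemma OpLe.mul_frob {X : Matrix β ι ℝ} {c : ℝ} (hc : 0 ≤ c) (h : OpLe X c) (Y : Matrix α β ℝ) :
    frob (Y * X) ≤ c * frob Y := by
  rw [← frob_transpose, transpose_mul, ← frob_transpose Y]
  exact (h.transpose hc).frob_mul hc _

lemma opLe_frob (X : Matrix α β ℝ) : OpLe X (frob X) := fun v => by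
  refine le_of_sq_le_sq ?_ (mul_nonneg (frob_nonneg _) (vnorm_nonneg _))
  rw [mul_pow, vnorm_sq, frob_sq_eq_sum, Finset.sum_mul, dotProduct]
  refine Finset.sum_le_sum fun i _ => ?_
  have h := Finset.sum_mul_sq_le_sq_mul_sq Finset.univ (fun j => X i j) v
  rw [vnorm_sq]
  simpa [mulVec, dotProduct, sq] using h

lemma frob_mul_le (X : Matrix α β ℝ) (Y : Matrix β ι ℝ) : frob (X * Y) ≤ frob X * frob Y :=
  (opLe_frob X).frob_mul (frob_nonneg X) Y

lemma vnorm_mulVec_of_orthonormal [DecidableEq β] {U : Matrix α β ℝ} (h : Uᵀ * U = 1)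
    (v : β → ℝ) : vnorm (U *ᵥ v) = vnorm v := by
  refine (sq_eq_sq₀ (vnorm_nonneg _) (vnorm_nonneg _)).1 ?_
  rw [vnorm_sq, vnorm_sq, dotProduct_mulVec, ← mulVec_transpose, mulVec_mulVec, h, one_mulVec]

lemma opLe_one_of_orthonormal [DecidableEq β] {U : Matrix α β ℝ} (h : Uᵀ * U = 1) :
    OpLe U 1 := fun v => by rw [vnorm_mulVec_of_orthonormal h, one_mul]

lemma opGe_one_of_orthonormal [DecidableEq β] {U : Matrix α β ℝ} (h : Uᵀ * U = 1) :
    OpGe U 1 := fun v => by rw [vnorm_mulVec_of_orthonormal h, one_mul]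

lemma frob_orthonormal {d : ℕ} {U : Matrix α (Fin d) ℝ} (h : Uᵀ * U = 1) :
    frob U = Real.sqrt d := by
  rw [← Real.sqrt_sq (frob_nonneg U), frob_sq, h]
  simp

lemma opGe_of_quadratic {K : Matrix α α ℝ} {c : ℝ} (h : ∀ v, c * (v ⬝ᵥ v) ≤ v ⬝ᵥ (K *ᵥ v)) :
    OpGe K c := fun v => by
  have h1 := (h v).trans (dotProduct_le_vnorm _ _)
  rw [← vnorm_sq] at h1
  rcases (vnorm_nonneg v).eq_or_lt with h0 | h0
  · rw [← h0, mul_zero]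
    exact vnorm_nonneg _
  · nlinarith

lemma trace_quadratic_le {K : Matrix α α ℝ} {c : ℝ} (h : ∀ v, c * (v ⬝ᵥ v) ≤ v ⬝ᵥ (K *ᵥ v))
    (Y : Matrix α β ℝ) : c * frob Y ^ 2 ≤ trace (Yᵀ * (K * Y)) := by
  rw [vnorm_col_sq_sum, Finset.mul_sum, trace]
  refine Finset.sum_le_sum fun j _ => ?_
  rw [vnorm_sq]
  exact h fun i => Y i j

end Norms

section Orth

variable {d : ℕ} {α : Type*} [Fintype α]

lemma IsOrth.one : IsOrth (1 : Matrix (Fin d) (Fin d) ℝ) := by simp [IsOrth]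

lemma IsOrth.transpose {Q : Matrix (Fin d) (Fin d) ℝ} (h : IsOrth Q) : IsOrth Qᵀ := by
  simpa [IsOrth] using And.symm h

lemma IsOrth.mul {Q R : Matrix (Fin d) (Fin d) ℝ} (h : IsOrth Q) (h' : IsOrth R) :
    IsOrth (Q * R) := by
  constructor
  · rw [transpose_mul, Matrix.mul_assoc, ← Matrix.mul_assoc Qᵀ, h.1, Matrix.one_mul, h'.1]
  · rw [transpose_mul, Matrix.mul_assoc, ← Matrix.mul_assoc R, h'.2, Matrix.one_mul, h.2]

lemma isOrth_of_left {Q : Matrix (Fin d) (Fin d) ℝ} (h : Qᵀ * Q = 1) : IsOrth Q :=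
  ⟨h, mul_eq_one_comm.1 h⟩

lemma frob_mul_orth (X : Matrix α (Fin d) ℝ) {Q : Matrix (Fin d) (Fin d) ℝ} (h : IsOrth Q) :
    frob (X * Q) = frob X := by
  refine (sq_eq_sq₀ (frob_nonneg _) (frob_nonneg _)).1 ?_
  rw [frob_sq, frob_sq, transpose_mul, Matrix.mul_assoc, trace_mul_comm, Matrix.mul_assoc,
    Matrix.mul_assoc, h.2, Matrix.mul_one]

lemma isCompact_orth : IsCompact {Q : Matrix (Fin d) (Fin d) ℝ | IsOrth Q} := by
  have hc : IsCompact (Set.univ.pi fun _ : Fin d => Set.univ.pi fun _ : Fin d =>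
      Set.Icc (-1 : ℝ) 1) := isCompact_univ_pi fun _ => isCompact_univ_pi fun _ => isCompact_Icc
  refine IsCompact.of_isClosed_subset hc ?_ ?_
  · have h1 : Continuous fun Q : Matrix (Fin d) (Fin d) ℝ => Qᵀ * Q := by fun_prop
    have h2 : Continuous fun Q : Matrix (Fin d) (Fin d) ℝ => Q * Qᵀ := by fun_prop
    exact (isClosed_eq h1 continuous_const).inter (isClosed_eq h2 continuous_const)
  · intro Q hQ i _ j _
    have h := congrFun (congrFun hQ.2 i) i
    simp only [mul_apply, transpose_apply, one_apply_eq] at h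
    have h2 : Q i j * Q i j ≤ 1 := h ▸ Finset.single_le_sum (f := fun j => Q i j * Q i j)
      (fun _ _ => mul_self_nonneg _) (Finset.mem_univ j)
    exact abs_le.1 (abs_le_of_sq_le_sq (by nlinarith) zero_le_one)

lemma continuous_frob {β : Type*} [Fintype β] : Continuous (frob : Matrix α β ℝ → ℝ) := by
  unfold frob
  fun_prop

end Orth

section DF

variable {n d : ℕ}

lemma dF_eq (X Y : Matrix (Fin n × Fin d) (Fin d) ℝ) :
    dF X Y = sInf {r : ℝ | ∃ Q : Matrix (Fin d) (Fin d) ℝ, IsOrth Q ∧ r = frob (X - Y * Q)} := rfl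

lemma dF_le (X Y : Matrix (Fin n × Fin d) (Fin d) ℝ) {Q : Matrix (Fin d) (Fin d) ℝ}
    (h : IsOrth Q) : dF X Y ≤ frob (X - Y * Q) := by
  rw [dF_eq]
  exact csInf_le ⟨0, by rintro _ ⟨Q, _, rfl⟩; exact frob_nonneg _⟩ ⟨Q, h, rfl⟩

lemma dF_nonneg (X Y : Matrix (Fin n × Fin d) (Fin d) ℝ) : 0 ≤ dF X Y :=
  Real.sInf_nonneg (by rintro _ ⟨Q, _, rfl⟩; exact frob_nonneg _)

lemma exists_dF_eq (X Y : Matrix (Fin n × Fin d) (Fin d) ℝ) :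
    ∃ Q : Matrix (Fin d) (Fin d) ℝ, IsOrth Q ∧ dF X Y = frob (X - Y * Q) := by
  have hcont : Continuous fun Q : Matrix (Fin d) (Fin d) ℝ => frob (X - Y * Q) :=
    continuous_frob.comp (by fun_prop)
  obtain ⟨Q, hQ, hmin⟩ := isCompact_orth.exists_isMinOn ⟨1, IsOrth.one⟩ hcont.continuousOn
  refine ⟨Q, hQ, le_antisymm (dF_le X Y hQ) ?_⟩
  rw [dF_eq]
  refine le_csInf ⟨_, Q, hQ, rfl⟩ ?_
  rintro _ ⟨R, hR, rfl⟩
  exact hmin hR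

lemma dF_le_mul (X Y : Matrix (Fin n × Fin d) (Fin d) ℝ) {P Q : Matrix (Fin d) (Fin d) ℝ}
    (hP : IsOrth P) (hQ : IsOrth Q) : dF X Y ≤ frob (X * P - Y * Q) := by
  refine (dF_le X Y (hQ.mul hP.transpose)).trans (le_of_eq ?_)
  rw [← frob_mul_orth _ hP, Matrix.sub_mul, Matrix.mul_assoc Y, Matrix.mul_assoc Q, hP.1,
    Matrix.mul_one]

lemma dF_triangle (X Y V : Matrix (Fin n × Fin d) (Fin d) ℝ) : dF X V ≤ dF X Y + dF Y V := by
  obtain ⟨P, hP, h1⟩ := exists_dF_eq X Y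
  obtain ⟨Q, hQ, h2⟩ := exists_dF_eq Y V
  rw [h1, h2, ← frob_mul_orth (Y - V * Q) hP, Matrix.sub_mul, Matrix.mul_assoc V]
  exact (dF_le X V (hQ.mul hP)).trans (frob_sub_le_add _ _ _)

lemma dF_comm (X Y : Matrix (Fin n × Fin d) (Fin d) ℝ) : dF X Y = dF Y X := by
  have key : ∀ X Y : Matrix (Fin n × Fin d) (Fin d) ℝ, dF X Y ≤ dF Y X := fun X Y => by
    obtain ⟨Q, hQ, h⟩ := exists_dF_eq Y X
    rw [h, frob_sub_comm]
    simpa using dF_le_mul X Y hQ IsOrth.one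
  exact le_antisymm (key X Y) (key Y X)

end DF

section Polar

variable {d : ℕ}

open scoped MatrixOrder in
open scoped Matrix.Norms.L2Operator in
lemma exists_sqrt (X : Matrix (Fin d) (Fin d) ℝ) :
    ∃ K : Matrix (Fin d) (Fin d) ℝ, K.PosSemidef ∧ K * K = Xᵀ * X := by
  have h : 0 ≤ Xᵀ * X := by
    rw [nonneg_iff_posSemidef]
    exact posSemidef_conjTranspose_mul_self X
  exact ⟨CFC.sqrt (Xᵀ * X), nonneg_iff_posSemidef.1 (CFC.sqrt_nonneg _),
    CFC.sqrt_mul_sqrt_self _ h⟩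

lemma quadratic_ge_of_opGe {K : Matrix (Fin d) (Fin d) ℝ} (hK : K.PosSemidef) {τ : ℝ}
    (h : OpGe K τ) (v : Fin d → ℝ) : τ * (v ⬝ᵥ v) ≤ v ⬝ᵥ (K *ᵥ v) := by
  have hH : (K - τ • (1 : Matrix (Fin d) (Fin d) ℝ)).IsHermitian := by
    refine hK.1.sub ?_
    simp [IsHermitian]
  have hP : (K - τ • (1 : Matrix (Fin d) (Fin d) ℝ)).PosSemidef := by
    rw [hH.posSemidef_iff_eigenvalues_nonneg]
    intro i
    set u : Fin d → ℝ := (hH.eigenvectorBasis i).ofLp with hu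
    have h1 : (K - τ • (1 : Matrix (Fin d) (Fin d) ℝ)) *ᵥ u = hH.eigenvalues i • u :=
      hH.mulVec_eigenvectorBasis i
    have hn : vnorm u = 1 := by
      rw [vnorm_eq_norm]
      exact hH.eigenvectorBasis.orthonormal.1 i
    have h2 : K *ᵥ u = (hH.eigenvalues i + τ) • u := by
      rw [sub_mulVec, smul_mulVec, one_mulVec] at h1
      rw [add_smul, ← h1]
      abel
    have h3 := h u
    have h4 := hK.dotProduct_mulVec_nonneg u
    rw [h2, vnorm_smul, hn] at h3
    rw [h2, dotProduct_smul] at h4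
    simp only [star_trivial] at h4
    rw [← vnorm_sq, hn] at h4
    simp only [one_pow, smul_eq_mul, mul_one] at h3 h4
    rw [abs_of_nonneg h4] at h3
    simpa using h3
  have h5 := hP.dotProduct_mulVec_nonneg v
  simp only [star_trivial, sub_mulVec, smul_mulVec, one_mulVec, dotProduct_sub,
    dotProduct_smul, smul_eq_mul] at h5
  linarith

lemma isUnit_det_of_opGe {X : Matrix (Fin d) (Fin d) ℝ} {τ : ℝ} (hτ : 0 < τ) (h : OpGe X τ) :
    IsUnit X.det := by
  rw [isUnit_iff_ne_zero]
  intro h0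
  obtain ⟨v, hv, hv0⟩ := exists_mulVec_eq_zero_iff.2 h0
  have h1 := h v
  rw [hv0, vnorm_eq_zero.2 rfl] at h1
  have h2 : 0 < vnorm v := lt_of_le_of_ne (vnorm_nonneg v) fun h => hv (vnorm_eq_zero.1 h.symm)
  nlinarith

lemma exists_polar {X : Matrix (Fin d) (Fin d) ℝ} {τ : ℝ} (hτ : 0 < τ) (h : OpGe X τ) :
    ∃ P : Matrix (Fin d) (Fin d) ℝ, IsOrth P ∧ (Pᵀ * X)ᵀ = Pᵀ * X ∧
      ∀ v, τ * (v ⬝ᵥ v) ≤ v ⬝ᵥ ((Pᵀ * X) *ᵥ v) := by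
  obtain ⟨K, hK, hKK⟩ := exists_sqrt X
  have hKt : Kᵀ = K := hK.1
  have hKX : OpGe K τ := fun v => by
    refine (h v).trans (le_of_eq ((sq_eq_sq₀ (vnorm_nonneg _) (vnorm_nonneg _)).1 ?_))
    rw [vnorm_sq, vnorm_sq, dotProduct_mulVec, ← mulVec_transpose, mulVec_mulVec, ← hKK,
      ← mulVec_mulVec, dotProduct_mulVec (K *ᵥ v) K v, ← mulVec_transpose, hKt]
  have hu : IsUnit K.det := isUnit_det_of_opGe hτ hKX
  have hit : (K⁻¹)ᵀ = K⁻¹ := by rw [transpose_nonsing_inv, hKt]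
  have hPX : (X * K⁻¹)ᵀ * X = K := by
    rw [transpose_mul, hit, Matrix.mul_assoc, ← hKK, nonsing_inv_mul_cancel_left _ _ hu]
  refine ⟨X * K⁻¹, isOrth_of_left ?_, ?_, ?_⟩
  · rw [← Matrix.mul_assoc, hPX, mul_nonsing_inv _ hu]
  · rw [hPX, hKt]
  · rw [hPX]
    exact quadratic_ge_of_opGe hK hKX

lemma frob_sub_orth_sq (X : Matrix (Fin d) (Fin d) ℝ) {Q : Matrix (Fin d) (Fin d) ℝ}
    (h : IsOrth Q) : frob (X - Q) ^ 2 = frob X ^ 2 - 2 * trace (Qᵀ * X) + d := by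
  rw [frob_sub_sq, frob_sq Q, h.1]
  simp

lemma isPolar_iff {X R : Matrix (Fin d) (Fin d) ℝ} :
    IsPolar X R ↔ IsOrth R ∧ ∀ Q : Matrix (Fin d) (Fin d) ℝ, IsOrth Q →
      trace (Qᵀ * X) ≤ trace (Rᵀ * X) := by
  refine and_congr_right fun hR => forall₂_congr fun Q hQ => ?_
  rw [← sq_le_sq₀ (frob_nonneg _) (frob_nonneg _), frob_sub_orth_sq X hR, frob_sub_orth_sq X hQ]
  constructor <;> intro h <;> linarith

lemma isPolar_self {Q : Matrix (Fin d) (Fin d) ℝ} (h : IsOrth Q) : IsPolar Q Q :=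
  ⟨h, fun _ _ => by rw [sub_self, frob_zero]; exact frob_nonneg _⟩

lemma IsPolar.mul_orth {X R Q : Matrix (Fin d) (Fin d) ℝ} (h : IsPolar X R) (hQ : IsOrth Q) :
    IsPolar (X * Q) (R * Q) := by
  refine ⟨h.1.mul hQ, fun P hP => ?_⟩
  have h1 := h.2 (P * Qᵀ) (hP.mul hQ.transpose)
  rw [← frob_mul_orth _ hQ, ← frob_mul_orth (X - P * Qᵀ) hQ, Matrix.sub_mul, Matrix.sub_mul,
    Matrix.mul_assoc P, hQ.1, Matrix.mul_one] at h1
  exact h1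

lemma IsPolar.smul {X R : Matrix (Fin d) (Fin d) ℝ} (h : IsPolar X R) {c : ℝ} (hc : 0 ≤ c) :
    IsPolar (c • X) R := by
  rw [isPolar_iff] at h ⊢
  refine ⟨h.1, fun Q hQ => ?_⟩
  simp only [Matrix.mul_smul, trace_smul, smul_eq_mul]
  exact mul_le_mul_of_nonneg_left (h.2 Q hQ) hc

lemma trace_gap_of_quadratic {X P Q : Matrix (Fin d) (Fin d) ℝ} (hP : IsOrth P) (hQ : IsOrth Q)
    (hs : (Pᵀ * X)ᵀ = Pᵀ * X) {τ : ℝ} (h : ∀ v, τ * (v ⬝ᵥ v) ≤ v ⬝ᵥ ((Pᵀ * X) *ᵥ v)) :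
    τ / 2 * frob (P - Q) ^ 2 ≤ trace (Pᵀ * X) - trace (Qᵀ * X) := by
  have h1 := trace_quadratic_le h (P - Q)ᵀ
  have h2 : frob (P - Q)ᵀ ^ 2 = frob (P - Q) ^ 2 := by rw [frob_transpose]
  rw [h2] at h1
  have hX : X = P * (Pᵀ * X) := by rw [← Matrix.mul_assoc, hP.2, Matrix.one_mul]
  set K := Pᵀ * X with hK
  have e1 : trace ((P - Q)ᵀᵀ * (K * (P - Q)ᵀ)) = 2 * trace K - 2 * trace (Qᵀ * X) := by
    rw [transpose_transpose, trace_mul_comm, Matrix.mul_assoc]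
    have : (P - Q)ᵀ * (P - Q) = 2 • (1 : Matrix (Fin d) (Fin d) ℝ) - Pᵀ * Q - Qᵀ * P := by
      rw [transpose_sub, Matrix.sub_mul, Matrix.mul_sub, Matrix.mul_sub, hP.1, hQ.1, two_smul]
      abel
    rw [this, Matrix.mul_sub, Matrix.mul_sub, trace_sub, trace_sub]
    have t1 : trace (K * (Qᵀ * P)) = trace (Qᵀ * X) := by
      rw [trace_mul_comm, Matrix.mul_assoc, ← hX]
    have t2 : trace (K * (Pᵀ * Q)) = trace (Qᵀ * X) := by
      rw [← trace_transpose, transpose_mul, transpose_mul, transpose_transpose, hs,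
        Matrix.mul_assoc, ← hX]
    rw [t1, t2, Matrix.mul_smul, trace_smul, Matrix.mul_one]
    simp
    ring
  linarith

lemma IsPolar.trace_gap {X R : Matrix (Fin d) (Fin d) ℝ} (hR : IsPolar X R) {τ : ℝ} (hτ : 0 < τ)
    (h : OpGe X τ) : (Rᵀ * X)ᵀ = Rᵀ * X ∧ (∀ v, τ * (v ⬝ᵥ v) ≤ v ⬝ᵥ ((Rᵀ * X) *ᵥ v)) ∧
      ∀ Q, IsOrth Q → τ / 2 * frob (R - Q) ^ 2 ≤ trace (Rᵀ * X) - trace (Qᵀ * X) := by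
  obtain ⟨P, hP, hs, hq⟩ := exists_polar hτ h
  have h1 := trace_gap_of_quadratic hP hR.1 hs hq
  have h2 := (isPolar_iff.1 hR).2 P hP
  have h3 : frob (P - R) = 0 := by
    have : frob (P - R) ^ 2 ≤ 0 := by nlinarith
    exact pow_eq_zero_iff two_ne_zero |>.1 (le_antisymm this (sq_nonneg _))
  have h4 : P = R := sub_eq_zero.1 (frob_eq_zero h3)
  subst h4
  exact ⟨hs, hq, fun Q hQ => trace_gap_of_quadratic hP hQ hs hq⟩

lemma le_of_half_mul_sq_le {x y τ : ℝ} (hx : 0 ≤ x) (hy : 0 ≤ y)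
    (h : τ / 2 * x ^ 2 ≤ y * x) : τ * x ≤ 2 * y := by
  rcases hx.eq_or_lt with h0 | h0
  · rw [← h0]; linarith
  · nlinarith

lemma IsPolar.frob_sub_le {X Y R Q : Matrix (Fin d) (Fin d) ℝ} (hR : IsPolar X R)
    (hQ : IsPolar Y Q) {τ : ℝ} (hτ : 0 < τ) (h : OpGe X τ) :
    τ * frob (R - Q) ≤ 2 * frob (X - Y) := by
  have h1 := (hR.trace_gap hτ h).2.2 Q hQ.1
  have h2 := (isPolar_iff.1 hQ).2 R hR.1
  have h3 := trace_le_frob (R - Q) (X - Y)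
  have h4 : trace ((R - Q)ᵀ * (X - Y)) = trace (Rᵀ * X) - trace (Qᵀ * X)
      - (trace (Rᵀ * Y) - trace (Qᵀ * Y)) := by
    simp only [transpose_sub, Matrix.sub_mul, Matrix.mul_sub, trace_sub]
  exact le_of_half_mul_sq_le (frob_nonneg _) (frob_nonneg _) (by nlinarith)

lemma IsPolar.frob_sub_le_of_both {X Y R Q : Matrix (Fin d) (Fin d) ℝ} (hR : IsPolar X R)
    (hQ : IsPolar Y Q) {τ τ' : ℝ} (hτ : 0 < τ) (h : OpGe X τ) (hτ' : 0 < τ') (h' : OpGe Y τ') :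
    (τ + τ') * frob (R - Q) ≤ 2 * frob (X - Y) := by
  have h1 := (hR.trace_gap hτ h).2.2 Q hQ.1
  have h2 := (hQ.trace_gap hτ' h').2.2 R hR.1
  rw [frob_sub_comm Q R] at h2
  have h3 := trace_le_frob (R - Q) (X - Y)
  have h4 : trace ((R - Q)ᵀ * (X - Y)) = trace (Rᵀ * X) - trace (Qᵀ * X)
      - (trace (Rᵀ * Y) - trace (Qᵀ * Y)) := by
    simp only [transpose_sub, Matrix.sub_mul, Matrix.mul_sub, trace_sub]
  exact le_of_half_mul_sq_le (frob_nonneg _) (frob_nonneg _) (by nlinarith)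

lemma exists_isPolar (X : Matrix (Fin d) (Fin d) ℝ) : ∃ R, IsPolar X R := by
  have hcont : Continuous fun Q : Matrix (Fin d) (Fin d) ℝ => frob (X - Q) :=
    continuous_frob.comp (by fun_prop)
  obtain ⟨Q, hQ, hmin⟩ := isCompact_orth.exists_isMinOn ⟨1, IsOrth.one⟩ hcont.continuousOn
  exact ⟨Q, hQ, fun R hR => hmin hR⟩

/-- A matrix that is nearly orthonormal is close to an orthogonal matrix. -/
lemma exists_orth_near (H : Matrix (Fin d) (Fin d) ℝ) {g : ℝ} (hg : g < 1)
    (h : frob (1 - Hᵀ * H) ≤ g) : ∃ Q, IsOrth Q ∧ frob (H - Q) ≤ g := by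
  have hg0 : 0 ≤ g := (frob_nonneg _).trans h
  have hH : OpGe H (Real.sqrt (1 - g)) := fun v => by
    refine le_of_sq_le_sq ?_ (vnorm_nonneg _)
    rw [mul_pow, Real.sq_sqrt (by linarith), vnorm_sq (H *ᵥ v), dotProduct_mulVec,
      ← mulVec_transpose, mulVec_mulVec]
    have h1 := dotProduct_le_vnorm v ((1 - Hᵀ * H) *ᵥ v)
    have h2 := opLe_frob (1 - Hᵀ * H) v
    have h3 : v ⬝ᵥ ((1 - Hᵀ * H) *ᵥ v) = v ⬝ᵥ v - v ⬝ᵥ ((Hᵀ * H) *ᵥ v) := by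
      rw [sub_mulVec, one_mulVec, dotProduct_sub]
    rw [dotProduct_comm ((Hᵀ * H) *ᵥ v)]
    have h4 : frob (1 - Hᵀ * H) * vnorm v ≤ g * vnorm v :=
      mul_le_mul_of_nonneg_right h (vnorm_nonneg v)
    have h5 := mul_le_mul_of_nonneg_left (h2.trans h4) (vnorm_nonneg v)
    have h6 := vnorm_sq v
    nlinarith
  obtain ⟨P, hP, hs, hq⟩ := exists_polar (Real.sqrt_pos.2 (by linarith)) hH
  refine ⟨P, hP, le_trans ?_ h⟩
  set K := Pᵀ * H with hK
  have hHK : H = P * K := by rw [hK, ← Matrix.mul_assoc, hP.2, Matrix.one_mul]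
  have e1 : frob (H - P) = frob (1 - K) := by
    have h8 : H - P = P * (K - 1) := by rw [Matrix.mul_sub, Matrix.mul_one, ← hHK]
    rw [h8, ← frob_transpose, transpose_mul, frob_mul_orth _ hP.transpose, frob_transpose,
      frob_sub_comm]
  have e2 : 1 - Hᵀ * H = (1 + K) * (1 - K) := by
    rw [hHK, transpose_mul, hs, Matrix.mul_assoc, ← Matrix.mul_assoc Pᵀ, hP.1, Matrix.one_mul]
    noncomm_ring
  rw [e1, e2]
  have hge : OpGe (1 + K) 1 := opGe_of_quadratic fun v => by
    rw [add_mulVec, one_mulVec, dotProduct_add, one_mul]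
    have := hq v
    have h7 : 0 ≤ Real.sqrt (1 - g) * (v ⬝ᵥ v) :=
      mul_nonneg (Real.sqrt_nonneg _) (by rw [← vnorm_sq]; positivity)
    linarith
  simpa using hge.frob_mul zero_le_one (1 - K)

end Polar

section Blocks

variable {n d m k : ℕ}

lemma blk_mul (X : Matrix (Fin n × Fin d) (Fin m) ℝ) (Y : Matrix (Fin m) (Fin k) ℝ)
    (i : Fin n) : blk (X * Y) i = blk X i * Y := rfl

lemma blk_add (X Y : Matrix (Fin n × Fin d) (Fin m) ℝ) (i : Fin n) :
    blk (X + Y) i = blk X i + blk Y i := rfl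

lemma blk_sub (X Y : Matrix (Fin n × Fin d) (Fin m) ℝ) (i : Fin n) :
    blk (X - Y) i = blk X i - blk Y i := rfl

lemma blk_smul (c : ℝ) (X : Matrix (Fin n × Fin d) (Fin m) ℝ) (i : Fin n) :
    blk (c • X) i = c • blk X i := rfl

lemma blk_ZStack (i : Fin n) : blk (ZStack n d) i = 1 := by
  ext a b
  simp [blk, ZStack, one_apply]

lemma blk_ZStack_mul (X : Matrix (Fin d) (Fin k) ℝ) (i : Fin n) :
    blk (ZStack n d * X) i = X := by
  rw [blk_mul, blk_ZStack, Matrix.one_mul]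

lemma blk_mask (W : Matrix (Fin n × Fin d) (Fin m) ℝ) (i j : Fin n) :
    blk (mask W i) j = if j = i then 0 else blk W j := by
  ext a b
  by_cases h : j = i <;> simp [blk, mask, h]

lemma transpose_mul_eq_sum_blk (X : Matrix (Fin n × Fin d) (Fin m) ℝ)
    (Y : Matrix (Fin n × Fin d) (Fin k) ℝ) : Xᵀ * Y = ∑ i, (blk X i)ᵀ * blk Y i := by
  ext a b
  simp [mul_apply, Matrix.sum_apply, blk, Fintype.sum_prod_type]

lemma frob_sq_blk (X : Matrix (Fin n × Fin d) (Fin m) ℝ) :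
    frob X ^ 2 = ∑ i, frob (blk X i) ^ 2 := by
  simp only [frob_sq_eq_sum, Fintype.sum_prod_type]
  rfl

lemma frob_le_of_blk {X : Matrix (Fin n × Fin d) (Fin m) ℝ} {c : ℝ} (hc : 0 ≤ c)
    (h : ∀ i, frob (blk X i) ≤ c) : frob X ≤ c * Real.sqrt n := by
  refine le_of_sq_le_sq ?_ (by positivity)
  rw [frob_sq_blk, mul_pow, Real.sq_sqrt (Nat.cast_nonneg _)]
  calc ∑ i, frob (blk X i) ^ 2 ≤ ∑ _i : Fin n, c ^ 2 :=
        Finset.sum_le_sum fun i _ => pow_le_pow_left₀ (frob_nonneg _) (h i) 2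
    _ = c ^ 2 * n := by simp [mul_comm]

lemma frob_blk_mono {X : Matrix (Fin n × Fin d) (Fin m) ℝ} {Y : Matrix (Fin n × Fin d) (Fin k) ℝ}
    {c c' : ℝ} (hc : 0 ≤ c) (hc' : 0 ≤ c')
    (h : ∀ i, c * frob (blk X i) ≤ c' * frob (blk Y i)) : c * frob X ≤ c' * frob Y := by
  refine le_of_sq_le_sq ?_ (mul_nonneg hc' (frob_nonneg _))
  rw [mul_pow, mul_pow, frob_sq_blk, frob_sq_blk, Finset.mul_sum, Finset.mul_sum]
  refine Finset.sum_le_sum fun i _ => ?_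
  rw [← mul_pow, ← mul_pow]
  exact pow_le_pow_left₀ (mul_nonneg hc (frob_nonneg _)) (h i) 2

lemma frob_eq_blk_of_forall_ne {X : Matrix (Fin n × Fin d) (Fin m) ℝ} (i : Fin n)
    (h : ∀ j, j ≠ i → blk X j = 0) : frob X = frob (blk X i) := by
  refine (sq_eq_sq₀ (frob_nonneg _) (frob_nonneg _)).1 ?_
  rw [frob_sq_blk]
  exact Finset.sum_eq_single i (fun j _ hj => by simp [h j hj, frob_zero]) (by simp)

lemma opLe_blk {X : Matrix (Fin n × Fin d) (Fin m) ℝ} {c : ℝ} (h : OpLe X c) (i : Fin n) :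
    OpLe (blk X i) c := fun v => by
  refine le_trans (Real.sqrt_le_sqrt ?_) (h v)
  rw [Fintype.sum_prod_type]
  exact Finset.single_le_sum (f := fun i => ∑ a, (X *ᵥ v) (i, a) ^ 2)
    (fun _ _ => Finset.sum_nonneg fun _ _ => sq_nonneg _) (Finset.mem_univ i)

lemma opLe_mask {W : Matrix (Fin n × Fin d) (Fin m) ℝ} {c : ℝ} (h : OpLe W c) (i : Fin n) :
    OpLe (mask W i) c := fun v => by
  refine le_trans (Real.sqrt_le_sqrt ?_) (h v)
  refine Finset.sum_le_sum fun p _ => ?_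
  by_cases hp : p.1 = i
  · have : (mask W i *ᵥ v) p = 0 := by simp [mulVec, dotProduct, mask, hp]
    rw [this, zero_pow two_ne_zero]
    exact sq_nonneg _
  · have : (mask W i *ᵥ v) p = (W *ᵥ v) p := by simp [mulVec, dotProduct, mask, hp]
    rw [this]

lemma transpose_mul_self_of_forall_isOrth {S : Matrix (Fin n × Fin d) (Fin d) ℝ}
    (h : OrthBlocks S) : Sᵀ * S = (n : ℝ) • 1 := by
  rw [transpose_mul_eq_sum_blk, Finset.sum_congr rfl fun i _ => (h i).1]
  simp [← Nat.cast_smul_eq_nsmul ℝ]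

lemma orthBlocks_ZStack : OrthBlocks (ZStack n d) := fun i => by
  rw [blk_ZStack]
  exact IsOrth.one

lemma OrthBlocks.mul {S : Matrix (Fin n × Fin d) (Fin d) ℝ} (h : OrthBlocks S)
    {Q : Matrix (Fin d) (Fin d) ℝ} (hQ : IsOrth Q) : OrthBlocks (S * Q) := fun i => by
  rw [blk_mul]
  exact (h i).mul hQ

lemma OrthBlocks.vnorm_mulVec {S : Matrix (Fin n × Fin d) (Fin d) ℝ} (h : OrthBlocks S)
    (v : Fin d → ℝ) : vnorm (S *ᵥ v) = Real.sqrt n * vnorm v := by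
  refine (sq_eq_sq₀ (vnorm_nonneg _) (mul_nonneg (Real.sqrt_nonneg _) (vnorm_nonneg _))).1 ?_
  rw [mul_pow, Real.sq_sqrt (Nat.cast_nonneg _), vnorm_sq, vnorm_sq, dotProduct_mulVec,
    ← mulVec_transpose, mulVec_mulVec, transpose_mul_self_of_forall_isOrth h, smul_mulVec,
    one_mulVec, smul_dotProduct, smul_eq_mul]

lemma OrthBlocks.opLe {S : Matrix (Fin n × Fin d) (Fin d) ℝ} (h : OrthBlocks S) :
    OpLe S (Real.sqrt n) := fun v => (h.vnorm_mulVec v).le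

lemma OrthBlocks.opLe_transpose {S : Matrix (Fin n × Fin d) (Fin d) ℝ} (h : OrthBlocks S) :
    OpLe Sᵀ (Real.sqrt n) := h.opLe.transpose (Real.sqrt_nonneg _)

lemma OrthBlocks.frob_eq {S : Matrix (Fin n × Fin d) (Fin d) ℝ} (h : OrthBlocks S) :
    frob S = Real.sqrt n * Real.sqrt d := by
  rw [← Real.sqrt_sq (frob_nonneg S), frob_sq, transpose_mul_self_of_forall_isOrth h,
    ← Real.sqrt_mul (Nat.cast_nonneg _)]
  simp

lemma opLe_one_of_isOrth {Q : Matrix (Fin d) (Fin d) ℝ} (hQ : IsOrth Q) : OpLe Q 1 :=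
  opLe_one_of_orthonormal hQ.1

lemma OpGe.mul_isOrth {α : Type*} [Fintype α] {X : Matrix α (Fin d) ℝ} {c : ℝ} (h : OpGe X c)
    {Q : Matrix (Fin d) (Fin d) ℝ} (hQ : IsOrth Q) : OpGe (X * Q) c := fun v => by
  rw [← mulVec_mulVec, ← vnorm_mulVec_of_orthonormal hQ.1 v]
  exact h _

lemma IsPolarBlocks.orthBlocks {X R : Matrix (Fin n × Fin d) (Fin d) ℝ}
    (h : IsPolarBlocks X R) : OrthBlocks R := fun i => (h i).1

lemma IsPolarBlocks.mul_orth {X R : Matrix (Fin n × Fin d) (Fin d) ℝ} (h : IsPolarBlocks X R)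
    {Q : Matrix (Fin d) (Fin d) ℝ} (hQ : IsOrth Q) : IsPolarBlocks (X * Q) (R * Q) := fun i => by
  rw [blk_mul, blk_mul]
  exact (h i).mul_orth hQ

lemma IsPolarBlocks.frob_sub_le {X Y R Q : Matrix (Fin n × Fin d) (Fin d) ℝ}
    (hR : IsPolarBlocks X R) (hQ : IsPolarBlocks Y Q) {τ : ℝ} (hτ : 0 < τ)
    (h : ∀ i, OpGe (blk X i) τ) : τ * frob (R - Q) ≤ 2 * frob (X - Y) :=
  frob_blk_mono hτ.le zero_le_two fun i => (hR i).frob_sub_le (hQ i) hτ (h i)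

end Blocks

section Alignment

variable {n d : ℕ}

/-- The minimizer in `dF S Z` is a polar factor of `ZᵀS`. -/
lemma exists_alignment {S : Matrix (Fin n × Fin d) (Fin d) ℝ} {t : ℝ}
    (ht : t < 1) (hn : 1 ≤ n) (h : dF S (ZStack n d) ≤ t * Real.sqrt n) :
    OpGe ((ZStack n d)ᵀ * S) (n * (1 - t)) ∧ ∃ Q : Matrix (Fin d) (Fin d) ℝ, IsOrth Q ∧
      IsPolar ((ZStack n d)ᵀ * S) Q ∧ frob (S * Qᵀ - ZStack n d) = dF S (ZStack n d) ∧
      ((ZStack n d)ᵀ * (S * Qᵀ))ᵀ = (ZStack n d)ᵀ * (S * Qᵀ) := by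
  obtain ⟨Q, hQ, hd⟩ := exists_dF_eq S (ZStack n d)
  have hn' : (0 : ℝ) < n := by exact_mod_cast hn
  have hZ := orthBlocks_ZStack (n := n) (d := d)
  have hexp : ∀ P : Matrix (Fin d) (Fin d) ℝ, IsOrth P → frob (S - ZStack n d * P) ^ 2 =
      frob S ^ 2 - 2 * trace (Pᵀ * ((ZStack n d)ᵀ * S)) + frob (ZStack n d) ^ 2 := fun P hP => by
    rw [frob_sub_sq, frob_mul_orth _ hP, transpose_mul, Matrix.mul_assoc]
  have hpol : IsPolar ((ZStack n d)ᵀ * S) Q := by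
    rw [isPolar_iff]
    refine ⟨hQ, fun P hP => ?_⟩
    have h1 := dF_le S (ZStack n d) hP
    rw [hd, ← sq_le_sq₀ (frob_nonneg _) (frob_nonneg _), hexp P hP, hexp Q hQ] at h1
    linarith
  have hop : OpGe ((ZStack n d)ᵀ * S) (n * (1 - t)) := by
    have h2 : OpGe ((n : ℝ) • Q) (n * 1) := (opGe_one_of_orthonormal hQ.1).smul hn'.le
    have h3 : (ZStack n d)ᵀ * S - (n : ℝ) • Q = (ZStack n d)ᵀ * (S - ZStack n d * Q) := by
      rw [Matrix.mul_sub, ← Matrix.mul_assoc, transpose_mul_self_of_forall_isOrth hZ,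
        Matrix.smul_mul, Matrix.one_mul]
    have h4 : OpLe ((ZStack n d)ᵀ * S - (n : ℝ) • Q) (Real.sqrt n * (t * Real.sqrt n)) := by
      rw [h3]
      exact hZ.opLe_transpose.mul (Real.sqrt_nonneg _)
        ((opLe_frob _).mono (hd ▸ h))
    refine (h2.of_sub h4).mono (le_of_eq ?_)
    have := Real.mul_self_sqrt hn'.le
    linear_combination t * this
  refine ⟨hop, Q, hQ, hpol, ?_, ?_⟩
  · rw [hd, ← frob_mul_orth _ hQ, Matrix.sub_mul, Matrix.mul_assoc, hQ.1, Matrix.mul_one]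
  · have h5 := (hpol.trace_gap (mul_pos hn' (by linarith)) hop).1
    have h6 : (ZStack n d)ᵀ * (S * Qᵀ) = Q * (Qᵀ * ((ZStack n d)ᵀ * S)) * Qᵀ := by
      rw [← Matrix.mul_assoc, ← Matrix.mul_assoc Q, hQ.2, Matrix.one_mul]
    rw [h6, transpose_mul, transpose_mul, h5, transpose_transpose]
    simp only [Matrix.mul_assoc]

lemma frob_transpose_mul_sub_le {S S' : Matrix (Fin n × Fin d) (Fin d) ℝ} (hS : OrthBlocks S)
    (hS' : OrthBlocks S') (h : ((ZStack n d)ᵀ * S)ᵀ = (ZStack n d)ᵀ * S)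
    (h' : ((ZStack n d)ᵀ * S')ᵀ = (ZStack n d)ᵀ * S') :
    frob ((ZStack n d)ᵀ * (S - S')) ≤
      1 / 2 * frob (S - S') * (frob (S - ZStack n d) + frob (S' - ZStack n d)) := by
  have e1 := transpose_mul_self_of_forall_isOrth hS
  have e2 := transpose_mul_self_of_forall_isOrth hS'
  rw [transpose_mul, transpose_transpose] at h h'
  have key : (2 : ℝ) • ((ZStack n d)ᵀ * (S - S')) =
      -((S' - ZStack n d)ᵀ * (S - S') + (S - S')ᵀ * (S - ZStack n d)) := by
    simp only [transpose_sub, Matrix.sub_mul, Matrix.mul_sub, h, h', e1, e2, two_smul]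
    abel
  have h1 := frob_add_le ((S' - ZStack n d)ᵀ * (S - S')) ((S - S')ᵀ * (S - ZStack n d))
  have h2 := frob_mul_le (S' - ZStack n d)ᵀ (S - S')
  have h3 := frob_mul_le (S - S')ᵀ (S - ZStack n d)
  have h4 := congrArg frob key
  rw [frob_smul, frob_neg, abs_of_pos zero_lt_two] at h4
  rw [frob_transpose] at h2 h3
  linarith

/-- Two block-orthogonal matrices near `Z` can be aligned with `Z` simultaneously without
increasing their distance by more than a constant factor. -/
lemma exists_aligned_pair {S S' : Matrix (Fin n × Fin d) (Fin d) ℝ} (hS : OrthBlocks S)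
    (hS' : OrthBlocks S') (hn : 1 ≤ n) {e : ℝ} (he' : e ≤ 1 / 32)
    (h : dF S (ZStack n d) + dF S' (ZStack n d) ≤ 4 * e * Real.sqrt n) :
    ∃ P P' : Matrix (Fin d) (Fin d) ℝ, IsOrth P ∧ IsOrth P' ∧
      frob (S * P - S' * P') ≤ 2.15 * dF S S' ∧
      frob ((ZStack n d)ᵀ * (S * P - S' * P')) ≤
        2 * e * Real.sqrt n * frob (S * P - S' * P') := by
  have hn' : (0 : ℝ) < n := by exact_mod_cast hn
  have hsn := Real.sqrt_pos.2 hn'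
  have hZ := orthBlocks_ZStack (n := n) (d := d)
  have n1 := dF_nonneg S (ZStack n d)
  have n2 := dF_nonneg S' (ZStack n d)
  have h1 : dF S (ZStack n d) ≤ dF S (ZStack n d) / Real.sqrt n * Real.sqrt n := by
    rw [div_mul_cancel₀ _ hsn.ne']
  have h2 : dF S' (ZStack n d) ≤ dF S' (ZStack n d) / Real.sqrt n * Real.sqrt n := by
    rw [div_mul_cancel₀ _ hsn.ne']
  set t := dF S (ZStack n d) / Real.sqrt n with ht
  set t' := dF S' (ZStack n d) / Real.sqrt n with ht'
  have t0 : 0 ≤ t := div_nonneg n1 hsn.le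
  have t0' : 0 ≤ t' := div_nonneg n2 hsn.le
  have hsum : t + t' ≤ 4 * e := by
    rw [ht, ht', ← add_div, div_le_iff₀ hsn]
    exact h
  obtain ⟨o1, Q, hQ, p1, f1, s1⟩ := exists_alignment (by linarith) hn h1
  obtain ⟨o2, Q', hQ', p2, f2, s2⟩ := exists_alignment (by linarith) hn h2
  refine ⟨Qᵀ, Q'ᵀ, hQ.transpose, hQ'.transpose, ?_, ?_⟩
  · obtain ⟨P, hP, hd⟩ := exists_dF_eq S S'
    have p3 := p2.mul_orth hP
    have h3 := p1.frob_sub_le_of_both p3 (mul_pos hn' (by linarith)) o1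
      (mul_pos hn' (by linarith)) (o2.mul_isOrth hP)
    rw [Matrix.mul_assoc, ← Matrix.mul_sub] at h3
    have h4 := hZ.opLe_transpose.frob_mul hsn.le (S - S' * P)
    rw [← hd] at h4
    have hsq := Real.mul_self_sqrt hn'.le
    have h5 : Real.sqrt n * frob (Q - Q' * P) ≤ 1.1 * dF S S' := by
      have h6 : n * (15 / 8) * frob (Q - Q' * P) ≤ 2 * (Real.sqrt n * dF S S') := by
        refine le_trans ?_ (h3.trans (by linarith))
        refine mul_le_mul_of_nonneg_right ?_ (frob_nonneg _)
        nlinarith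
      have h7 : Real.sqrt n * (15 / 8 * (Real.sqrt n * frob (Q - Q' * P))) ≤
          Real.sqrt n * (2 * dF S S') := by
        calc _ = Real.sqrt n * Real.sqrt n * (15 / 8) * frob (Q - Q' * P) := by ring
          _ ≤ _ := by rw [hsq]; linarith
      have h8 := le_of_mul_le_mul_left h7 hsn
      have := dF_nonneg S S'
      linarith
    have h6 : S * Qᵀ - S' * Q'ᵀ = (S - S' * P) * Qᵀ + S' * P * (Q - Q' * P)ᵀ := by
      rw [transpose_sub, transpose_mul, Matrix.mul_sub, Matrix.sub_mul, Matrix.mul_assoc S' P,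
        Matrix.mul_assoc S' P (Pᵀ * Q'ᵀ), ← Matrix.mul_assoc P, hP.2, Matrix.one_mul]
      abel
    have h7 := (hS'.mul hP).opLe.frob_mul hsn.le (Q - Q' * P)ᵀ
    rw [frob_transpose] at h7
    rw [h6]
    refine (frob_add_le _ _).trans ?_
    rw [frob_mul_orth _ hQ.transpose, ← hd]
    linarith [dF_nonneg S S']
  · have h3 := frob_transpose_mul_sub_le (hS.mul hQ.transpose) (hS'.mul hQ'.transpose) s1 s2
    rw [f1, f2] at h3
    refine h3.trans ?_
    have := mul_le_mul_of_nonneg_left h (frob_nonneg (S * Qᵀ - S' * Q'ᵀ))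
    linarith

end Alignment

/-- The relations between the problem parameters: `a`, `s` are the extreme singular values of `A`,
`e` is the target accuracy and `β` the noise level. -/
structure Scale (n d : ℕ) (a s e β : ℝ) : Prop where
  two_le : 2 ≤ n
  one_le : 1 ≤ d
  s_pos : 0 < s
  s_le : s ≤ a
  β_nonneg : 0 ≤ β
  e_pos : 0 < e
  e_le : e ≤ 1 / 32
  cond : a ^ 2 * e = s ^ 2 / 32
  lin : β * a * Real.sqrt n * Real.sqrt d ≤ s ^ 2 * n * e / 12
  quad : β ^ 2 * Real.sqrt d ≤ s ^ 2 * n * e / 4608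

/-- The deterministic bounds on the noise matrix used in the analysis of the GPM. -/
structure Noise {n d m : ℕ} (A : Matrix (Fin d) (Fin m) ℝ)
    (W : Matrix (Fin n × Fin d) (Fin m) ℝ) (σ B a : ℝ) : Prop where
  opLe : OpLe W (3.2 * B)
  opLe_blk : ∀ i, OpLe (blk W i) (2.3 * B)
  signal : ∀ i, frob (blk W i * Aᵀ) ≤ a * Real.sqrt d * (B / Real.sqrt n)
  self : ∀ i, frob (blk W i * (blk W i)ᵀ) ≤ 1.7 * Real.sqrt d * B ^ 2
  loo : ∀ i, ∀ V : Matrix (Fin n × Fin d) (Fin d) ℝ,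
    IsTopSingVecs (ZStack n d * A + σ • mask W i) V →
      frob (blk W i * (mask W i)ᵀ * V) ≤ 3.2 * B * Real.sqrt d * (B / Real.sqrt n)

namespace Scale

variable {n d : ℕ} {a s e β : ℝ} (h : Scale n d a s e β)
include h

lemma a_pos : 0 < a := h.s_pos.trans_le h.s_le

lemma n_pos : (0 : ℝ) < n := by
  have := h.two_le
  exact_mod_cast (by omega : 0 < n)

lemma sqrt_n_pos : 0 < Real.sqrt n := Real.sqrt_pos.2 h.n_pos

lemma sqrt_n_ge : 1.4142 ≤ Real.sqrt n := by
  refine Real.le_sqrt_of_sq_le ?_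
  have : (2 : ℝ) ≤ n := by exact_mod_cast h.two_le
  linarith

lemma sqrt_d_ge : 1 ≤ Real.sqrt d := Real.one_le_sqrt.2 (by exact_mod_cast h.one_le)

lemma sqrt_n_sq : Real.sqrt n * Real.sqrt n = n := Real.mul_self_sqrt h.n_pos.le

lemma q_pos : 0 < s ^ 2 * n := mul_pos (pow_pos h.s_pos 2) h.n_pos

lemma lin_one : β * a * Real.sqrt n ≤ s ^ 2 * n * e / 12 := by
  refine le_trans ?_ h.lin
  exact le_mul_of_one_le_right
    (mul_nonneg (mul_nonneg h.β_nonneg h.a_pos.le) (Real.sqrt_nonneg _)) h.sqrt_d_ge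

lemma lin_single : β * a * Real.sqrt d ≤ 0.7072 * (s ^ 2 * n * e / 12) := by
  have h1 : β * a * Real.sqrt d * 1.4142 ≤ β * a * Real.sqrt d * Real.sqrt n :=
    mul_le_mul_of_nonneg_left h.sqrt_n_ge
      (mul_nonneg (mul_nonneg h.β_nonneg h.a_pos.le) (Real.sqrt_nonneg _))
  have h2 := h.lin
  have h3 : 0 ≤ β * a * Real.sqrt d :=
    mul_nonneg (mul_nonneg h.β_nonneg h.a_pos.le) (Real.sqrt_nonneg _)
  linarith

lemma quad_one : β ^ 2 ≤ s ^ 2 * n * e / 4608 :=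
  (le_mul_of_one_le_right (sq_nonneg _) h.sqrt_d_ge).trans h.quad

lemma q_mul_e_le : s ^ 2 * n * e ≤ s ^ 2 * n / 32 := by
  have := mul_le_mul_of_nonneg_left h.e_le h.q_pos.le
  linarith

end Scale

section Gram

variable {n d m k : ℕ} {A : Matrix (Fin d) (Fin m) ℝ} {X : Matrix (Fin n × Fin d) (Fin m) ℝ}
  {σ B a s e : ℝ}

lemma opGe_mul_transpose (h : OpGe Aᵀ s) (hs : 0 ≤ s) : OpGe (A * Aᵀ) (s ^ 2) :=
  opGe_of_quadratic fun v => by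
    rw [← mulVec_mulVec, dotProduct_mulVec, ← mulVec_transpose, ← vnorm_sq, ← vnorm_sq, ← mul_pow]
    exact pow_le_pow_left₀ (mul_nonneg hs (vnorm_nonneg _)) (h v) 2

lemma gram_mul (A : Matrix (Fin d) (Fin m) ℝ) (X : Matrix (Fin n × Fin d) (Fin m) ℝ) (σ : ℝ)
    (E : Matrix (Fin n × Fin d) (Fin k) ℝ) :
    (ZStack n d * A + σ • X) * (ZStack n d * A + σ • X)ᵀ * E =
      ZStack n d * (A * Aᵀ * ((ZStack n d)ᵀ * E)) +
        σ • (X * (Aᵀ * ((ZStack n d)ᵀ * E)) + ZStack n d * (A * (Xᵀ * E))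
          + σ • (X * Xᵀ * E)) := by
  simp only [transpose_add, transpose_mul, transpose_smul, Matrix.add_mul, Matrix.mul_add,
    Matrix.smul_mul, Matrix.mul_smul, Matrix.mul_assoc, smul_add]
  abel

lemma frob_gram_le (hA : OpLe A a) (hX : OpLe X (3.2 * B)) (hσ : 0 ≤ σ) (hB : 0 ≤ B)
    (sc : Scale n d a s e (σ * B)) (E : Matrix (Fin n × Fin d) (Fin k) ℝ) :
    frob ((ZStack n d * A + σ • X) * (ZStack n d * A + σ • X)ᵀ * E) ≤
      Real.sqrt n * a ^ 2 * frob ((ZStack n d)ᵀ * E) + 0.017 * (s ^ 2 * n) * frob E := by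
  have hZ := orthBlocks_ZStack (n := n) (d := d)
  have ha := sc.a_pos.le
  have hn := sc.sqrt_n_pos.le
  have hw : 0 ≤ 3.2 * B := by positivity
  have hXt := hX.transpose hw
  have hAt := hA.transpose ha
  have hE := frob_nonneg E
  have h1 : frob (ZStack n d * (A * Aᵀ * ((ZStack n d)ᵀ * E))) ≤
      Real.sqrt n * (a * a * frob ((ZStack n d)ᵀ * E)) :=
    (hZ.opLe.frob_mul hn _).trans (mul_le_mul_of_nonneg_left
      ((hA.mul ha hAt).frob_mul (by positivity) _) hn)
  have h2 : frob (X * (Aᵀ * ((ZStack n d)ᵀ * E))) ≤ 3.2 * B * (a * (Real.sqrt n * frob E)) :=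
    (hX.frob_mul hw _).trans (mul_le_mul_of_nonneg_left ((hAt.frob_mul ha _).trans
      (mul_le_mul_of_nonneg_left (hZ.opLe_transpose.frob_mul hn _) ha)) hw)
  have h3 : frob (ZStack n d * (A * (Xᵀ * E))) ≤ Real.sqrt n * (a * (3.2 * B * frob E)) :=
    (hZ.opLe.frob_mul hn _).trans (mul_le_mul_of_nonneg_left ((hA.frob_mul ha _).trans
      (mul_le_mul_of_nonneg_left (hXt.frob_mul hw _) ha)) hn)
  have h4 : frob (X * Xᵀ * E) ≤ 3.2 * B * (3.2 * B) * frob E :=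
    (hX.mul hw hXt).frob_mul (by positivity) _
  rw [gram_mul]
  refine (frob_add_le _ _).trans ?_
  rw [frob_smul, abs_of_nonneg hσ]
  have h5 := frob_add_le (X * (Aᵀ * ((ZStack n d)ᵀ * E)) + ZStack n d * (A * (Xᵀ * E)))
    (σ • (X * Xᵀ * E))
  have h6 := frob_add_le (X * (Aᵀ * ((ZStack n d)ᵀ * E))) (ZStack n d * (A * (Xᵀ * E)))
  rw [frob_smul, abs_of_nonneg hσ] at h5
  have h7 := mul_le_mul_of_nonneg_left h4 hσ
  have h8 := mul_le_mul_of_nonneg_left (h5.trans (add_le_add (h6.trans (add_le_add h2 h3)) h7)) hσ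
  have h9 : 6.4 * (σ * B * a * Real.sqrt n) + 10.24 * (σ * B) ^ 2 ≤ 0.017 * (s ^ 2 * n) := by
    linarith [sc.lin_one, sc.quad_one, sc.q_mul_e_le, sc.q_pos]
  have h10 := mul_le_mul_of_nonneg_right h9 hE
  linarith

lemma blk_gram_sub (W : Matrix (Fin n × Fin d) (Fin m) ℝ) (S : Matrix (Fin n × Fin d) (Fin d) ℝ)
    (j : Fin n) : blk ((ZStack n d * A + σ • W) * (ZStack n d * A + σ • W)ᵀ * S) j
        - A * Aᵀ * ((ZStack n d)ᵀ * S) =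
      σ • (blk W j * Aᵀ * ((ZStack n d)ᵀ * S) + A * (Wᵀ * S) + σ • (blk W j * Wᵀ * S)) := by
  rw [gram_mul, blk_add, blk_ZStack_mul, blk_smul, blk_add, blk_add, blk_smul, blk_ZStack_mul,
    blk_mul, Matrix.mul_assoc W, blk_mul, add_sub_cancel_left, Matrix.mul_assoc (blk W j),
    Matrix.mul_assoc (blk W j)]

lemma frob_blk_gram_sub_le {W : Matrix (Fin n × Fin d) (Fin m) ℝ} (hA : OpLe A a)
    (hW : Noise A W σ B a) (hσ : 0 ≤ σ) (hB : 0 ≤ B) (sc : Scale n d a s e (σ * B))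
    {S : Matrix (Fin n × Fin d) (Fin d) ℝ} (hS : OrthBlocks S) (j : Fin n)
    (h : frob (blk W j * Wᵀ * S) ≤ 3 * Real.sqrt d * B ^ 2) :
    frob (blk ((ZStack n d * A + σ • W) * (ZStack n d * A + σ • W)ᵀ * S) j
        - A * Aᵀ * ((ZStack n d)ᵀ * S)) ≤ 0.351 * (s ^ 2 * n * e) := by
  have hZ := orthBlocks_ZStack (n := n) (d := d)
  have ha := sc.a_pos.le
  have hn := sc.sqrt_n_pos
  have hw : 0 ≤ 3.2 * B := by positivity
  have h1 : frob (blk W j * Aᵀ * ((ZStack n d)ᵀ * S)) ≤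
      Real.sqrt n * Real.sqrt n * (a * Real.sqrt d * (B / Real.sqrt n)) :=
    ((hZ.opLe_transpose.mul hn.le hS.opLe).mul_frob (by positivity) _).trans
      (mul_le_mul_of_nonneg_left (hW.signal j) (by positivity))
  have h1' : Real.sqrt n * Real.sqrt n * (a * Real.sqrt d * (B / Real.sqrt n)) =
      B * a * Real.sqrt n * Real.sqrt d := by
    field_simp
  have h2 : frob (A * (Wᵀ * S)) ≤ a * (3.2 * B * (Real.sqrt n * Real.sqrt d)) := by
    refine (hA.frob_mul ha _).trans (mul_le_mul_of_nonneg_left ?_ ha)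
    rw [← hS.frob_eq]
    exact (hW.opLe.transpose hw).frob_mul hw _
  rw [blk_gram_sub, frob_smul, abs_of_nonneg hσ]
  have h5 := frob_add_le (blk W j * Aᵀ * ((ZStack n d)ᵀ * S) + A * (Wᵀ * S))
    (σ • (blk W j * Wᵀ * S))
  have h6 := frob_add_le (blk W j * Aᵀ * ((ZStack n d)ᵀ * S)) (A * (Wᵀ * S))
  rw [frob_smul, abs_of_nonneg hσ] at h5
  have h7 := mul_le_mul_of_nonneg_left h hσ
  have h8 := mul_le_mul_of_nonneg_left
    (h5.trans (add_le_add (h6.trans (add_le_add (h1.trans_eq h1') h2)) h7)) hσ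
  have h9 := sc.lin
  have h10 := sc.quad
  have := sc.q_pos
  have := mul_pos sc.q_pos sc.e_pos
  linarith

lemma opGe_signal (hA' : OpGe Aᵀ s) (sc : Scale n d a s e (σ * B))
    {S : Matrix (Fin n × Fin d) (Fin d) ℝ}
    (h : dF S (ZStack n d) ≤ 1.5 * e * Real.sqrt n) :
    OpGe (A * Aᵀ * ((ZStack n d)ᵀ * S)) (0.953 * (s ^ 2 * n)) := by
  have h1 := (exists_alignment (by linarith [sc.e_le]) (by linarith [sc.two_le]) h).1
  refine ((opGe_mul_transpose hA' sc.s_pos.le).mul (sq_nonneg s) h1).mono ?_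
  have := mul_le_mul_of_nonneg_left sc.e_le sc.q_pos.le
  linarith [sc.q_pos]

lemma opGe_blk_gram {W : Matrix (Fin n × Fin d) (Fin m) ℝ} (hA : OpLe A a) (hA' : OpGe Aᵀ s)
    (hW : Noise A W σ B a) (hσ : 0 ≤ σ) (hB : 0 ≤ B) (sc : Scale n d a s e (σ * B))
    {S : Matrix (Fin n × Fin d) (Fin d) ℝ} (hS : OrthBlocks S)
    (hd : dF S (ZStack n d) ≤ 1.5 * e * Real.sqrt n) (j : Fin n)
    (h : frob (blk W j * Wᵀ * S) ≤ 3 * Real.sqrt d * B ^ 2) :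
    OpGe (blk ((ZStack n d * A + σ • W) * (ZStack n d * A + σ • W)ᵀ * S) j)
      (0.94 * (s ^ 2 * n)) := by
  have h1 := opGe_signal hA' sc hd
  have h2 := frob_blk_gram_sub_le hA hW hσ hB sc hS j h
  refine (h1.of_sub ((opLe_frob _).mono h2)).mono ?_
  linarith [sc.q_mul_e_le, sc.q_pos]

/-- One step of the GPM started near `Z` lands even nearer to `Z`. -/
lemma dF_step_ZStack_le {W : Matrix (Fin n × Fin d) (Fin m) ℝ} (hA : OpLe A a) (hA' : OpGe Aᵀ s)
    (hW : Noise A W σ B a) (hσ : 0 ≤ σ) (hB : 0 ≤ B) (sc : Scale n d a s e (σ * B))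
    {S R : Matrix (Fin n × Fin d) (Fin d) ℝ} (hS : OrthBlocks S)
    (hd : dF S (ZStack n d) ≤ 1.5 * e * Real.sqrt n)
    (h : ∀ j, frob (blk W j * Wᵀ * S) ≤ 3 * Real.sqrt d * B ^ 2)
    (hR : IsPolarBlocks ((ZStack n d * A + σ • W) * (ZStack n d * A + σ • W)ᵀ * S) R) :
    dF R (ZStack n d) ≤ e * Real.sqrt n / 2 := by
  have hq := sc.q_pos
  have h1 := opGe_signal hA' sc hd
  obtain ⟨P, hP⟩ := exists_isPolar (A * Aᵀ * ((ZStack n d)ᵀ * S))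
  have h2 : ∀ j, frob (blk (R - ZStack n d * P) j) ≤ e / 2 := fun j => by
    rw [blk_sub, blk_ZStack_mul]
    have h3 := (hR j).frob_sub_le_of_both hP (by positivity)
      (opGe_blk_gram hA hA' hW hσ hB sc hS hd j (h j)) (by positivity) h1
    have h4 := frob_blk_gram_sub_le hA hW hσ hB sc hS j (h j)
    refine le_of_mul_le_mul_left ?_ hq
    have := frob_nonneg (blk R j - P)
    nlinarith
  have h5 := (dF_le R (ZStack n d) hP.1).trans
    (frob_le_of_blk (by linarith [sc.e_pos]) h2)
  linarith

/-- The GPM step is a contraction near `Z`, up to the discrepancy between the two data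
matrices. -/
lemma dF_step_le {W X : Matrix (Fin n × Fin d) (Fin m) ℝ} (hA : OpLe A a) (hA' : OpGe Aᵀ s)
    (hW : Noise A W σ B a) (hσ : 0 ≤ σ) (hB : 0 ≤ B) (sc : Scale n d a s e (σ * B))
    {S S' R R' : Matrix (Fin n × Fin d) (Fin d) ℝ} (hS : OrthBlocks S) (hS' : OrthBlocks S')
    (hd : dF S (ZStack n d) ≤ 1.5 * e * Real.sqrt n)
    (hdd : dF S (ZStack n d) + dF S' (ZStack n d) ≤ 4 * e * Real.sqrt n)
    (h : ∀ j, frob (blk W j * Wᵀ * S) ≤ 3 * Real.sqrt d * B ^ 2)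
    (hR : IsPolarBlocks ((ZStack n d * A + σ • W) * (ZStack n d * A + σ • W)ᵀ * S) R)
    (hR' : IsPolarBlocks ((ZStack n d * A + σ • X) * (ZStack n d * A + σ • X)ᵀ * S') R') :
    0.94 * (s ^ 2 * n) * dF R R' ≤ 0.4 * (s ^ 2 * n) * dF S S' +
      2 * frob (((ZStack n d * A + σ • W) * (ZStack n d * A + σ • W)ᵀ -
        (ZStack n d * A + σ • X) * (ZStack n d * A + σ • X)ᵀ) * S') := by
  have hq := sc.q_pos
  obtain ⟨P, P', hP, hP', h1, h2⟩ :=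
    exists_aligned_pair hS hS' (by linarith [sc.two_le]) sc.e_le hdd
  have h3 := (hR.mul_orth hP).frob_sub_le (hR'.mul_orth hP') (τ := 0.94 * (s ^ 2 * n))
    (by positivity) fun i => by
      rw [blk_mul]
      exact (opGe_blk_gram hA hA' hW hσ hB sc hS hd i (h i)).mul_isOrth hP
  have h4 := dF_le_mul R R' hP hP'
  have h5 := frob_gram_le hA hW.opLe hσ hB sc (S * P - S' * P')
  set C := (ZStack n d * A + σ • W) * (ZStack n d * A + σ • W)ᵀ with hC
  set C' := (ZStack n d * A + σ • X) * (ZStack n d * A + σ • X)ᵀ with hC'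
  have h6 : C * S * P - C' * S' * P' = C * (S * P - S' * P') + (C - C') * S' * P' := by
    simp only [Matrix.mul_sub, Matrix.sub_mul, Matrix.mul_assoc]
    abel
  have h7 := frob_add_le (C * (S * P - S' * P')) ((C - C') * S' * P')
  rw [← h6, frob_mul_orth _ hP'] at h7
  have hn := sc.sqrt_n_sq
  have h8 : Real.sqrt n * a ^ 2 * frob ((ZStack n d)ᵀ * (S * P - S' * P')) ≤
      s ^ 2 * n / 16 * frob (S * P - S' * P') := by
    calc _ ≤ Real.sqrt n * a ^ 2 * (2 * e * Real.sqrt n * frob (S * P - S' * P')) :=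
          mul_le_mul_of_nonneg_left h2 (by positivity)
      _ = 2 * (a ^ 2 * e) * (Real.sqrt n * Real.sqrt n) * frob (S * P - S' * P') := by ring
      _ = _ := by rw [sc.cond, hn]; ring
  have h9 : 0.94 * (s ^ 2 * n) * dF R R' ≤ 0.94 * (s ^ 2 * n) * frob (R * P - R' * P') :=
    mul_le_mul_of_nonneg_left h4 (by positivity)
  have h10 := mul_le_mul_of_nonneg_left h1 hq.le
  have h11 := mul_nonneg hq.le (dF_nonneg S S')
  linarith

/-- The effect of removing the `i`-th noise block from the data matrix. -/
lemma frob_gram_sub_mask_le {W : Matrix (Fin n × Fin d) (Fin m) ℝ}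
    (hW : Noise A W σ B a) (hσ : 0 ≤ σ) (hB : 0 ≤ B) (sc : Scale n d a s e (σ * B)) (i : Fin n)
    {V : Matrix (Fin n × Fin d) (Fin d) ℝ} (hV : OpLe V (Real.sqrt n))
    (hVi : OpLe (blk V i) 1.01)
    (h : frob (blk W i * (mask W i)ᵀ * V) ≤ 3.2 * Real.sqrt d * B ^ 2) :
    frob (((ZStack n d * A + σ • W) * (ZStack n d * A + σ • W)ᵀ -
      (ZStack n d * A + σ • mask W i) * (ZStack n d * A + σ • mask W i)ᵀ) * V) ≤
      0.146 * (s ^ 2 * n * e) := by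
  have hZ := orthBlocks_ZStack (n := n) (d := d)
  have ha := sc.a_pos.le
  have hn := sc.sqrt_n_pos
  set M := mask W i with hM
  set P := W - M with hP
  have hPi : ∀ j, blk P j = if j = i then blk W i else 0 := fun j => by
    rw [hP, blk_sub, hM, blk_mask]
    split_ifs with hj <;> simp [hj]
  have hPt : Pᵀ * V = (blk W i)ᵀ * blk V i := by
    rw [transpose_mul_eq_sum_blk, Finset.sum_eq_single i]
    · simp [hPi]
    · intro j _ hj; simp [hPi, hj]
    · simp
  have hfP : ∀ Y : Matrix (Fin m) (Fin d) ℝ, frob (P * Y) = frob (blk W i * Y) := fun Y => by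
    rw [frob_eq_blk_of_forall_ne i, blk_mul, hPi, if_pos rfl]
    intro j hj
    rw [blk_mul, hPi, if_neg hj, Matrix.zero_mul]
  have hWM : W = M + P := by rw [hP]; abel
  have hWt : Wᵀ * V = Mᵀ * V + (blk W i)ᵀ * blk V i := by
    rw [hWM, transpose_add, Matrix.add_mul, hPt, ← hWM]
  have key : ((ZStack n d * A + σ • W) * (ZStack n d * A + σ • W)ᵀ -
      (ZStack n d * A + σ • M) * (ZStack n d * A + σ • M)ᵀ) * V =
      σ • (P * (Aᵀ * ((ZStack n d)ᵀ * V)) + ZStack n d * (A * ((blk W i)ᵀ * blk V i))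
        + σ • (P * (Mᵀ * V + (blk W i)ᵀ * blk V i)) + σ • (M * ((blk W i)ᵀ * blk V i))) := by
    rw [Matrix.sub_mul, gram_mul, gram_mul, Matrix.mul_assoc W, Matrix.mul_assoc M, ← hWt, ← hPt]
    simp only [hP, Matrix.sub_mul, Matrix.mul_sub, transpose_sub, smul_add, smul_sub]
    abel
  have b1 : frob (P * (Aᵀ * ((ZStack n d)ᵀ * V))) ≤ B * a * Real.sqrt n * Real.sqrt d := by
    rw [hfP, ← Matrix.mul_assoc]
    refine (((hZ.opLe_transpose.mul hn.le hV).mul_frob (by positivity) _).trans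
      (mul_le_mul_of_nonneg_left (hW.signal i) (by positivity))).trans (le_of_eq ?_)
    field_simp
  have b2 : frob (ZStack n d * (A * ((blk W i)ᵀ * blk V i))) ≤ 1.01 * (B * a * Real.sqrt d) := by
    refine (hZ.opLe.frob_mul hn.le _).trans ?_
    rw [← Matrix.mul_assoc]
    have h1 : frob (A * (blk W i)ᵀ) ≤ a * Real.sqrt d * (B / Real.sqrt n) := by
      rw [← frob_transpose, transpose_mul, transpose_transpose]
      exact hW.signal i
    refine (mul_le_mul_of_nonneg_left ((hVi.mul_frob (by norm_num) _).trans
      (mul_le_mul_of_nonneg_left h1 (by norm_num))) hn.le).trans (le_of_eq ?_)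
    field_simp
  have b3 : frob (P * (Mᵀ * V + (blk W i)ᵀ * blk V i)) ≤ 4.917 * Real.sqrt d * B ^ 2 := by
    rw [hfP, Matrix.mul_add, ← Matrix.mul_assoc, ← Matrix.mul_assoc]
    refine (frob_add_le _ _).trans ?_
    have := (hVi.mul_frob (by norm_num) (blk W i * (blk W i)ᵀ)).trans
      (mul_le_mul_of_nonneg_left (hW.self i) (by norm_num))
    linarith
  have b4 : frob (M * ((blk W i)ᵀ * blk V i)) ≤ 7.44 * Real.sqrt d * B ^ 2 := by
    have h1 : frob (blk V i) ≤ 1.01 * Real.sqrt d := by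
      have := hVi.frob_mul (by norm_num) (1 : Matrix (Fin d) (Fin d) ℝ)
      rwa [Matrix.mul_one, frob_orthonormal (U := (1 : Matrix (Fin d) (Fin d) ℝ)) (by simp)] at this
    have h2 := ((hW.opLe_blk i).transpose (by positivity)).frob_mul (by positivity) (blk V i)
    have h3 := (opLe_mask hW.opLe i).frob_mul (by positivity) ((blk W i)ᵀ * blk V i)
    have h4 := mul_le_mul_of_nonneg_left h1 (by positivity : 0 ≤ 2.3 * B)
    have h5 := mul_le_mul_of_nonneg_left (h2.trans h4) (by positivity : 0 ≤ 3.2 * B)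
    refine (h3.trans h5).trans ?_
    have : 0 ≤ Real.sqrt d * B ^ 2 := by positivity
    linarith
  rw [key, frob_smul, abs_of_nonneg hσ]
  have c1 := frob_add_le (P * (Aᵀ * ((ZStack n d)ᵀ * V)) +
    ZStack n d * (A * ((blk W i)ᵀ * blk V i)) + σ • (P * (Mᵀ * V + (blk W i)ᵀ * blk V i)))
    (σ • (M * ((blk W i)ᵀ * blk V i)))
  have c2 := frob_add_le (P * (Aᵀ * ((ZStack n d)ᵀ * V)) +
    ZStack n d * (A * ((blk W i)ᵀ * blk V i))) (σ • (P * (Mᵀ * V + (blk W i)ᵀ * blk V i)))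
  have c3 := frob_add_le (P * (Aᵀ * ((ZStack n d)ᵀ * V)))
    (ZStack n d * (A * ((blk W i)ᵀ * blk V i)))
  rw [frob_smul, abs_of_nonneg hσ] at c1 c2
  have c4 := mul_le_mul_of_nonneg_left b3 hσ
  have c5 := mul_le_mul_of_nonneg_left b4 hσ
  have c6 := mul_le_mul_of_nonneg_left (c1.trans (add_le_add (c2.trans (add_le_add
    (c3.trans (add_le_add b1 b2)) c4)) c5)) hσ
  have c7 := sc.lin
  have c8 := sc.lin_single
  have c9 := sc.quad
  have := mul_pos sc.q_pos sc.e_pos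
  linarith

/-- Closeness to a leave-one-out iterate controls the correlation with the left-out noise block. -/
lemma frob_blk_mul_le_of_loo {W : Matrix (Fin n × Fin d) (Fin m) ℝ}
    (hW : Noise A W σ B a) (hB : 0 ≤ B) (sc : Scale n d a s e (σ * B)) (i : Fin n)
    {S S' : Matrix (Fin n × Fin d) (Fin d) ℝ} (hS' : OrthBlocks S') (hd : dF S S' ≤ e)
    (h : frob (blk W i * (mask W i)ᵀ * S') ≤ Real.sqrt d * B ^ 2) :
    frob (blk W i * Wᵀ * S) ≤ 3 * Real.sqrt d * B ^ 2 := by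
  obtain ⟨Q, hQ, hQd⟩ := exists_dF_eq S S'
  have e1 : Wᵀ * S' = (mask W i)ᵀ * S' + (blk W i)ᵀ * blk S' i := by
    rw [transpose_mul_eq_sum_blk, transpose_mul_eq_sum_blk,
      ← Finset.add_sum_erase _ _ (Finset.mem_univ i), ← Finset.add_sum_erase (a := i) Finset.univ
        (fun j => (blk (mask W i) j)ᵀ * blk S' j) (Finset.mem_univ i)]
    simp only [blk_mask, if_true, transpose_zero, Matrix.zero_mul, zero_add]
    rw [add_comm]
    congr 1
    refine Finset.sum_congr rfl fun j hj => ?_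
    rw [if_neg (Finset.ne_of_mem_erase hj)]
  have e2 : blk W i * Wᵀ * S = blk W i * Wᵀ * (S - S' * Q) +
      (blk W i * (mask W i)ᵀ * S' + blk W i * (blk W i)ᵀ * blk S' i) * Q := by
    have : blk W i * (mask W i)ᵀ * S' + blk W i * (blk W i)ᵀ * blk S' i =
        blk W i * (Wᵀ * S') := by
      rw [e1, Matrix.mul_add, Matrix.mul_assoc, Matrix.mul_assoc]
    rw [this]
    simp only [Matrix.mul_sub, Matrix.mul_assoc]
    abel
  have b1 : frob (blk W i * Wᵀ * (S - S' * Q)) ≤ 2.3 * B * (3.2 * B) * e :=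
    (((hW.opLe_blk i).mul (by positivity) (hW.opLe.transpose (by positivity))).frob_mul
      (by positivity) _).trans (mul_le_mul_of_nonneg_left (hQd ▸ hd) (by positivity))
  have b2 := (opLe_one_of_isOrth (hS' i)).mul_frob zero_le_one (blk W i * (blk W i)ᵀ)
  have b3 := hW.self i
  rw [e2]
  refine (frob_add_le _ _).trans ?_
  rw [frob_mul_orth _ hQ]
  have b4 := frob_add_le (blk W i * (mask W i)ᵀ * S') (blk W i * (blk W i)ᵀ * blk S' i)
  have b5 : B ^ 2 * e ≤ B ^ 2 * Real.sqrt d / 32 := by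
    have h1 := mul_le_mul_of_nonneg_left sc.e_le (sq_nonneg B)
    have h2 := mul_le_mul_of_nonneg_left sc.sqrt_d_ge (sq_nonneg B)
    linarith
  have : 0 ≤ Real.sqrt d * B ^ 2 := by positivity
  linarith

end Gram

section Iteration

variable {n d m : ℕ} {A : Matrix (Fin d) (Fin m) ℝ} {W : Matrix (Fin n × Fin d) (Fin m) ℝ}
  {σ B a s e : ℝ}

lemma IsGPM.orthBlocks {D : Matrix (Fin n × Fin d) (Fin m) ℝ}
    {S : ℕ → Matrix (Fin n × Fin d) (Fin d) ℝ} (h : IsGPM D S) : ∀ t, OrthBlocks (S t)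
  | 0 => h.1.choose_spec.2.orthBlocks
  | t + 1 => (h.2 t).orthBlocks

lemma iterates_near (hA : OpLe A a) (hA' : OpGe Aᵀ s)
    (hW : Noise A W σ B a) (hσ : 0 ≤ σ) (hB : 0 ≤ B) (sc : Scale n d a s e (σ * B))
    {S : ℕ → Matrix (Fin n × Fin d) (Fin d) ℝ} (hS : IsGPM (ZStack n d * A + σ • W) S)
    {Sl : Fin n → ℕ → Matrix (Fin n × Fin d) (Fin d) ℝ}
    (hSl : ∀ i, IsGPM (ZStack n d * A + σ • mask W i) (Sl i)) {T : ℕ}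
    (hloo : ∀ i, ∀ t ≤ T, frob (blk W i * (mask W i)ᵀ * Sl i t) ≤ Real.sqrt d * B ^ 2)
    (h0 : ∀ i, dF (S 0) (Sl i 0) ≤ e) (h0' : dF (S 0) (ZStack n d) ≤ 1.5 * e * Real.sqrt n) :
    ∀ t ≤ T, (∀ i, dF (S t) (Sl i t) ≤ e) ∧ dF (S t) (ZStack n d) ≤ 1.5 * e * Real.sqrt n ∧
      (1 ≤ t → dF (S t) (ZStack n d) ≤ e * Real.sqrt n / 2) := by
  intro t
  induction t with
  | zero => exact fun _ => ⟨h0, h0', fun h => absurd h (by norm_num)⟩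
  | succ t ih =>
    intro ht
    obtain ⟨h1, h2, -⟩ := ih (by omega)
    have he := sc.e_pos
    have hn := sc.sqrt_n_ge
    have hen := mul_pos he sc.sqrt_n_pos
    have hq := sc.q_pos
    have h3 : ∀ j, frob (blk W j * Wᵀ * S t) ≤ 3 * Real.sqrt d * B ^ 2 := fun j =>
      frob_blk_mul_le_of_loo hW hB sc j ((hSl j).orthBlocks t) (h1 j) (hloo j t (by omega))
    have h4 := dF_step_ZStack_le hA hA' hW hσ hB sc (hS.orthBlocks t) h2 h3 (hS.2 t)
    refine ⟨fun i => ?_, by linarith, fun _ => h4⟩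
    have h5 := dF_triangle (Sl i t) (S t) (ZStack n d)
    rw [dF_comm (Sl i t) (S t)] at h5
    have h6 : dF (S t) (ZStack n d) + dF (Sl i t) (ZStack n d) ≤ 4 * e * Real.sqrt n := by
      have := h1 i
      nlinarith
    have h7 := dF_step_le hA hA' hW hσ hB sc (hS.orthBlocks t) ((hSl i).orthBlocks t) h2 h6 h3
      (hS.2 t) ((hSl i).2 t)
    have h8 := frob_gram_sub_mask_le hW hσ hB sc i ((hSl i).orthBlocks t).opLe
      ((opLe_one_of_isOrth ((hSl i).orthBlocks t i)).mono (by norm_num))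
      ((hloo i t (by omega)).trans (by
        have : 0 ≤ Real.sqrt d * B ^ 2 := by positivity
        linarith))
    have h9 := mul_le_mul_of_nonneg_left (h1 i) hq.le
    refine le_of_mul_le_mul_left ?_ hq
    have := mul_pos hq he
    have := mul_nonneg hq.le (dF_nonneg (S (t + 1)) (Sl i (t + 1)))
    linarith

lemma iterates_in_basin (hA : OpLe A a) (hA' : OpGe Aᵀ s)
    (hW : Noise A W σ B a) (hσ : 0 ≤ σ) (hB : 0 ≤ B) (sc : Scale n d a s e (σ * B))
    {S : ℕ → Matrix (Fin n × Fin d) (Fin d) ℝ} (hS : IsGPM (ZStack n d * A + σ • W) S)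
    {Sl : Fin n → ℕ → Matrix (Fin n × Fin d) (Fin d) ℝ}
    (hSl : ∀ i, IsGPM (ZStack n d * A + σ • mask W i) (Sl i)) {T : ℕ}
    (hloo : ∀ i, ∀ t ≤ T, frob (blk W i * (mask W i)ᵀ * Sl i t) ≤ Real.sqrt d * B ^ 2)
    (h0 : ∀ i, dF (S 0) (Sl i 0) ≤ e) (h0' : dF (S 0) (ZStack n d) ≤ 1.5 * e * Real.sqrt n) :
    ∀ t, 1 ≤ t → t ≤ T → (∀ i, dF (S t) (Sl i t) ≤ e) ∧
      (∀ i, frob (blk W i * Wᵀ * S t) ≤ 3 * Real.sqrt d * B ^ 2) ∧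
      dF (S t) (ZStack n d) ≤ e * Real.sqrt n / 2 ∧
      dF (S (t + 1)) (S t) ≤ 1 / 2 * dF (S t) (S (t - 1)) ∧
      dF (S (t + 1)) (S t) ≤ (1 / 2 : ℝ) ^ t * dF (S 1) (S 0) := by
  have near := iterates_near hA hA' hW hσ hB sc hS hSl hloo h0 h0'
  have corr : ∀ t ≤ T, ∀ i, frob (blk W i * Wᵀ * S t) ≤ 3 * Real.sqrt d * B ^ 2 := fun t ht i =>
    frob_blk_mul_le_of_loo hW hB sc i ((hSl i).orthBlocks t) ((near t ht).1 i) (hloo i t ht)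
  have contr : ∀ t, t + 1 ≤ T → dF (S (t + 2)) (S (t + 1)) ≤ 1 / 2 * dF (S (t + 1)) (S t) := by
    intro t ht
    have h1 := (near (t + 1) ht).2
    have h2 := (near t (by omega)).2.1
    have h3 := h1.2 (by omega)
    have hen := mul_pos sc.e_pos sc.sqrt_n_pos
    have h4 := dF_step_le hA hA' hW hσ hB sc (hS.orthBlocks (t + 1)) (hS.orthBlocks t) h1.1
      (by linarith) (corr (t + 1) ht) (hS.2 (t + 1)) (hS.2 t)
    rw [sub_self, Matrix.zero_mul, frob_zero] at h4
    refine le_of_mul_le_mul_left ?_ sc.q_pos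
    have := mul_nonneg sc.q_pos.le (dF_nonneg (S (t + 1)) (S t))
    linarith
  have pow : ∀ t, t ≤ T → dF (S (t + 1)) (S t) ≤ (1 / 2 : ℝ) ^ t * dF (S 1) (S 0) := by
    intro t
    induction t with
    | zero => simp
    | succ t ih =>
      intro ht
      have := ih (by omega)
      refine (contr t ht).trans ?_
      rw [pow_succ]
      linarith
  intro t h1 ht
  obtain ⟨u, rfl⟩ : ∃ u, t = u + 1 := ⟨t - 1, by omega⟩
  exact ⟨(near _ ht).1, corr _ ht, (near _ ht).2.2 h1, contr u ht, pow _ ht⟩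

end Iteration

section Spectral

variable {N : Type*} [Fintype N] {d m : ℕ} {D : Matrix N (Fin m) ℝ} {U : Matrix N (Fin d) ℝ}

lemma vnorm_sq_transpose_mulVec (D : Matrix N (Fin m) ℝ) (y : N → ℝ) :
    vnorm (Dᵀ *ᵥ y) ^ 2 = y ⬝ᵥ ((D * Dᵀ) *ᵥ y) := by
  rw [vnorm_sq, ← mulVec_mulVec, dotProduct_mulVec y, ← mulVec_transpose]

/-- Variational characterization of top singular vectors, tested against replacing the column
`U x` by a vector `y` orthogonal to the complement of `x` in the column space of `U`. -/
lemma IsTopSingVecs.vnorm_le (h : IsTopSingVecs D U) {x : Fin d → ℝ} (hx : vnorm x = 1)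
    {y : N → ℝ} {c : ℝ} (hy : Uᵀ *ᵥ y = c • x) :
    vnorm (Dᵀ *ᵥ y) ≤ vnorm y * vnorm (Dᵀ *ᵥ (U *ᵥ x)) := by
  have hxx : x ⬝ᵥ x = 1 := by rw [← vnorm_sq, hx, one_pow]
  have unit : ∀ (y : N → ℝ) (c : ℝ), vnorm y = 1 → Uᵀ *ᵥ y = c • x →
      vnorm (Dᵀ *ᵥ y) ≤ vnorm (Dᵀ *ᵥ (U *ᵥ x)) := by
    intro y c hy1 hy
    have hyy : y ⬝ᵥ y = 1 := by rw [← vnorm_sq, hy1, one_pow]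
    have hyU : y ᵥ* U = c • x := by rw [← mulVec_transpose, hy]
    set R := vecMulVec x x with hR
    have hRt : Rᵀ = R := by rw [hR, transpose_vecMulVec]
    have hRR : R * R = R := by rw [hR, vecMulVec_mul_vecMulVec, hxx, one_smul]
    have hRx : R *ᵥ x = x := by
      ext i
      simp [hR, vecMulVec, mulVec, dotProduct, mul_assoc, ← Finset.mul_sum]
      rw [show ∑ i, x i * x i = 1 from hxx, mul_one]
    set Q := U - U * R + vecMulVec y x with hQ
    have hUy : Uᵀ * vecMulVec y x = c • R := by
      rw [mul_vecMulVec, hy, hR, smul_vecMulVec]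
    have hQU : Qᵀ * Q = 1 := by
      have t1 : Qᵀ = Uᵀ - R * Uᵀ + vecMulVec x y := by
        rw [hQ, transpose_add, transpose_sub, transpose_mul, hRt, transpose_vecMulVec]
      have t2 : vecMulVec x y * U = c • R := by
        rw [vecMulVec_mul, hyU, hR, vecMulVec_smul]
      have t3 : vecMulVec x y * vecMulVec y x = R := by
        rw [vecMulVec_mul_vecMulVec, hyy, one_smul]
      rw [t1, hQ]
      simp only [Matrix.add_mul, Matrix.mul_add, Matrix.sub_mul, Matrix.mul_sub,
        Matrix.mul_assoc, h.1, hUy]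
      simp only [← Matrix.mul_assoc, t2, t3, h.1, Matrix.mul_one, hRR, Matrix.smul_mul,
        Matrix.mul_smul]
      rw [Matrix.one_mul]
      abel
    have hQQ : Q * Qᵀ = U * Uᵀ - vecMulVec (U *ᵥ x) (U *ᵥ x) + vecMulVec y y := by
      have t1 : Qᵀ = Uᵀ - R * Uᵀ + vecMulVec x y := by
        rw [hQ, transpose_add, transpose_sub, transpose_mul, hRt, transpose_vecMulVec]
      have t2 : vecMulVec y x * R = vecMulVec y x := by
        rw [vecMulVec_mul, ← mulVec_transpose, hRt, hRx]
      have t3 : R * vecMulVec x y = vecMulVec x y := by rw [mul_vecMulVec, hRx]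
      have t4 : U * R * Uᵀ = vecMulVec (U *ᵥ x) (U *ᵥ x) := by
        rw [hR, mul_vecMulVec, vecMulVec_mul, ← mulVec_transpose, transpose_transpose]
      have t5 : vecMulVec y x * vecMulVec x y = vecMulVec y y := by
        rw [vecMulVec_mul_vecMulVec, hxx, one_smul]
      rw [t1, hQ, ← t4]
      simp only [Matrix.add_mul, Matrix.mul_add, Matrix.sub_mul, Matrix.mul_sub]
      simp only [Matrix.mul_assoc, t3, t5]
      simp only [← Matrix.mul_assoc, t2]
      simp only [Matrix.mul_assoc U R R, hRR]
      abel
    have h1 := h.2 Q hQU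
    have tr : ∀ v : N → ℝ, trace (vecMulVec v v * (D * Dᵀ)) = vnorm (Dᵀ *ᵥ v) ^ 2 := by
      intro v
      rw [vecMulVec_mul, trace_vecMulVec, vnorm_sq_transpose_mulVec, dotProduct_mulVec,
        dotProduct_comm]
    have h2 : ∀ V : Matrix N (Fin d) ℝ, trace (Vᵀ * (D * Dᵀ) * V) = trace (V * Vᵀ * (D * Dᵀ)) := by
      intro V
      rw [Matrix.mul_assoc, trace_mul_comm, Matrix.mul_assoc, Matrix.mul_assoc,
        trace_mul_comm, Matrix.mul_assoc, trace_mul_comm]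
      simp only [Matrix.mul_assoc]
    rw [h2, h2, hQQ, Matrix.add_mul, Matrix.sub_mul, trace_add, trace_sub, tr, tr] at h1
    exact le_of_sq_le_sq (by linarith) (vnorm_nonneg _)
  rcases (vnorm_nonneg y).eq_or_lt with h0 | h0
  · rw [vnorm_eq_zero.1 h0.symm, mulVec_zero, vnorm_eq_zero.2 rfl, vnorm_eq_zero.2 rfl, zero_mul]
  · have h1 := unit ((vnorm y)⁻¹ • y) ((vnorm y)⁻¹ * c)
      (by rw [vnorm_smul, abs_of_pos (inv_pos.2 h0), inv_mul_cancel₀ h0.ne'])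
      (by rw [mulVec_smul, hy, smul_smul])
    rw [mulVec_smul, vnorm_smul, abs_of_pos (inv_pos.2 h0)] at h1
    rwa [inv_mul_le_iff₀ h0] at h1

lemma IsTopSingVecs.dotProduct_eq_zero (h : IsTopSingVecs D U) (x : Fin d → ℝ) {z : N → ℝ}
    (hz : Uᵀ *ᵥ z = 0) : z ⬝ᵥ ((D * Dᵀ) *ᵥ (U *ᵥ x)) = 0 := by
  have unit : ∀ x : Fin d → ℝ, vnorm x = 1 → z ⬝ᵥ ((D * Dᵀ) *ᵥ (U *ᵥ x)) = 0 := by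
    intro x hx
    have hxx : x ⬝ᵥ x = 1 := by rw [← vnorm_sq, hx, one_pow]
    set b := z ⬝ᵥ ((D * Dᵀ) *ᵥ (U *ᵥ x)) with hb
    have hb' : (U *ᵥ x) ⬝ᵥ ((D * Dᵀ) *ᵥ z) = b := by
      rw [hb, dotProduct_mulVec, ← mulVec_transpose, transpose_mul, transpose_transpose,
        dotProduct_comm]
    have hUz : (U *ᵥ x) ⬝ᵥ z = 0 := by
      rw [dotProduct_comm, dotProduct_mulVec, ← mulVec_transpose, hz, zero_dotProduct]
    have hUU : (U *ᵥ x) ⬝ᵥ (U *ᵥ x) = 1 := by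
      rw [← vnorm_sq, vnorm_mulVec_of_orthonormal h.1, hx, one_pow]
    have key : ∀ r : ℝ, 2 * r * b ≤ r ^ 2 *
        ((z ⬝ᵥ z) * ((U *ᵥ x) ⬝ᵥ ((D * Dᵀ) *ᵥ (U *ᵥ x)))) := by
      intro r
      have h1 := h.vnorm_le hx (y := U *ᵥ x + r • z) (c := 1) (by
        rw [mulVec_add, mulVec_smul, hz, smul_zero, add_zero, mulVec_mulVec, h.1, one_mulVec,
          one_smul])
      have h2 := pow_le_pow_left₀ (vnorm_nonneg _) h1 2
      rw [mul_pow, vnorm_sq_transpose_mulVec, vnorm_sq_transpose_mulVec, vnorm_sq] at h2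
      simp only [mulVec_add, mulVec_smul, dotProduct_add, add_dotProduct, smul_dotProduct,
        dotProduct_smul, smul_eq_mul, hb', hUz, hUU, dotProduct_comm z (U *ᵥ x)] at h2
      have h3 : 0 ≤ z ⬝ᵥ ((D * Dᵀ) *ᵥ z) := by rw [← vnorm_sq_transpose_mulVec]; positivity
      rw [← hb] at h2
      nlinarith [mul_nonneg (sq_nonneg r) h3]
    set K := (z ⬝ᵥ z) * ((U *ᵥ x) ⬝ᵥ ((D * Dᵀ) *ᵥ (U *ᵥ x))) with hK
    have hK0 : 0 ≤ K := by
      rw [hK, ← vnorm_sq_transpose_mulVec, ← vnorm_sq]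
      positivity
    have h1 := key (b / (K + 1))
    have h2 : 2 * (b / (K + 1)) * b = 2 * b ^ 2 / (K + 1) := by ring
    have h3 : (b / (K + 1)) ^ 2 * K ≤ b ^ 2 / (K + 1) := by
      rw [div_pow, div_mul_eq_mul_div, div_le_div_iff₀ (by positivity) (by positivity)]
      nlinarith [mul_nonneg (sq_nonneg b) hK0, sq_nonneg b]
    rw [h2] at h1
    have h4 : b ^ 2 / (K + 1) ≤ 0 := by
      have : 2 * b ^ 2 / (K + 1) = 2 * (b ^ 2 / (K + 1)) := by ring
      linarith
    have h5 : b ^ 2 ≤ 0 := by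
      by_contra hcon
      exact absurd h4 (not_le.2 (div_pos (not_le.1 hcon) (by positivity)))
    exact pow_eq_zero_iff two_ne_zero |>.1 (le_antisymm h5 (sq_nonneg b))
  rcases (vnorm_nonneg x).eq_or_lt with h0 | h0
  · rw [vnorm_eq_zero.1 h0.symm]
    simp
  · have h1 := unit ((vnorm x)⁻¹ • x)
      (by rw [vnorm_smul, abs_of_pos (inv_pos.2 h0), inv_mul_cancel₀ h0.ne'])
    rw [mulVec_smul, mulVec_smul, dotProduct_smul, smul_eq_mul] at h1
    exact (mul_eq_zero.1 h1).resolve_left (inv_pos.2 h0).ne'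

/-- The span of top singular vectors is invariant. -/
lemma IsTopSingVecs.gram_mul (h : IsTopSingVecs D U) :
    D * (Dᵀ * U) = U * ((Dᵀ * U)ᵀ * (Dᵀ * U)) := by
  have h1 : ∀ x, (D * (Dᵀ * U) - U * ((Dᵀ * U)ᵀ * (Dᵀ * U))) *ᵥ x = 0 := by
    intro x
    set z := (D * (Dᵀ * U) - U * ((Dᵀ * U)ᵀ * (Dᵀ * U))) *ᵥ x with hz
    have hUz : Uᵀ *ᵥ z = 0 := by
      rw [hz, mulVec_mulVec, Matrix.mul_sub, ← Matrix.mul_assoc Uᵀ U, h.1, Matrix.one_mul,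
        transpose_mul, transpose_transpose, Matrix.mul_assoc, sub_self, zero_mulVec]
    have h2 := h.dotProduct_eq_zero x hUz
    have h3 : (D * Dᵀ) *ᵥ (U *ᵥ x) = z + U *ᵥ (((Dᵀ * U)ᵀ * (Dᵀ * U)) *ᵥ x) := by
      rw [hz, sub_mulVec, mulVec_mulVec, mulVec_mulVec, Matrix.mul_assoc]
      abel
    rw [h3, dotProduct_add, dotProduct_mulVec z U, ← mulVec_transpose, hUz, zero_dotProduct,
      add_zero, ← vnorm_sq] at h2
    exact vnorm_eq_zero.1 (pow_eq_zero_iff two_ne_zero |>.1 h2)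
  have h2 : D * (Dᵀ * U) - U * ((Dᵀ * U)ᵀ * (Dᵀ * U)) = 0 := by
    ext i j
    have := congrFun (h1 (Pi.single j 1)) i
    simpa using this
  exact sub_eq_zero.1 h2

lemma frob_sub_proj_le {V : Matrix N (Fin d) ℝ} (hV : Vᵀ * V = 1) {k : ℕ}
    (M : Matrix N (Fin k) ℝ) : frob (M - V * (Vᵀ * M)) ≤ frob M := by
  refine le_of_sq_le_sq ?_ (frob_nonneg _)
  have : (V * (Vᵀ * M))ᵀ * M = (Vᵀ * M)ᵀ * (Vᵀ * M) := by
    rw [transpose_mul, Matrix.mul_assoc]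
  have e2 : (V * (Vᵀ * M))ᵀ * (V * (Vᵀ * M)) = (Vᵀ * M)ᵀ * (Vᵀ * M) := by
    rw [transpose_mul V, Matrix.mul_assoc, ← Matrix.mul_assoc Vᵀ V, hV, Matrix.one_mul]
  rw [frob_sub_sq, this, frob_sq (V * (Vᵀ * M)), e2, ← frob_sq]
  linarith [sq_nonneg (frob (Vᵀ * M))]

lemma opLe_sub_proj {V : Matrix N (Fin d) ℝ} (hV : Vᵀ * V = 1) {M : Matrix N (Fin m) ℝ} {c : ℝ}
    (h : OpLe M c) : OpLe (M - V * (Vᵀ * M)) c := fun v => by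
  refine le_trans ?_ (h v)
  have h1 := frob_sub_proj_le hV (Matrix.of fun i (_ : Fin 1) => (M *ᵥ v) i)
  have e : ∀ w : N → ℝ, frob (Matrix.of fun i (_ : Fin 1) => w i) = vnorm w := fun w => by
    simp [frob, vnorm]
  rw [e] at h1
  refine le_trans (le_of_eq ?_) h1
  rw [← e]
  congr 1
  ext i j
  have e2 : (V * (Vᵀ * M)) *ᵥ v = V *ᵥ (Vᵀ *ᵥ (M *ᵥ v)) := by
    rw [← mulVec_mulVec, ← mulVec_mulVec]
  rw [sub_mulVec, e2]
  rfl

/-- Orthonormal frames whose spans are close are close up to an orthogonal matrix. -/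
lemma exists_orth_of_proj {U V : Matrix N (Fin d) ℝ} (hU : Uᵀ * U = 1) (hV : Vᵀ * V = 1) {g : ℝ}
    (hg : g < 1) (h : frob (U - V * (Vᵀ * U)) ≤ g) :
    ∃ Q : Matrix (Fin d) (Fin d) ℝ, IsOrth Q ∧ frob (Vᵀ * U - Q) ≤ g ^ 2 ∧
      frob (U - V * Q) ≤ g + g ^ 2 := by
  have hg0 : 0 ≤ g := (frob_nonneg _).trans h
  set Y := U - V * (Vᵀ * U) with hY
  have e1 : 1 - (Vᵀ * U)ᵀ * (Vᵀ * U) = Yᵀ * Y := by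
    rw [hY, transpose_sub, Matrix.sub_mul, Matrix.mul_sub, Matrix.mul_sub, hU]
    simp only [transpose_mul, transpose_transpose, Matrix.mul_assoc]
    rw [← Matrix.mul_assoc Vᵀ V, hV, Matrix.one_mul]
    abel
  have h1 : frob (1 - (Vᵀ * U)ᵀ * (Vᵀ * U)) ≤ g ^ 2 := by
    rw [e1, sq]
    refine (frob_mul_le _ _).trans ?_
    rw [frob_transpose]
    exact mul_le_mul h h (frob_nonneg _) hg0
  obtain ⟨Q, hQ, hQ'⟩ := exists_orth_near (Vᵀ * U) (by nlinarith) h1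
  refine ⟨Q, hQ, hQ', ?_⟩
  have e2 : U - V * Q = Y + V * (Vᵀ * U - Q) := by
    rw [hY, Matrix.mul_sub]
    abel
  rw [e2]
  refine (frob_add_le _ _).trans (add_le_add h ?_)
  have := (opLe_one_of_orthonormal hV).frob_mul zero_le_one (Vᵀ * U - Q)
  linarith

lemma opLe_of_mul_gram {α : Type*} [Fintype α] {G : Matrix N (Fin d) ℝ} {μ w : ℝ} (hμ : 0 < μ)
    (hw : 0 ≤ w) (hG : OpGe G μ) {K : Matrix α N ℝ} (hK : OpLe K w) {Y : Matrix α (Fin d) ℝ}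
    (h : Y * (Gᵀ * G) = K * G) : OpLe Y (w / μ) := by
  have hq : ∀ v, v ⬝ᵥ ((Gᵀ * G) *ᵥ v) = vnorm (G *ᵥ v) ^ 2 := fun v => by
    rw [vnorm_sq, ← mulVec_mulVec, dotProduct_mulVec v, ← mulVec_transpose, transpose_transpose]
  have hge : OpGe (Gᵀ * G) (μ ^ 2) := opGe_of_quadratic fun v => by
    rw [hq, ← vnorm_sq, ← mul_pow]
    exact pow_le_pow_left₀ (mul_nonneg hμ.le (vnorm_nonneg _)) (hG v) 2
  have hu := isUnit_det_of_opGe (by positivity) hge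
  intro v
  set u := (Gᵀ * G)⁻¹ *ᵥ v with hu'
  have hv : v = (Gᵀ * G) *ᵥ u := by rw [hu', mulVec_mulVec, mul_nonsing_inv _ hu, one_mulVec]
  have h1 : vnorm (Y *ᵥ v) ≤ w * vnorm (G *ᵥ u) := by
    rw [hv, mulVec_mulVec, h, ← mulVec_mulVec]
    exact hK _
  have h2 : vnorm (G *ᵥ u) ^ 2 ≤ vnorm u * vnorm v := by
    rw [← hq, ← hv]
    exact dotProduct_le_vnorm _ _
  have h3 := hG u
  have h4 : μ * vnorm (G *ᵥ u) ≤ vnorm v := by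
    rcases (vnorm_nonneg (G *ᵥ u)).eq_or_lt with h0 | h0
    · rw [← h0, mul_zero]
      exact vnorm_nonneg v
    · refine le_of_mul_le_mul_left ?_ h0
      nlinarith [vnorm_nonneg v]
  rw [div_mul_eq_mul_div, le_div_iff₀ hμ]
  nlinarith

end Spectral

section Frame

variable {n d : ℕ}

/-- The normalization of `ZStack n d` with orthonormal columns. -/
noncomputable def frame (n d : ℕ) : Matrix (Fin n × Fin d) (Fin d) ℝ :=
  (Real.sqrt n)⁻¹ • ZStack n d

lemma sqrt_smul_frame (hn : 0 < Real.sqrt n) : Real.sqrt n • frame n d = ZStack n d := by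
  rw [frame, smul_smul, mul_inv_cancel₀ hn.ne', one_smul]

lemma frame_orthonormal (hn : 0 < Real.sqrt n) : (frame n d)ᵀ * frame n d = 1 := by
  have h := transpose_mul_self_of_forall_isOrth (orthBlocks_ZStack (n := n) (d := d))
  have : (Real.sqrt n)⁻¹ * (Real.sqrt n)⁻¹ * n = 1 := by
    have h1 : Real.sqrt n * Real.sqrt n = n := Real.mul_self_sqrt (Nat.cast_nonneg n)
    field_simp
    linarith
  rw [frame, transpose_smul, Matrix.smul_mul, Matrix.mul_smul, h, smul_smul, smul_smul]
  rw [this, one_smul]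

lemma frame_transpose_mul_ZStack (hn : 0 < Real.sqrt n) :
    (frame n d)ᵀ * ZStack n d = Real.sqrt n • (1 : Matrix (Fin d) (Fin d) ℝ) := by
  rw [← sqrt_smul_frame hn, Matrix.mul_smul, frame_orthonormal hn]

lemma frame_mul_transpose_mul_ZStack (hn : 0 < Real.sqrt n) :
    frame n d * ((frame n d)ᵀ * ZStack n d) = ZStack n d := by
  rw [frame_transpose_mul_ZStack hn, Matrix.mul_smul, Matrix.mul_one, sqrt_smul_frame hn]

end Frame

lemma Scale.β_le {n d : ℕ} {a s e β : ℝ} (h : Scale n d a s e β) :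
    β ≤ s * Real.sqrt n / 384 := by
  refine le_of_sq_le_sq ?_ (by have := h.s_pos; positivity)
  have h1 := h.quad_one
  have h2 := h.q_mul_e_le
  rw [div_pow, mul_pow, Real.sq_sqrt h.n_pos.le]
  linarith

lemma Scale.β_mul_sqrt_le {n d : ℕ} {a s e β : ℝ} (h : Scale n d a s e β) :
    β * Real.sqrt d ≤ s * Real.sqrt n * e / 12 := by
  have h1 := h.lin
  have h2 : s * (β * Real.sqrt d * Real.sqrt n) ≤ a * (β * Real.sqrt d * Real.sqrt n) :=
    mul_le_mul_of_nonneg_right h.s_le (by have := h.β_nonneg; positivity)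
  have hs := mul_pos h.s_pos h.sqrt_n_pos
  refine le_of_mul_le_mul_left ?_ hs
  have h3 := h.sqrt_n_sq
  have : s ^ 2 * n * e / 12 = s * Real.sqrt n * (s * Real.sqrt n * e / 12) := by
    linear_combination (-(s ^ 2 * e / 12)) * h3
  linarith

lemma Scale.a_mul_e_le {n d : ℕ} {a s e β : ℝ} (h : Scale n d a s e β) : a * e ≤ s / 32 := by
  have h1 := h.cond
  refine le_of_mul_le_mul_left ?_ h.a_pos
  have h2 := mul_le_mul_of_nonneg_right h.s_le h.s_pos.le
  nlinarith

section SpectralInit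

variable {n d m : ℕ} {a s e σ B : ℝ} {A : Matrix (Fin d) (Fin m) ℝ}
  {X : Matrix (Fin n × Fin d) (Fin m) ℝ} {U V : Matrix (Fin n × Fin d) (Fin d) ℝ}

lemma le_vnorm_signal (hA' : OpGe Aᵀ s) (hX : OpLe X (3.2 * B)) (hσ : 0 ≤ σ) (hB : 0 ≤ B)
    (sc : Scale n d a s e (σ * B)) (v : Fin d → ℝ) :
    0.9916 * (s * Real.sqrt n) * vnorm (ZStack n d *ᵥ v) ≤
      vnorm ((ZStack n d * A + σ • X)ᵀ *ᵥ (ZStack n d *ᵥ v)) := by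
  have e1 : (ZStack n d * A + σ • X)ᵀ *ᵥ (ZStack n d *ᵥ v) =
      (n : ℝ) • (Aᵀ *ᵥ v) + σ • (Xᵀ *ᵥ (ZStack n d *ᵥ v)) := by
    rw [transpose_add, transpose_mul, transpose_smul, add_mulVec, smul_mulVec, mulVec_mulVec,
      Matrix.mul_assoc, transpose_mul_self_of_forall_isOrth orthBlocks_ZStack, Matrix.mul_smul,
      Matrix.mul_one, smul_mulVec]
  have h1 : vnorm (ZStack n d *ᵥ v) = Real.sqrt n * vnorm v :=
    orthBlocks_ZStack.vnorm_mulVec v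
  have h2 := hA' v
  have h3 := hX.transpose (by positivity) (ZStack n d *ᵥ v)
  have h4 := vnorm_add_le ((n : ℝ) • (Aᵀ *ᵥ v) + σ • (Xᵀ *ᵥ (ZStack n d *ᵥ v)))
    (-(σ • (Xᵀ *ᵥ (ZStack n d *ᵥ v))))
  rw [add_neg_cancel_right, vnorm_neg, vnorm_smul, vnorm_smul, abs_of_nonneg hσ,
    abs_of_nonneg (Nat.cast_nonneg n), ← e1] at h4
  have h5 := mul_le_mul_of_nonneg_left h2 (Nat.cast_nonneg n)
  have h6 := mul_le_mul_of_nonneg_left h3 hσ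
  have h7 := mul_le_mul_of_nonneg_right sc.β_le (vnorm_nonneg (ZStack n d *ᵥ v))
  have h8 : (n : ℝ) * (s * vnorm v) = s * Real.sqrt n * vnorm (ZStack n d *ᵥ v) := by
    rw [h1]
    linear_combination (-(s * vnorm v)) * sc.sqrt_n_sq
  have h9 := mul_nonneg (mul_nonneg sc.s_pos.le sc.sqrt_n_pos.le)
    (vnorm_nonneg (ZStack n d *ᵥ v))
  nlinarith

lemma IsTopSingVecs.opGe (h : IsTopSingVecs (ZStack n d * A + σ • X) U) (hA' : OpGe Aᵀ s)
    (hX : OpLe X (3.2 * B)) (hσ : 0 ≤ σ) (hB : 0 ≤ B) (sc : Scale n d a s e (σ * B)) :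
    OpGe ((ZStack n d * A + σ • X)ᵀ * U) (0.9916 * (s * Real.sqrt n)) := by
  have unit : ∀ x, vnorm x = 1 →
      0.9916 * (s * Real.sqrt n) ≤ vnorm ((ZStack n d * A + σ • X)ᵀ *ᵥ (U *ᵥ x)) := by
    intro x hx
    have hxx : x ⬝ᵥ x = 1 := by rw [← vnorm_sq, hx, one_pow]
    have hx0 : x ≠ 0 := fun h0 => by
      rw [h0, dotProduct_zero] at hxx
      exact zero_ne_one hxx
    have hdet : ((1 - vecMulVec x x) * (Uᵀ * ZStack n d)).det = 0 := by
      refine exists_vecMul_eq_zero_iff.1 ⟨x, hx0, ?_⟩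
      rw [← vecMul_vecMul, vecMul_sub, vecMul_one, vecMul_vecMulVec, hxx, one_smul, sub_self,
        zero_vecMul]
    obtain ⟨v, hv0, hv⟩ := exists_mulVec_eq_zero_iff.2 hdet
    rw [← mulVec_mulVec, sub_mulVec, one_mulVec, sub_eq_zero, vecMulVec_mulVec,
      ← mulVec_mulVec] at hv
    have h1 := h.vnorm_le hx (y := ZStack n d *ᵥ v) (c := x ⬝ᵥ (Uᵀ *ᵥ (ZStack n d *ᵥ v)))
      (by rw [hv, dotProduct_smul, hxx]; simp)
    have h2 := le_vnorm_signal hA' hX hσ hB sc v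
    have h3 : 0 < vnorm (ZStack n d *ᵥ v) := by
      rw [orthBlocks_ZStack.vnorm_mulVec v]
      exact mul_pos sc.sqrt_n_pos ((vnorm_nonneg v).lt_of_ne' fun h0 => hv0 (vnorm_eq_zero.1 h0))
    refine le_of_mul_le_mul_left ?_ h3
    linarith
  intro v
  rcases (vnorm_nonneg v).eq_or_lt with h0 | h0
  · rw [← h0, mul_zero]
    exact vnorm_nonneg _
  · have h1 := unit ((vnorm v)⁻¹ • v)
      (by rw [vnorm_smul, abs_of_pos (inv_pos.2 h0), inv_mul_cancel₀ h0.ne'])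
    rw [mulVec_smul, mulVec_smul, vnorm_smul, abs_of_pos (inv_pos.2 h0),
      le_inv_mul_iff₀ h0, mulVec_mulVec] at h1
    linarith

lemma noise_div_le (sc : Scale n d a s e (σ * B)) :
    σ * (3.2 * B) / (0.9916 * (s * Real.sqrt n)) ≤ 0.0085 := by
  have h := mul_pos sc.s_pos sc.sqrt_n_pos
  rw [div_le_iff₀ (by positivity)]
  have := sc.β_le
  linarith

/-- The span of the top singular vectors is close to the span of `ZStack n d`. -/
lemma IsTopSingVecs.frob_sub_frame_le (h : IsTopSingVecs (ZStack n d * A + σ • X) U)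
    (hA' : OpGe Aᵀ s) (hX : OpLe X (3.2 * B)) (hσ : 0 ≤ σ) (hB : 0 ≤ B)
    (sc : Scale n d a s e (σ * B)) :
    frob (U - frame n d * ((frame n d)ᵀ * U)) ≤ 0.27 * e := by
  have hn := sc.sqrt_n_pos
  have hsn := mul_pos sc.s_pos hn
  have hG := h.opGe hA' hX hσ hB sc
  set D := ZStack n d * A + σ • X with hD
  have hK : OpLe (D - frame n d * ((frame n d)ᵀ * D)) (σ * (3.2 * B)) := by
    have e1 : D - frame n d * ((frame n d)ᵀ * D) =
        σ • (X - frame n d * ((frame n d)ᵀ * X)) := by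
      rw [hD, Matrix.mul_add, Matrix.mul_add, ← Matrix.mul_assoc _ (ZStack n d),
        ← Matrix.mul_assoc _ _ A, frame_mul_transpose_mul_ZStack hn, Matrix.mul_smul,
        Matrix.mul_smul, smul_sub]
      abel
    rw [e1]
    exact (opLe_sub_proj (frame_orthonormal hn) hX).smul hσ
  have hY : OpLe (U - frame n d * ((frame n d)ᵀ * U)) _ :=
    opLe_of_mul_gram (by positivity) (by positivity) hG hK (by
      rw [Matrix.sub_mul, Matrix.mul_assoc, Matrix.mul_assoc, ← h.gram_mul, Matrix.sub_mul]
      simp only [Matrix.mul_assoc])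
  have h1 := hY.frob_mul (by positivity) (1 : Matrix (Fin d) (Fin d) ℝ)
  rw [Matrix.mul_one, frob_orthonormal (U := (1 : Matrix (Fin d) (Fin d) ℝ)) (by simp)] at h1
  refine h1.trans ?_
  rw [div_mul_eq_mul_div, div_le_iff₀ (by positivity)]
  have h2 := sc.β_mul_sqrt_le
  have h3 := mul_pos hsn sc.e_pos
  linarith

lemma IsTopSingVecs.exists_frame_orth (h : IsTopSingVecs (ZStack n d * A + σ • X) U)
    (hA' : OpGe Aᵀ s) (hX : OpLe X (3.2 * B)) (hσ : 0 ≤ σ) (hB : 0 ≤ B)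
    (sc : Scale n d a s e (σ * B)) :
    ∃ Q : Matrix (Fin d) (Fin d) ℝ, IsOrth Q ∧ frob ((frame n d)ᵀ * U - Q) ≤ 0.0001 ∧
      frob (U - frame n d * Q) ≤ 0.28 * e := by
  have he := sc.e_pos
  have he' := sc.e_le
  obtain ⟨Q, hQ, h1, h2⟩ := exists_orth_of_proj h.1 (frame_orthonormal sc.sqrt_n_pos)
    (by linarith) (h.frob_sub_frame_le hA' hX hσ hB sc)
  exact ⟨Q, hQ, h1.trans (by nlinarith), h2.trans (by nlinarith)⟩

lemma IsTopSingVecs.dF_ZStack_le (h : IsTopSingVecs (ZStack n d * A + σ • X) U)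
    (hA' : OpGe Aᵀ s) (hX : OpLe X (3.2 * B)) (hσ : 0 ≤ σ) (hB : 0 ≤ B)
    (sc : Scale n d a s e (σ * B)) {S : Matrix (Fin n × Fin d) (Fin d) ℝ}
    (hS : IsPolarBlocks U S) : dF S (ZStack n d) ≤ 1.5 * e * Real.sqrt n := by
  have hn := sc.sqrt_n_pos
  obtain ⟨Q, hQ, -, h1⟩ := h.exists_frame_orth hA' hX hσ hB sc
  have hZQ := (orthBlocks_ZStack (n := n) (d := d)).mul hQ
  have h2 := IsPolarBlocks.frob_sub_le (X := ZStack n d * Q) (R := ZStack n d * Q)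
    (Y := Real.sqrt n • U) (Q := S) (fun i => isPolar_self (hZQ i))
    (fun i => (hS i).smul hn.le) one_pos (fun i => opGe_one_of_orthonormal (hZQ i).1)
  have e1 : ZStack n d * Q - Real.sqrt n • U = Real.sqrt n • (frame n d * Q - U) := by
    rw [smul_sub, ← Matrix.smul_mul, sqrt_smul_frame hn]
  rw [e1, frob_smul, abs_of_pos hn, frob_sub_comm, one_mul, frob_sub_comm (frame n d * Q)] at h2
  have h3 := mul_le_mul_of_nonneg_left h1 hn.le
  have := mul_pos hn sc.e_pos
  have h4 := dF_le S (ZStack n d) hQ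
  linarith

lemma IsTopSingVecs.frob_complement_le (h : IsTopSingVecs (ZStack n d * A + σ • X) U)
    (hA : OpLe A a) (hA' : OpGe Aᵀ s) (hX : OpLe X (3.2 * B)) (hσ : 0 ≤ σ) (hB : 0 ≤ B)
    (sc : Scale n d a s e (σ * B)) {Y : Matrix (Fin n × Fin d) (Fin d) ℝ} (hY : Uᵀ * Y = 0) :
    frob ((ZStack n d * A + σ • X)ᵀ * Y) ≤ 0.0171 * (s * Real.sqrt n) * frob Y := by
  have hn := sc.sqrt_n_pos
  obtain ⟨Q, hQ, -, h1⟩ := h.exists_frame_orth hA' hX hσ hB sc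
  have e1 : (U - frame n d * Q)ᵀ * Y = -(Qᵀ * ((frame n d)ᵀ * Y)) := by
    rw [transpose_sub, Matrix.sub_mul, hY, transpose_mul, Matrix.mul_assoc, zero_sub]
  have h2 : frob ((frame n d)ᵀ * Y) ≤ 0.28 * e * frob Y := by
    have h3 := frob_mul_le (U - frame n d * Q)ᵀ Y
    rw [e1, frob_neg, frob_transpose, ← frob_transpose, transpose_mul, transpose_transpose,
      frob_mul_orth _ hQ, frob_transpose] at h3
    exact h3.trans (mul_le_mul_of_nonneg_right h1 (frob_nonneg _))
  have e2 : (ZStack n d * A + σ • X)ᵀ * Y =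
      Real.sqrt n • (Aᵀ * ((frame n d)ᵀ * Y)) + σ • (Xᵀ * Y) := by
    conv_lhs => rw [← sqrt_smul_frame hn]
    simp only [transpose_add, transpose_mul, transpose_smul, Matrix.add_mul, Matrix.smul_mul,
      Matrix.mul_assoc]
  rw [e2]
  refine (frob_add_le _ _).trans ?_
  rw [frob_smul, frob_smul, abs_of_pos hn, abs_of_nonneg hσ]
  have h3 := (hA.transpose sc.a_pos.le).frob_mul sc.a_pos.le ((frame n d)ᵀ * Y)
  have h4 := (hX.transpose (by positivity)).frob_mul (by positivity) Y
  have h5 := mul_le_mul_of_nonneg_left (h3.trans (mul_le_mul_of_nonneg_left h2 sc.a_pos.le)) hn.le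
  have h6 := mul_le_mul_of_nonneg_left h4 hσ
  have h7 := mul_le_mul_of_nonneg_right sc.β_le (frob_nonneg Y)
  have h8 := mul_le_mul_of_nonneg_right sc.a_mul_e_le (mul_nonneg hn.le (frob_nonneg Y))
  nlinarith [mul_nonneg (mul_nonneg sc.s_pos.le hn.le) (frob_nonneg Y)]

/-- A Davis–Kahan type bound for the top singular vectors. -/
lemma IsTopSingVecs.frob_sub_proj_le {X' : Matrix (Fin n × Fin d) (Fin m) ℝ}
    (hU : IsTopSingVecs (ZStack n d * A + σ • X) U)
    (hV : IsTopSingVecs (ZStack n d * A + σ • X') V)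
    (hA : OpLe A a) (hA' : OpGe Aᵀ s) (hX : OpLe X (3.2 * B)) (hX' : OpLe X' (3.2 * B))
    (hσ : 0 ≤ σ) (hB : 0 ≤ B) (sc : Scale n d a s e (σ * B)) :
    0.98 * (s ^ 2 * n) * frob (V - U * (Uᵀ * V)) ≤
      frob (((ZStack n d * A + σ • X) * (ZStack n d * A + σ • X)ᵀ -
        (ZStack n d * A + σ • X') * (ZStack n d * A + σ • X')ᵀ) * V) := by
  set Y := V - U * (Uᵀ * V) with hY
  have hUY : Uᵀ * Y = 0 := by
    rw [hY, Matrix.mul_sub, ← Matrix.mul_assoc, hU.1, Matrix.one_mul, sub_self]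
  have hYU : Yᵀ * U = 0 := by rw [← transpose_transpose U, ← transpose_mul, hUY, transpose_zero]
  have h1 := hU.frob_complement_le hA hA' hX hσ hB sc hUY
  have h2 := hV.opGe hA' hX' hσ hB sc
  have g1 := hU.gram_mul
  have g2 := hV.gram_mul
  set D := ZStack n d * A + σ • X
  set D' := ZStack n d * A + σ • X'
  set G := D'ᵀ * V with hG
  have hsn := mul_pos sc.s_pos sc.sqrt_n_pos
  have hYV : Yᵀ * V = Yᵀ * Y := by
    have : V = Y + U * (Uᵀ * V) := by rw [hY]; abel
    conv_lhs => rw [this]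
    rw [Matrix.mul_add, ← Matrix.mul_assoc, hYU, Matrix.zero_mul, add_zero]
  have t1 : trace (Yᵀ * (D' * (D'ᵀ * V))) = frob (G * Yᵀ) ^ 2 := by
    rw [g2, ← Matrix.mul_assoc, hYV, frob_sq, transpose_mul G, transpose_transpose,
      Matrix.mul_assoc Y, trace_mul_comm Y, trace_mul_comm]
    simp only [Matrix.mul_assoc]
  have t2 : trace (Yᵀ * (D * (Dᵀ * V))) = frob (Dᵀ * Y) ^ 2 := by
    have : V = Y + U * (Uᵀ * V) := by rw [hY]; abel
    conv_lhs => rw [this]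
    rw [Matrix.mul_add, Matrix.mul_add, Matrix.mul_add, ← Matrix.mul_assoc Dᵀ U,
      ← Matrix.mul_assoc D (Dᵀ * U), g1]
    simp only [← Matrix.mul_assoc, hYU, Matrix.zero_mul, add_zero]
    rw [frob_sq, transpose_mul, transpose_transpose]
    simp only [← Matrix.mul_assoc]
  have t3 := h2.frob_mul (by positivity) Yᵀ
  rw [frob_transpose] at t3
  have t4 := trace_le_frob Y ((D' * D'ᵀ - D * Dᵀ) * V)
  rw [← neg_sub (D * Dᵀ), Matrix.neg_mul, frob_neg, ← Matrix.neg_mul, neg_sub, Matrix.sub_mul,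
    Matrix.mul_sub, trace_sub, Matrix.mul_assoc, Matrix.mul_assoc D Dᵀ, t1, t2] at t4
  have t5 := pow_le_pow_left₀ (by have := frob_nonneg Y; positivity) t3 2
  have t6 := pow_le_pow_left₀ (frob_nonneg _) h1 2
  have t7 : (s * Real.sqrt n) ^ 2 = s ^ 2 * n := by rw [mul_pow, Real.sq_sqrt sc.n_pos.le]
  rw [mul_pow, mul_pow, t7] at t5 t6
  rcases (frob_nonneg Y).eq_or_lt with h0 | h0
  · rw [← h0, mul_zero]
    exact frob_nonneg _
  · refine le_of_mul_le_mul_left ?_ h0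
    nlinarith [mul_nonneg sc.q_pos.le (sq_nonneg (frob Y))]

lemma IsTopSingVecs.exists_orth_eq (hU : IsTopSingVecs (ZStack n d * A + σ • X) U)
    (hV : IsTopSingVecs (ZStack n d * A + σ • X) V)
    (hA : OpLe A a) (hA' : OpGe Aᵀ s) (hX : OpLe X (3.2 * B))
    (hσ : 0 ≤ σ) (hB : 0 ≤ B) (sc : Scale n d a s e (σ * B)) :
    ∃ Q : Matrix (Fin d) (Fin d) ℝ, IsOrth Q ∧ V = U * Q := by
  have h1 := hU.frob_sub_proj_le hV hA hA' hX hX hσ hB sc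
  rw [sub_self, Matrix.zero_mul, frob_zero] at h1
  have h2 : V = U * (Uᵀ * V) := by
    refine sub_eq_zero.1 (frob_eq_zero (le_antisymm ?_ (frob_nonneg _)))
    by_contra hcon
    exact absurd h1 (not_le.2 (mul_pos (mul_pos (by norm_num) sc.q_pos) (not_le.1 hcon)))
  refine ⟨Uᵀ * V, isOrth_of_left ?_, h2⟩
  rw [transpose_mul, transpose_transpose, Matrix.mul_assoc, ← h2, hV.1]

/-- If the `i`-th block of the noise vanishes, the `i`-th block of the top singular vectors is
nearly orthogonal. -/
lemma IsTopSingVecs.opLe_blk_and_opGe_blk (hV : IsTopSingVecs (ZStack n d * A + σ • X) V)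
    (hA' : OpGe Aᵀ s) (hX : OpLe X (3.2 * B)) (hσ : 0 ≤ σ) (hB : 0 ≤ B)
    (sc : Scale n d a s e (σ * B)) {i : Fin n} (hi : blk X i = 0) :
    OpLe (blk (Real.sqrt n • V) i) 1.01 ∧ OpGe (blk (Real.sqrt n • V) i) 0.99 := by
  have hn := sc.sqrt_n_pos
  have hsn := mul_pos sc.s_pos hn
  obtain ⟨Q, hQ, h1, -⟩ := hV.exists_frame_orth hA' hX hσ hB sc
  have hG := hV.opGe hA' hX hσ hB sc
  have g := hV.gram_mul
  set D := ZStack n d * A + σ • X with hD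
  have hF := opLe_one_of_orthonormal (frame_orthonormal (d := d) hn)
  have hK : OpLe (-(σ • ((frame n d)ᵀ * X))) (σ * (3.2 * B)) := by
    have := ((hF.transpose zero_le_one).mul zero_le_one hX).smul hσ
    rw [one_mul] at this
    exact this.neg
  have hH : OpLe (blk (Real.sqrt n • V) i - (frame n d)ᵀ * V) _ :=
    opLe_of_mul_gram (by positivity) (by positivity) hG hK (by
      have b1 : blk (Real.sqrt n • V) i * ((Dᵀ * V)ᵀ * (Dᵀ * V)) =
          Real.sqrt n • (A * (Dᵀ * V)) := by
        rw [blk_smul, Matrix.smul_mul, ← blk_mul, ← g, blk_mul, hD, blk_add, blk_ZStack_mul,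
          blk_smul, hi, smul_zero, add_zero]
      rw [Matrix.sub_mul, b1, Matrix.mul_assoc, ← g]
      conv_lhs => rw [hD, Matrix.add_mul, Matrix.mul_add, Matrix.mul_assoc (ZStack n d),
        ← Matrix.mul_assoc (frame n d)ᵀ (ZStack n d), frame_transpose_mul_ZStack hn]
      rw [Matrix.smul_mul, Matrix.one_mul, Matrix.smul_mul, Matrix.mul_smul, Matrix.neg_mul,
        Matrix.smul_mul, Matrix.mul_assoc]
      abel)
  have hH' := hH.mono (noise_div_le sc)
  constructor
  · have := hH'.add ((hF.transpose zero_le_one).mul zero_le_one (opLe_one_of_orthonormal hV.1))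
    rw [sub_add_cancel] at this
    exact this.mono (by norm_num)
  · have h2 := (opGe_one_of_orthonormal hQ.1).of_sub ((opLe_frob _).mono h1)
    exact (h2.of_sub hH').mono (by norm_num)

lemma Noise.exists_frob_sub_mask_le {W : Matrix (Fin n × Fin d) (Fin m) ℝ}
    (hW : Noise A W σ B a) (hU : IsTopSingVecs (ZStack n d * A + σ • W) U)
    (hA : OpLe A a) (hA' : OpGe Aᵀ s) (hσ : 0 ≤ σ) (hB : 0 ≤ B)
    (sc : Scale n d a s e (σ * B)) {i : Fin n}
    (hV : IsTopSingVecs (ZStack n d * A + σ • mask W i) V) :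
    ∃ Q : Matrix (Fin d) (Fin d) ℝ, IsOrth Q ∧
      frob (Real.sqrt n • U - Real.sqrt n • V * Q) ≤ 0.151 * e := by
  have hn := sc.sqrt_n_pos
  have hn' := sc.sqrt_n_ge
  have he := sc.e_pos
  have he' := sc.e_le
  have hM := opLe_mask hW.opLe i
  have hi : blk (mask W i) i = 0 := by simp [blk_mask]
  have h1 := frob_gram_sub_mask_le hW hσ hB sc i (V := Real.sqrt n • V)
    (by simpa using (opLe_one_of_orthonormal hV.1).smul hn.le)
    (hV.opLe_blk_and_opGe_blk hA' hM hσ hB sc hi).1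
    (by
      rw [Matrix.mul_smul, frob_smul, abs_of_pos hn]
      refine (mul_le_mul_of_nonneg_left (hW.loo i V hV) hn.le).trans (le_of_eq ?_)
      field_simp)
  rw [Matrix.mul_smul, frob_smul, abs_of_pos hn] at h1
  have h2 := hU.frob_sub_proj_le hV hA hA' hW.opLe hM hσ hB sc
  have h3 : Real.sqrt n * frob (V - U * (Uᵀ * V)) ≤ 0.149 * e := by
    refine le_of_mul_le_mul_left ?_ (mul_pos (by norm_num : (0 : ℝ) < 0.98) sc.q_pos)
    have h4 := mul_le_mul_of_nonneg_left h2 hn.le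
    have h5 := mul_pos sc.q_pos he
    linarith
  set g := 0.149 * e / Real.sqrt n with hg
  have hg0 : 0 < g := by positivity
  have h4 : frob (V - U * (Uᵀ * V)) ≤ g := by
    rw [hg, le_div_iff₀ hn]
    linarith
  have h5 : Real.sqrt n * g = 0.149 * e := by rw [hg]; field_simp
  have h6 : g ≤ 0.005 := by nlinarith
  obtain ⟨Q, hQ, -, h7⟩ := exists_orth_of_proj hV.1 hU.1 (by linarith) h4
  refine ⟨Qᵀ, hQ.transpose, ?_⟩
  have e1 : Real.sqrt n • U - Real.sqrt n • V * Qᵀ = Real.sqrt n • ((U * Q - V) * Qᵀ) := by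
    rw [Matrix.sub_mul, Matrix.mul_assoc, hQ.2, Matrix.mul_one, smul_sub, Matrix.smul_mul]
  rw [e1, frob_smul, abs_of_pos hn, frob_mul_orth _ hQ.transpose, frob_sub_comm]
  have h8 := mul_le_mul_of_nonneg_left h7 hn.le
  nlinarith

/-- The spectral initialization is close to its leave-one-out counterparts. -/
lemma Noise.dF_init_le {W : Matrix (Fin n × Fin d) (Fin m) ℝ}
    (hW : Noise A W σ B a) (hU : IsTopSingVecs (ZStack n d * A + σ • W) U)
    (hA : OpLe A a) (hA' : OpGe Aᵀ s) (hσ : 0 ≤ σ) (hB : 0 ≤ B)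
    (sc : Scale n d a s e (σ * B)) {V : Fin n → Matrix (Fin n × Fin d) (Fin d) ℝ}
    (hV : ∀ i, IsTopSingVecs (ZStack n d * A + σ • mask W i) (V i))
    {S : Matrix (Fin n × Fin d) (Fin d) ℝ} {S' : Fin n → Matrix (Fin n × Fin d) (Fin d) ℝ}
    (hS : IsPolarBlocks U S) (hS' : ∀ i, IsPolarBlocks (V i) (S' i)) (i : Fin n) :
    dF S (S' i) ≤ e := by
  have hn := sc.sqrt_n_pos
  have he := sc.e_pos
  have he' := sc.e_le
  have near := fun i => hW.exists_frob_sub_mask_le hU hA hA' hσ hB sc (hV i)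
  have hge : ∀ j, OpGe (blk (Real.sqrt n • U) j) 0.95 := fun j => by
    obtain ⟨Q, hQ, h1⟩ := near j
    have h2 := ((hV j).opLe_blk_and_opGe_blk hA' (opLe_mask hW.opLe j) hσ hB sc (i := j)
      (by simp [blk_mask])).2.mul_isOrth hQ
    have h3 := GOPP.opLe_blk (opLe_frob (Real.sqrt n • U - Real.sqrt n • V j * Q)) j
    rw [blk_sub, blk_mul] at h3
    exact (h2.of_sub (h3.mono h1)).mono (by linarith)
  obtain ⟨Q, hQ, h1⟩ := near i
  have h2 := IsPolarBlocks.frob_sub_le (X := Real.sqrt n • U) (R := S)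
    (Y := Real.sqrt n • V i * Q) (Q := S' i * Q) (fun j => (hS j).smul hn.le)
    (fun j => ((hS' i j).smul hn.le).mul_orth hQ) (by norm_num) hge
  have h3 := dF_le S (S' i) hQ
  linarith

end SpectralInit

section Parameters

lemma opNorm_nonneg {α β : Type*} [Fintype α] [Fintype β] (X : Matrix α β ℝ) : 0 ≤ opNorm X :=
  Real.sSup_nonneg (by rintro _ ⟨u, -, rfl⟩; exact vnorm_nonneg _)

lemma opLe_of_unit {α β : Type*} [Fintype α] [Fintype β] {X : Matrix α β ℝ} {c : ℝ}
    (h : ∀ u, vnorm u = 1 → vnorm (X *ᵥ u) ≤ c) : OpLe X c := fun v => by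
  rcases (vnorm_nonneg v).eq_or_lt with h0 | h0
  · rw [← h0, mul_zero, vnorm_eq_zero.1 h0.symm, mulVec_zero, vnorm_eq_zero.2 rfl]
  · have h1 := h ((vnorm v)⁻¹ • v)
      (by rw [vnorm_smul, abs_of_pos (inv_pos.2 h0), inv_mul_cancel₀ h0.ne'])
    rw [mulVec_smul, vnorm_smul, abs_of_pos (inv_pos.2 h0), inv_mul_le_iff₀ h0] at h1
    linarith

lemma opLe_opNorm {α β : Type*} [Fintype α] [Fintype β] (X : Matrix α β ℝ) :
    OpLe X (opNorm X) := opLe_of_unit fun u hu => by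
  refine le_csSup ⟨frob X, ?_⟩ ⟨u, hu, rfl⟩
  rintro _ ⟨v, hv, rfl⟩
  have := opLe_frob X v
  rwa [hv, mul_one] at this

lemma opGe_sigmaMin {α β : Type*} [Fintype α] [Fintype β] (X : Matrix α β ℝ) :
    OpGe Xᵀ (sigmaMin X) := fun v => by
  rcases (vnorm_nonneg v).eq_or_lt with h0 | h0
  · rw [← h0, mul_zero]
    exact vnorm_nonneg _
  · have h1 : sigmaMin X ≤ vnorm (((vnorm v)⁻¹ • v) ᵥ* X) := by
      refine csInf_le ⟨0, ?_⟩ ⟨(vnorm v)⁻¹ • v, ?_, rfl⟩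
      · rintro _ ⟨u, -, rfl⟩
        exact vnorm_nonneg _
      · rw [vnorm_smul, abs_of_pos (inv_pos.2 h0), inv_mul_cancel₀ h0.ne']
    rw [smul_vecMul, vnorm_smul, abs_of_pos (inv_pos.2 h0), le_inv_mul_iff₀ h0,
      ← mulVec_transpose] at h1
    linarith

lemma sigmaMin_le_opNorm {d m : ℕ} (hd : 1 ≤ d) (A : Matrix (Fin d) (Fin m) ℝ) :
    sigmaMin A ≤ opNorm A := by
  have h1 := opGe_sigmaMin A (Pi.single ⟨0, hd⟩ 1)
  have h2 := (opLe_opNorm A).transpose (opNorm_nonneg A) (Pi.single ⟨0, hd⟩ 1)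
  have h3 : vnorm (Pi.single (⟨0, hd⟩ : Fin d) (1 : ℝ)) = 1 := by
    refine (sq_eq_sq₀ (vnorm_nonneg _) zero_le_one).1 ?_
    rw [vnorm_sq]
    simp
  rw [h3] at h1 h2
  linarith

variable {n d m : ℕ} {A : Matrix (Fin d) (Fin m) ℝ} {σ γ ε δ : ℝ}

lemma scale_of_noise_level (hn : 2 ≤ n) (hd : 1 ≤ d) (hA : 0 < sigmaMin A) (hσ : 0 < σ)
    (hε : ε = 1 / (32 * kappa A ^ 2 * Real.sqrt (d : ℝ)))
    (hδ : δ ≤ (1 - ε ^ 2 * (d : ℝ)) * ε / 12)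
    (hσ' : σ ≤ δ / kappa A ^ 2 * opNorm A * Real.sqrt (n : ℝ) / bnd1 n d m γ) :
    Scale n d (opNorm A) (sigmaMin A) (ε * Real.sqrt d) (σ * bnd1 n d m γ) := by
  have hsa := sigmaMin_le_opNorm hd A
  set s := sigmaMin A with hs
  set a := opNorm A with ha
  have ha0 : 0 < a := hA.trans_le hsa
  have hn0 : (0 : ℝ) < n := by exact_mod_cast (by omega : 0 < n)
  have hd1 : 1 ≤ Real.sqrt d := Real.one_le_sqrt.2 (by exact_mod_cast hd)
  have hdd : Real.sqrt d * Real.sqrt d = d := Real.mul_self_sqrt (Nat.cast_nonneg d)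
  have hnn : Real.sqrt n * Real.sqrt n = n := Real.mul_self_sqrt hn0.le
  have hrn : 0 < Real.sqrt n := Real.sqrt_pos.2 hn0
  have hB : 0 < bnd1 n d m γ := by
    have : 0 < Real.sqrt ((n : ℝ) * d) :=
      Real.sqrt_pos.2 (mul_pos hn0 (by exact_mod_cast (by omega : 0 < d)))
    have h1 := Real.sqrt_nonneg (m : ℝ)
    have h2 := Real.sqrt_nonneg (2 * γ * n * Real.log n)
    unfold bnd1
    linarith
  have hκ : kappa A = a / s := rfl
  have hε0 : 0 < ε := by rw [hε, hκ]; positivity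
  have he : ε * Real.sqrt d = s ^ 2 / (32 * a ^ 2) := by
    rw [hε, hκ]
    field_simp
  have he1 : ε * Real.sqrt d ≤ 1 / 32 := by
    rw [he, div_le_div_iff₀ (by positivity) (by norm_num)]
    nlinarith
  have hδ' : δ ≤ ε / 12 := by nlinarith [mul_nonneg (sq_nonneg ε) (Nat.cast_nonneg (α := ℝ) d)]
  have hβ : σ * bnd1 n d m γ ≤ ε / 12 * (s ^ 2 / a) * Real.sqrt n := by
    rw [le_div_iff₀ hB] at hσ'
    refine hσ'.trans ?_
    have e1 : δ / kappa A ^ 2 * a * Real.sqrt n = δ * ((s ^ 2 / a) * Real.sqrt n) := by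
      rw [hκ]
      field_simp
    rw [e1, mul_assoc]
    exact mul_le_mul_of_nonneg_right hδ' (by positivity)
  have hβ0 : 0 ≤ σ * bnd1 n d m γ := by positivity
  refine ⟨hn, hd, hA, hsa, hβ0, by positivity, he1, ?_, ?_, ?_⟩
  · rw [he]
    field_simp
  · have h1 := mul_le_mul_of_nonneg_right hβ
      (by positivity : 0 ≤ a * Real.sqrt n * Real.sqrt d)
    have e1 : ε / 12 * (s ^ 2 / a) * Real.sqrt n * (a * Real.sqrt n * Real.sqrt d) =
        s ^ 2 * (Real.sqrt n * Real.sqrt n) * (ε * Real.sqrt d) / 12 := by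
      field_simp
    rw [e1, hnn] at h1
    linarith
  · have h1 := mul_le_mul_of_nonneg_right (pow_le_pow_left₀ hβ0 hβ 2) (Real.sqrt_nonneg d)
    refine h1.trans ?_
    have e1 : (ε / 12 * (s ^ 2 / a) * Real.sqrt n) ^ 2 * Real.sqrt d =
        s ^ 2 * n * (ε * Real.sqrt d) * (ε * (s ^ 2 / (32 * a ^ 2)) * (32 / 144)) := by
      rw [← hnn]
      field_simp
      norm_num
      ring
    rw [e1, ← he]
    have h2 : ε * (ε * Real.sqrt d) * (32 / 144) ≤ 1 / 4608 := by
      have h3 : ε ≤ 1 / 32 := by nlinarith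
      nlinarith [mul_pos hε0 (zero_lt_one.trans_le hd1)]
    have h4 := mul_le_mul_of_nonneg_left h2
      (by positivity : 0 ≤ s ^ 2 * n * (ε * Real.sqrt d))
    linarith

lemma Noise.iterates {e s a B : ℝ} {W : Matrix (Fin n × Fin d) (Fin m) ℝ}
    (hA : OpLe A a) (hA' : OpGe Aᵀ s)
    (hW : Noise A W σ B a) (hσ : 0 ≤ σ) (hB : 0 ≤ B) (sc : Scale n d a s e (σ * B))
    {S : ℕ → Matrix (Fin n × Fin d) (Fin d) ℝ} (hS : IsGPM (ZStack n d * A + σ • W) S)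
    {Sl : Fin n → ℕ → Matrix (Fin n × Fin d) (Fin d) ℝ}
    (hSl : ∀ i, IsGPM (ZStack n d * A + σ • mask W i) (Sl i)) {T : ℕ}
    (hloo : ∀ i, ∀ t ≤ T, frob (blk W i * (mask W i)ᵀ * Sl i t) ≤ Real.sqrt d * B ^ 2) :
    ∀ t, 1 ≤ t → t ≤ T → (∀ i, dF (S t) (Sl i t) ≤ e) ∧
      (∀ i, frob (blk W i * Wᵀ * S t) ≤ 3 * Real.sqrt d * B ^ 2) ∧
      dF (S t) (ZStack n d) ≤ e * Real.sqrt n / 2 ∧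
      dF (S (t + 1)) (S t) ≤ 1 / 2 * dF (S t) (S (t - 1)) ∧
      dF (S (t + 1)) (S t) ≤ (1 / 2 : ℝ) ^ t * dF (S 1) (S 0) := by
  obtain ⟨U, hU, hUS⟩ := hS.1
  choose V hV hVS using fun i => (hSl i).1
  exact iterates_in_basin hA hA' hW hσ hB sc hS hSl hloo
    (hW.dF_init_le hU hA hA' hσ hB sc hV hUS hVS) (hU.dF_ZStack_le hA' hW.opLe hσ hB sc hUS)

end Parameters

section Gaussian
variable {ι κ ι' κ' : Type*} [Fintype ι] [Fintype κ] [Fintype ι'] [Fintype κ']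

instance : IsProbabilityMeasure (stdGaussian ι κ) := by
  unfold stdGaussian
  infer_instance

lemma lintegral_prod_stdGaussian {f : ι → κ → ℝ → ℝ} (hf : ∀ i j x, 0 ≤ f i j x)
    (hf' : ∀ i j, Integrable (f i j) (ProbabilityTheory.gaussianReal 0 1)) :
    ∫⁻ W, ENNReal.ofReal (∏ i, ∏ j, f i j (W i j)) ∂stdGaussian ι κ =
      ENNReal.ofReal (∏ i, ∏ j, ∫ x, f i j x ∂ProbabilityTheory.gaussianReal 0 1) := by
  have h1 : ∀ i, Integrable (fun w : κ → ℝ => ∏ j, f i j (w j))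
      (Measure.pi fun _ : κ => ProbabilityTheory.gaussianReal 0 1) := fun i =>
    Integrable.fintype_prod_dep (hf' i)
  have h2 : Integrable (fun W : ι → κ → ℝ => ∏ i, ∏ j, f i j (W i j)) (stdGaussian ι κ) :=
    Integrable.fintype_prod_dep h1
  rw [← ofReal_integral_eq_lintegral_ofReal h2
    (ae_of_all _ fun W => Finset.prod_nonneg fun i _ => Finset.prod_nonneg fun j _ => hf _ _ _)]
  congr 1
  rw [stdGaussian, integral_fintype_prod_eq_prod (fun i (w : κ → ℝ) => ∏ j, f i j (w j))]
  exact Finset.prod_congr rfl fun i _ => integral_fintype_prod_eq_prod (f i)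

lemma lintegral_exp_linear (c : ι → κ → ℝ) :
    ∫⁻ W, ENNReal.ofReal (Real.exp (∑ i, ∑ j, c i j * W i j)) ∂stdGaussian ι κ =
      ENNReal.ofReal (Real.exp ((∑ i, ∑ j, c i j ^ 2) / 2)) := by
  have h := lintegral_prod_stdGaussian (f := fun (i : ι) (j : κ) x => Real.exp (c i j * x))
    (fun _ _ _ => (Real.exp_pos _).le)
    (fun i j => ProbabilityTheory.integrable_exp_mul_gaussianReal (c i j))
  simp only [← Real.exp_sum] at h
  rw [h]
  have e : ∀ t : ℝ, ∫ x, Real.exp (t * x) ∂ProbabilityTheory.gaussianReal 0 1 =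
      Real.exp (t ^ 2 / 2) := fun t => by
    have := congrFun (ProbabilityTheory.mgf_id_gaussianReal (μ := 0) (v := 1)) t
    simpa [ProbabilityTheory.mgf] using this
  simp only [e, ← Real.exp_sum, Finset.sum_div]

lemma exp_sq_gaussianReal {τ : ℝ} (hτ : τ < 1) :
    Integrable (fun x => Real.exp (τ / 2 * x ^ 2)) (ProbabilityTheory.gaussianReal 0 1) ∧
      ∫ x, Real.exp (τ / 2 * x ^ 2) ∂ProbabilityTheory.gaussianReal 0 1 =
        (Real.sqrt (1 - τ))⁻¹ := by
  have hb : 0 < (1 - τ) / 2 := by linarith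
  have e : ∀ x, ProbabilityTheory.gaussianPDFReal 0 1 x • Real.exp (τ / 2 * x ^ 2) =
      (Real.sqrt (2 * Real.pi))⁻¹ * Real.exp (-((1 - τ) / 2) * x ^ 2) := fun x => by
    simp only [ProbabilityTheory.gaussianPDFReal, smul_eq_mul, sub_zero, NNReal.coe_one, mul_one]
    rw [mul_assoc, ← Real.exp_add]
    congr 2
    ring
  constructor
  · rw [ProbabilityTheory.gaussianReal_of_var_ne_zero _ one_ne_zero,
      integrable_withDensity_iff_integrable_smul' (ProbabilityTheory.measurable_gaussianPDF 0 1)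
        (ae_of_all _ fun x => ProbabilityTheory.gaussianPDF_lt_top)]
    simp only [ProbabilityTheory.toReal_gaussianPDF, e]
    exact (integrable_exp_neg_mul_sq hb).const_mul _
  · rw [ProbabilityTheory.integral_gaussianReal_eq_integral_smul one_ne_zero]
    simp only [e]
    rw [integral_const_mul, integral_gaussian, ← Real.sqrt_inv, ← Real.sqrt_inv,
      ← Real.sqrt_mul (by positivity)]
    congr 1
    have : 1 - τ ≠ 0 := by linarith
    field_simp

lemma lintegral_exp_sq {τ : ℝ} (hτ : τ < 1) :
    ∫⁻ W, ENNReal.ofReal (Real.exp (τ / 2 * ∑ i, ∑ j, W i j ^ 2)) ∂stdGaussian ι κ =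
      ENNReal.ofReal ((Real.sqrt (1 - τ))⁻¹ ^ (Fintype.card ι * Fintype.card κ)) := by
  have h := lintegral_prod_stdGaussian (f := fun (_ : ι) (_ : κ) x => Real.exp (τ / 2 * x ^ 2))
    (fun _ _ _ => (Real.exp_pos _).le) (fun i j => (exp_sq_gaussianReal hτ).1)
  simp only [← Real.exp_sum, ← Finset.mul_sum] at h
  rw [h]
  simp only [(exp_sq_gaussianReal hτ).2, Finset.prod_const, Finset.card_univ]
  rw [← pow_mul, mul_comm]

/-- The transpose of the map `T` has operator norm at most `g`. -/
def AdjLe (T : (ι → κ → ℝ) → Matrix ι' κ' ℝ) (g : ℝ) : Prop :=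
  ∀ x : ι' → κ' → ℝ, ∃ c : ι → κ → ℝ,
    (∀ W, ∑ i, ∑ j, x i j * T W i j = ∑ i, ∑ j, c i j * W i j) ∧
      ∑ i, ∑ j, c i j ^ 2 ≤ g ^ 2 * ∑ i, ∑ j, x i j ^ 2

lemma lintegral_exp_frob_sq_le {T : (ι → κ → ℝ) → Matrix ι' κ' ℝ} (hT : Continuous T) {g θ : ℝ}
    (hg : AdjLe T g) (hθ : θ ^ 2 * g ^ 2 < 1) :
    ∫⁻ W, ENNReal.ofReal (Real.exp (θ ^ 2 / 2 * frob (T W) ^ 2)) ∂stdGaussian ι κ ≤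
      ENNReal.ofReal ((Real.sqrt (1 - θ ^ 2 * g ^ 2))⁻¹ ^
        (Fintype.card ι' * Fintype.card κ')) := by
  have e1 : ∀ W, ENNReal.ofReal (Real.exp (θ ^ 2 / 2 * frob (T W) ^ 2)) =
      ∫⁻ x, ENNReal.ofReal (Real.exp (∑ i, ∑ j, (θ * T W i j) * x i j))
        ∂stdGaussian ι' κ' := fun W => by
    rw [lintegral_exp_linear, frob_sq_eq_sum]
    congr 2
    simp only [mul_pow, ← Finset.mul_sum]
    ring
  simp only [e1]
  rw [lintegral_lintegral_swap]
  · rw [← lintegral_exp_sq hθ]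
    refine lintegral_mono fun x => ?_
    obtain ⟨c, hc, hc'⟩ := hg x
    have e2 : ∀ W, ∑ i, ∑ j, (θ * T W i j) * x i j = ∑ i, ∑ j, (θ * c i j) * W i j := fun W => by
      simp only [mul_assoc, ← Finset.mul_sum, ← hc W]
      simp only [mul_comm]
    simp only [e2]
    rw [lintegral_exp_linear]
    refine ENNReal.ofReal_le_ofReal (Real.exp_le_exp.2 ?_)
    simp only [mul_pow, ← Finset.mul_sum]
    have := mul_le_mul_of_nonneg_left hc' (by positivity : 0 ≤ θ ^ 2 / 2)
    linarith
  · refine Measurable.aemeasurable ?_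
    refine ENNReal.measurable_ofReal.comp (Continuous.measurable ?_)
    refine Real.continuous_exp.comp (continuous_finsetSum _ fun i _ =>
      continuous_finsetSum _ fun j _ => ?_)
    have : Continuous fun W => T W i j := hT.matrix_elem i j
    fun_prop

lemma frob_tail {T : (ι → κ → ℝ) → Matrix ι' κ' ℝ} (hT : Continuous T) {g K x : ℝ}
    (hg0 : 0 < g) (hg : AdjLe T g) (hK : (Fintype.card ι' * Fintype.card κ' : ℕ) = K)
    (hK0 : 0 < K) (hx : 0 ≤ x) :
    stdGaussian ι κ {W | g * (Real.sqrt K + Real.sqrt (2 * x)) ≤ frob (T W)} ≤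
      ENNReal.ofReal (Real.exp (-x)) := by
  rcases hx.eq_or_lt with rfl | hx
  · simpa using prob_le_one
  set r := Real.sqrt K with hr
  set y := Real.sqrt (2 * x) with hy
  have hr0 : 0 < r := Real.sqrt_pos.2 hK0
  have hy0 : 0 < y := Real.sqrt_pos.2 (by linarith)
  have hr2 : r ^ 2 = K := Real.sq_sqrt hK0.le
  have hy2 : y ^ 2 = 2 * x := Real.sq_sqrt (by linarith)
  set θ := Real.sqrt (1 - r ^ 2 / (r + y) ^ 2) / g with hθ
  have hlt : r ^ 2 / (r + y) ^ 2 < 1 := by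
    rw [div_lt_one (by positivity)]
    nlinarith
  have hθg : θ ^ 2 * g ^ 2 = 1 - r ^ 2 / (r + y) ^ 2 := by
    rw [hθ, div_pow, Real.sq_sqrt (by linarith)]
    field_simp
  have h1 := lintegral_exp_frob_sq_le hT hg (θ := θ) (by
    rw [hθg]
    have : 0 < r ^ 2 / (r + y) ^ 2 := by positivity
    linarith)
  have e1 : (Real.sqrt (1 - θ ^ 2 * g ^ 2))⁻¹ = 1 + y / r := by
    rw [hθg, sub_sub_cancel, Real.sqrt_div (by positivity), Real.sqrt_sq hr0.le,
      Real.sqrt_sq (by positivity)]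
    field_simp
  rw [e1] at h1
  set M := Real.exp (θ ^ 2 / 2 * (g * (r + y)) ^ 2) with hM
  have hsub : {W | g * (r + y) ≤ frob (T W)} ⊆
      {W | ENNReal.ofReal M ≤ ENNReal.ofReal (Real.exp (θ ^ 2 / 2 * frob (T W) ^ 2))} := by
    intro W hW
    refine ENNReal.ofReal_le_ofReal (Real.exp_le_exp.2 ?_)
    have := pow_le_pow_left₀ (by positivity) (Set.mem_ofPred.1 hW) 2
    gcongr
  have hmeas : Measurable fun W =>
      ENNReal.ofReal (Real.exp (θ ^ 2 / 2 * frob (T W) ^ 2)) := by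
    refine ENNReal.measurable_ofReal.comp (Continuous.measurable ?_)
    have : Continuous fun W => frob (T W) := continuous_frob.comp hT
    fun_prop
  have h2 := (mul_meas_ge_le_lintegral hmeas (ENNReal.ofReal M)).trans h1
  have hM0 : 0 < M := Real.exp_pos _
  refine (measure_mono hsub).trans ?_
  rw [← ENNReal.mul_le_mul_iff_right (a := ENNReal.ofReal M) (by simpa using hM0)
    ENNReal.ofReal_ne_top]
  refine h2.trans ?_
  rw [← ENNReal.ofReal_mul hM0.le]
  refine ENNReal.ofReal_le_ofReal ?_
  have h3 : (1 + y / r) ^ (Fintype.card ι' * Fintype.card κ') ≤ Real.exp (r * y) := by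
    have h4 : 1 + y / r ≤ Real.exp (y / r) := by linarith [Real.add_one_le_exp (y / r)]
    refine (pow_le_pow_left₀ (by positivity) h4 _).trans ?_
    rw [← Real.exp_nat_mul, hK, ← hr2]
    refine Real.exp_le_exp.2 (le_of_eq ?_)
    field_simp
  refine h3.trans ?_
  rw [hM, ← Real.exp_add]
  refine Real.exp_le_exp.2 (le_of_eq ?_)
  have e2 : θ ^ 2 / 2 * (g * (r + y)) ^ 2 = ((r + y) ^ 2 - r ^ 2) / 2 := by
    rw [show θ ^ 2 / 2 * (g * (r + y)) ^ 2 = (θ ^ 2 * g ^ 2) * (r + y) ^ 2 / 2 by ring, hθg]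
    field_simp
  rw [e2]
  nlinarith

end Gaussian

section OperatorTail
variable {ι κ p q : Type*} [Fintype ι] [Fintype κ] [Fintype p] [Fintype q]

lemma exp_le_lintegral_ball {X : Matrix q p ℝ} {u : p → ℝ} (hu : vnorm u = 1) {s : ℝ}
    (hs0 : 0 ≤ s) (hs : s ≤ vnorm (X *ᵥ u)) :
    ENNReal.ofReal (Real.exp (9 / 64 * s ^ 2)) * (ENNReal.ofReal ((1 / 4) ^ Fintype.card p) *
      volume (Metric.ball (0 : EuclideanSpace ℝ p) 1)) ≤
    ∫⁻ v in Metric.ball (0 : EuclideanSpace ℝ p) 1,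
      ENNReal.ofReal (Real.exp (vnorm (X *ᵥ v.ofLp) ^ 2 / 4)) := by
  set f : EuclideanSpace ℝ p → ENNReal := fun v =>
    ENNReal.ofReal (Real.exp (vnorm (X *ᵥ v.ofLp) ^ 2 / 4)) with hf
  set c : EuclideanSpace ℝ p := WithLp.toLp 2 ((3 / 4 : ℝ) • u) with hc
  have hcn : ‖c‖ = 3 / 4 := by
    rw [hc, ← vnorm_eq_norm, vnorm_smul, hu]
    norm_num
  have hsub : Metric.ball c (1 / 4) ⊆ Metric.ball (0 : EuclideanSpace ℝ p) 1 := by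
    refine Metric.ball_subset_ball' ?_
    rw [dist_zero_right, hcn]
    norm_num
  refine le_trans ?_ (lintegral_mono_set hsub)
  set k := (Metric.ball c (1 / 4)).indicator f with hk
  have hint : ∫⁻ v in Metric.ball c (1 / 4), f v = ∫⁻ v, k v :=
    (lintegral_indicator Metric.isOpen_ball.measurableSet f).symm
  rw [hint]
  have hfm : Measurable f := by
    have : Continuous fun v : EuclideanSpace ℝ p => vnorm (X *ᵥ v.ofLp) := by
      simp only [vnorm_eq_norm]
      fun_prop
    exact ENNReal.measurable_ofReal.comp (Continuous.measurable (by fun_prop))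
  have hkm : Measurable k := hfm.indicator Metric.isOpen_ball.measurableSet
  set M := ENNReal.ofReal (Real.exp (9 / 64 * s ^ 2)) with hM
  have hpt : ∀ v, (Metric.ball (0 : EuclideanSpace ℝ p) (1 / 4)).indicator (fun _ => 2 * M) v ≤
      k (c + v) + k (c - v) := by
    intro v
    by_cases hv : v ∈ Metric.ball (0 : EuclideanSpace ℝ p) (1 / 4)
    · have hv' : ‖v‖ < 1 / 4 := by simpa using hv
      rw [Set.indicator_of_mem hv, hk, Set.indicator_of_mem (by simpa [dist_eq_norm] using hv'),
        Set.indicator_of_mem (by simpa [dist_eq_norm] using hv')]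
      rw [hf, hM, two_mul]
      simp only
      rw [← ENNReal.ofReal_add (Real.exp_pos _).le (Real.exp_pos _).le,
        ← ENNReal.ofReal_add (Real.exp_pos _).le (Real.exp_pos _).le]
      refine ENNReal.ofReal_le_ofReal ?_
      set a := vnorm (X *ᵥ (c + v).ofLp) ^ 2 / 4 with ha
      set b := vnorm (X *ᵥ (c - v).ofLp) ^ 2 / 4 with hb
      have hab : 2 * (9 / 64 * s ^ 2) ≤ a + b := by
        have e1 : vnorm (X *ᵥ c.ofLp) = 3 / 4 * vnorm (X *ᵥ u) := by
          rw [hc, Matrix.mulVec_smul, vnorm_smul]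
          norm_num
        have e2 : vnorm (X *ᵥ (c + v).ofLp) ^ 2 + vnorm (X *ᵥ (c - v).ofLp) ^ 2 =
            2 * vnorm (X *ᵥ c.ofLp) ^ 2 + 2 * vnorm (X *ᵥ v.ofLp) ^ 2 := by
          simp only [WithLp.ofLp_add, WithLp.ofLp_sub, Matrix.mulVec_add, Matrix.mulVec_sub,
            vnorm_sq, dotProduct_add, add_dotProduct, dotProduct_sub, sub_dotProduct]
          ring
        have e3 := pow_le_pow_left₀ hs0 hs 2
        have e4 := sq_nonneg (vnorm (X *ᵥ v.ofLp))
        rw [e1] at e2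
        rw [ha, hb]
        nlinarith
      have h3 : Real.exp (9 / 64 * s ^ 2) ≤ Real.exp ((a + b) / 2) :=
        Real.exp_le_exp.2 (by linarith)
      have h4 : 2 * Real.exp ((a + b) / 2) ≤ Real.exp a + Real.exp b := by
        have e5 : Real.exp ((a + b) / 2) = Real.exp (a / 2) * Real.exp (b / 2) := by
          rw [← Real.exp_add]
          ring_nf
        have e6 : ∀ z, Real.exp z = Real.exp (z / 2) ^ 2 := fun z => by
          rw [← Real.exp_nat_mul]
          ring_nf
        rw [e5, e6 a, e6 b]
        nlinarith [sq_nonneg (Real.exp (a / 2) - Real.exp (b / 2))]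
      linarith
    · rw [Set.indicator_of_notMem hv]
      exact zero_le
  have h1 := lintegral_mono (μ := volume) hpt
  rw [lintegral_indicator_const Metric.isOpen_ball.measurableSet,
    lintegral_add_left (f := fun v => k (c + v)) (hkm.comp (measurable_const_add c)),
    lintegral_add_left_eq_self (μ := volume) k c, lintegral_sub_left_eq_self k c,
    Measure.addHaar_ball_of_pos _ _ (by norm_num), ← two_mul, mul_assoc, finrank_euclideanSpace]
    at h1
  exact (ENNReal.mul_le_mul_iff_right two_ne_zero ENNReal.ofNat_ne_top).1 h1

lemma op_tail {Φ : (ι → κ → ℝ) → Matrix p q ℝ} (hΦ : Continuous Φ) (hΦ' : AdjLe Φ 1) {x : ℝ}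
    (hx : 0 ≤ x) :
    stdGaussian ι κ {W | ¬ OpLe (Φ W) (1.6 * Real.sqrt (Fintype.card q) +
      3.2 * Real.sqrt (Fintype.card p) + 2 * Real.sqrt (2 * x))} ≤
        ENNReal.ofReal (Real.exp (-x)) := by
  set s := 1.6 * Real.sqrt (Fintype.card q) +
      3.2 * Real.sqrt (Fintype.card p) + 2 * Real.sqrt (2 * x) with hs
  have hs0 : 0 ≤ s := by positivity
  set V := volume (Metric.ball (0 : EuclideanSpace ℝ p) 1) with hV
  have hV0 : V ≠ 0 := (Metric.measure_ball_pos volume _ one_pos).ne'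
  have hVt : V ≠ ⊤ := measure_ball_lt_top.ne
  set F : (ι → κ → ℝ) → EuclideanSpace ℝ p → ENNReal := fun W v =>
    ENNReal.ofReal (Real.exp (vnorm ((Φ W)ᵀ *ᵥ v.ofLp) ^ 2 / 4)) with hF
  have hFm : Measurable (Function.uncurry F) := by
    have h1 : Continuous fun z : (ι → κ → ℝ) × EuclideanSpace ℝ p =>
        vnorm ((Φ z.1)ᵀ *ᵥ z.2.ofLp) := by
      simp only [vnorm_eq_norm]
      have : Continuous fun z : (ι → κ → ℝ) × EuclideanSpace ℝ p => (Φ z.1)ᵀ *ᵥ z.2.ofLp :=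
        (hΦ.comp continuous_fst).matrix_transpose.matrix_mulVec (by fun_prop)
      fun_prop
    exact ENNReal.measurable_ofReal.comp (Continuous.measurable (by fun_prop))
  set c := Real.exp (9 / 64 * s ^ 2) * (1 / 4) ^ Fintype.card p with hc
  have hc0 : 0 < c := by positivity
  have hsub : {W | ¬ OpLe (Φ W) s} ⊆ {W | ENNReal.ofReal c * V ≤
      ∫⁻ v in Metric.ball (0 : EuclideanSpace ℝ p) 1, F W v} := by
    intro W hW
    have h1 : ¬ OpLe (Φ W)ᵀ s := fun h => hW (by simpa using h.transpose hs0)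
    have h2 : ∃ u : p → ℝ, vnorm u = 1 ∧ s < vnorm ((Φ W)ᵀ *ᵥ u) := by
      by_contra hcon
      push Not at hcon
      exact h1 (opLe_of_unit hcon)
    obtain ⟨u, hu, hu'⟩ := h2
    have := exp_le_lintegral_ball hu hs0 hu'.le
    rwa [← mul_assoc, ← ENNReal.ofReal_mul (Real.exp_pos _).le] at this
  have hmean : ∫⁻ W, (∫⁻ v in Metric.ball (0 : EuclideanSpace ℝ p) 1, F W v) ∂stdGaussian ι κ ≤
      ENNReal.ofReal (Real.sqrt 2 ^ Fintype.card q) * V := by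
    rw [lintegral_lintegral_swap hFm.aemeasurable]
    rw [hV, ← setLIntegral_const]
    refine setLIntegral_mono' Metric.isOpen_ball.measurableSet fun v hv => ?_
    have hv1 : vnorm v.ofLp ≤ 1 := by
      rw [vnorm_eq_norm]
      exact (by simpa using hv : ‖v‖ < 1).le
    set T : (ι → κ → ℝ) → Matrix Unit q ℝ := fun W => Matrix.of fun _ j =>
      ((Φ W)ᵀ *ᵥ v.ofLp) j with hT
    have hTc : Continuous T := by
      refine continuous_matrix fun _ j => ?_
      exact (continuous_apply j).comp (hΦ.matrix_transpose.matrix_mulVec continuous_const)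
    have hTa : AdjLe T 1 := by
      intro y
      obtain ⟨c, h1, h2⟩ := hΦ' fun a j => v.ofLp a * y () j
      refine ⟨c, fun W => ?_, h2.trans ?_⟩
      · rw [← h1 W]
        simp only [hT, Matrix.of_apply, mulVec, dotProduct, Matrix.transpose_apply,
          Finset.univ_unique, Finset.sum_singleton, Finset.mul_sum]
        rw [Finset.sum_comm]
        refine Finset.sum_congr rfl fun a _ => Finset.sum_congr rfl fun j _ => ?_
        change y () j * _ = _
        ring
      · simp only [mul_pow, ← Finset.mul_sum, ← Finset.sum_mul, Finset.univ_unique,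
          Finset.sum_singleton]
        have h3 : ∑ a, v.ofLp a ^ 2 ≤ 1 := by
          have := pow_le_pow_left₀ (vnorm_nonneg _) hv1 2
          rw [vnorm_sq, dotProduct] at this
          simpa only [pow_two, mul_one] using this
        have h4 : 0 ≤ ∑ j, y () j ^ 2 := Finset.sum_nonneg fun j _ => sq_nonneg _
        have h5 := mul_le_mul_of_nonneg_right h3 h4
        change 1 ^ 2 * ((∑ a, v.ofLp a ^ 2) * ∑ j, y () j ^ 2) ≤ 1 ^ 2 * ∑ j, y () j ^ 2
        linarith
    have h5 := lintegral_exp_frob_sq_le hTc hTa (θ := Real.sqrt (1 / 2)) (by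
      rw [Real.sq_sqrt (by norm_num)]
      norm_num)
    rw [Real.sq_sqrt (by norm_num)] at h5
    have e1 : ∀ W, frob (T W) = vnorm ((Φ W)ᵀ *ᵥ v.ofLp) := fun W => by
      simp [frob, vnorm, hT]
    have e2 : (Real.sqrt (1 - 1 / 2 * 1 ^ 2))⁻¹ = Real.sqrt 2 := by
      rw [← Real.sqrt_inv]
      norm_num
    simp only [e1, e2, Fintype.card_unit, one_mul] at h5
    refine le_trans (le_of_eq ?_) h5
    refine lintegral_congr fun W => ?_
    simp only [hF]
    congr 2
    ring
  have hmark := (mul_meas_ge_le_lintegral (μ := stdGaussian ι κ)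
    hFm.lintegral_prod_right' (ENNReal.ofReal c * V)).trans hmean
  refine (measure_mono hsub).trans ?_
  rw [← ENNReal.mul_le_mul_iff_right (a := ENNReal.ofReal c * V)
    (mul_ne_zero (by simpa using hc0) hV0) (ENNReal.mul_ne_top ENNReal.ofReal_ne_top hVt)]
  refine hmark.trans ?_
  rw [mul_right_comm, ← ENNReal.ofReal_mul hc0.le]
  refine mul_le_mul_left (ENNReal.ofReal_le_ofReal ?_) _
  have hlog : Real.log 2 < 0.7 := Real.log_two_lt_d9.trans (by norm_num)
  have h2 : (2 : ℝ) ≤ Real.exp 0.72 := by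
    rw [← Real.log_le_iff_le_exp two_pos]
    linarith
  have hs2 : Real.sqrt 2 ≤ Real.exp 0.36 := by
    refine Real.sqrt_le_iff.2 ⟨(Real.exp_pos _).le, h2.trans (le_of_eq ?_)⟩
    rw [← Real.exp_nat_mul]
    norm_num
  have h4 : Real.exp (-1.44) ≤ 1 / 4 := by
    rw [Real.exp_neg, one_div]
    refine inv_anti₀ (by norm_num) ?_
    have : Real.exp 1.44 = Real.exp 0.72 ^ 2 := by
      rw [← Real.exp_nat_mul]
      norm_num
    rw [this]
    nlinarith
  have h6 := pow_le_pow_left₀ (Real.sqrt_nonneg 2) hs2 (Fintype.card q)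
  have h7 := pow_le_pow_left₀ (Real.exp_pos _).le h4 (Fintype.card p)
  rw [← Real.exp_nat_mul] at h6 h7
  refine h6.trans ?_
  have h8 : Real.exp (9 / 64 * s ^ 2) * Real.exp (Fintype.card p * (-1.44)) * Real.exp (-x) ≤
      c * Real.exp (-x) := by
    rw [hc]
    gcongr
  refine le_trans ?_ h8
  rw [← Real.exp_add, ← Real.exp_add]
  refine Real.exp_le_exp.2 ?_
  have a1 := Real.sq_sqrt (Nat.cast_nonneg (α := ℝ) (Fintype.card q))
  have a2 := Real.sq_sqrt (Nat.cast_nonneg (α := ℝ) (Fintype.card p))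
  have a3 := Real.sq_sqrt (by linarith : 0 ≤ 2 * x)
  have b1 := Real.sqrt_nonneg (Fintype.card q : ℝ)
  have b2 := Real.sqrt_nonneg (Fintype.card p : ℝ)
  have b3 := Real.sqrt_nonneg (2 * x)
  rw [hs]
  nlinarith [mul_nonneg b1 b2, mul_nonneg b1 b3, mul_nonneg b2 b3]

end OperatorTail

section NoiseTail

lemma adjLe_submatrix {ι κ p : Type*} [Fintype ι] [Fintype κ] [Fintype p] {f : p → ι}
    (hf : Function.Injective f) :
    AdjLe (fun W : ι → κ → ℝ => (Matrix.of fun a j => W (f a) j : Matrix p κ ℝ)) 1 := by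
  intro x
  refine ⟨Function.extend f x 0, fun W => ?_, ?_⟩
  · refine Fintype.sum_of_injective f hf _ _ (fun i hi => ?_) fun a => ?_
    · have h := Function.extend_apply' x (0 : ι → κ → ℝ) i (by simpa using hi)
      simp [h]
    · simp [hf.extend_apply]
  · rw [one_pow, one_mul]
    refine le_of_eq (Fintype.sum_of_injective f hf _ _ (fun i hi => ?_) fun a => ?_).symm
    · have h := Function.extend_apply' x (0 : ι → κ → ℝ) i (by simpa using hi)
      simp [h]
    · simp [hf.extend_apply]

lemma AdjLe.mul_const {ι κ ι' κ' ρ : Type*} [Fintype ι] [Fintype κ] [Fintype ι'] [Fintype κ']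
    [Fintype ρ] {T : (ι → κ → ℝ) → Matrix ι' κ' ℝ} {g c : ℝ} (h : AdjLe T g) (hc : 0 ≤ c)
    {M : Matrix κ' ρ ℝ} (hM : OpLe M c) : AdjLe (fun W => T W * M) (g * c) := by
  intro x
  obtain ⟨b, h1, h2⟩ := h (Matrix.of x * Mᵀ)
  refine ⟨b, fun W => ?_, h2.trans ?_⟩
  · rw [← h1 W]
    refine Finset.sum_congr rfl fun i _ => ?_
    simp only [mul_apply, transpose_apply, of_apply, Finset.mul_sum, Finset.sum_mul]
    rw [Finset.sum_comm]
    refine Finset.sum_congr rfl fun j _ => Finset.sum_congr rfl fun k _ => ?_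
    ring
  · have h3 := pow_le_pow_left₀ (frob_nonneg _)
      ((hM.transpose hc).mul_frob hc (Matrix.of x)) 2
    rw [mul_pow, frob_sq_eq_sum, frob_sq_eq_sum] at h3
    have h4 := mul_le_mul_of_nonneg_left h3 (sq_nonneg g)
    rw [mul_pow, mul_assoc]
    exact h4

variable {n d m : ℕ}

lemma continuous_blk (i : Fin n) : Continuous fun W : Matrix (Fin n × Fin d) (Fin m) ℝ =>
    blk W i :=
  continuous_matrix fun a b => continuous_id.matrix_elem (i, a) b

lemma continuous_mask (i : Fin n) : Continuous fun W : Matrix (Fin n × Fin d) (Fin m) ℝ =>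
    mask W i := by
  refine continuous_matrix fun p b => ?_
  by_cases h : p.1 = i
  · simp only [mask, of_apply, h, if_true]
    exact continuous_const
  · simp only [mask, of_apply, h, if_false]
    exact continuous_id.matrix_elem p b

lemma isClosed_opLe {α β : Type*} [Fintype α] [Fintype β] (c : ℝ) :
    IsClosed {X : Matrix α β ℝ | OpLe X c} := by
  have : {X : Matrix α β ℝ | OpLe X c} =
      ⋂ v : β → ℝ, {X : Matrix α β ℝ | vnorm (X *ᵥ v) ≤ c * vnorm v} := by
    ext X
    simp [OpLe]
  rw [this]
  refine isClosed_iInter fun v => isClosed_le ?_ continuous_const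
  simp only [vnorm_eq_norm]
  have : Continuous fun X : Matrix α β ℝ => X *ᵥ v :=
    continuous_id.matrix_mulVec continuous_const
  fun_prop

lemma isCompact_stiefel {N : Type*} [Fintype N] (d : ℕ) :
    IsCompact {V : Matrix N (Fin d) ℝ | Vᵀ * V = 1} := by
  have hc : IsCompact (Set.univ.pi fun _ : N => Set.univ.pi fun _ : Fin d =>
      Set.Icc (-1 : ℝ) 1) := isCompact_univ_pi fun _ => isCompact_univ_pi fun _ => isCompact_Icc
  refine IsCompact.of_isClosed_subset hc ?_ ?_
  · have h1 : Continuous fun V : Matrix N (Fin d) ℝ => Vᵀ * V := by fun_prop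
    exact isClosed_eq h1 continuous_const
  · intro V hV i _ j _
    have h := congrFun (congrFun (Set.mem_ofPred.1 hV) j) j
    simp only [mul_apply, transpose_apply, one_apply_eq] at h
    have h2 : V i j * V i j ≤ 1 := h ▸ Finset.single_le_sum (f := fun i => V i j * V i j)
      (fun _ _ => mul_self_nonneg _) (Finset.mem_univ i)
    exact abs_le.1 (abs_le_of_sq_le_sq (by nlinarith) zero_le_one)

/-- The event that the noise block `i` is badly correlated with a leave-one-out eigenspace. -/
def correlatedEvent (A : Matrix (Fin d) (Fin m) ℝ) (σ : ℝ) (i : Fin n) (g s : ℝ) :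
    Set (Fin n × Fin d → Fin m → ℝ) :=
  {W | OpLe (mask (Matrix.of W) i) g ∧ ∃ V : Matrix (Fin n × Fin d) (Fin d) ℝ,
    IsTopSingVecs (ZStack n d * A + σ • mask (Matrix.of W) i) V ∧
      s ≤ frob (blk (Matrix.of W) i * (mask (Matrix.of W) i)ᵀ * V)}

lemma isClosed_correlatedEvent (A : Matrix (Fin d) (Fin m) ℝ) (σ : ℝ) (i : Fin n) (g s : ℝ) :
    IsClosed (correlatedEvent A σ i g s) := by
  set K := {V : Matrix (Fin n × Fin d) (Fin d) ℝ | Vᵀ * V = 1} with hK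
  have hcomp : CompactSpace K := isCompact_iff_compactSpace.1 (isCompact_stiefel d)
  have hof : Continuous fun W : Fin n × Fin d → Fin m → ℝ =>
      (Matrix.of W : Matrix (Fin n × Fin d) (Fin m) ℝ) := continuous_id
  have hm : Continuous fun W : Fin n × Fin d → Fin m → ℝ => mask (Matrix.of W) i :=
    (continuous_mask i).comp hof
  have hb : Continuous fun W : Fin n × Fin d → Fin m → ℝ => blk (Matrix.of W) i :=
    (continuous_blk i).comp hof
  set R : Set ((Fin n × Fin d → Fin m → ℝ) × K) := {z |
    (∀ Q : Matrix (Fin n × Fin d) (Fin d) ℝ, Qᵀ * Q = 1 →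
      trace (Qᵀ * ((ZStack n d * A + σ • mask (Matrix.of z.1) i) *
        (ZStack n d * A + σ • mask (Matrix.of z.1) i)ᵀ) * Q) ≤
      trace ((z.2 : Matrix (Fin n × Fin d) (Fin d) ℝ)ᵀ *
        ((ZStack n d * A + σ • mask (Matrix.of z.1) i) *
        (ZStack n d * A + σ • mask (Matrix.of z.1) i)ᵀ) *
        (z.2 : Matrix (Fin n × Fin d) (Fin d) ℝ))) ∧
    s ≤ frob (blk (Matrix.of z.1) i * (mask (Matrix.of z.1) i)ᵀ *
      (z.2 : Matrix (Fin n × Fin d) (Fin d) ℝ))} with hR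
  have hm' : Continuous fun z : (Fin n × Fin d → Fin m → ℝ) × K => mask (Matrix.of z.1) i :=
    hm.comp continuous_fst
  have hb' : Continuous fun z : (Fin n × Fin d → Fin m → ℝ) × K => blk (Matrix.of z.1) i :=
    hb.comp continuous_fst
  have hv : Continuous fun z : (Fin n × Fin d → Fin m → ℝ) × K =>
    (z.2 : Matrix (Fin n × Fin d) (Fin d) ℝ) := continuous_subtype_val.comp continuous_snd
  have hRc : IsClosed R := by
    simp only [hR, Set.ofPred_and, Set.ofPred_forall]
    refine IsClosed.inter ?_ ?_
    · refine isClosed_iInter fun Q => isClosed_iInter fun _ => isClosed_le ?_ ?_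
      · exact Continuous.matrix_trace (by fun_prop)
      · exact Continuous.matrix_trace (by fun_prop)
    · refine isClosed_le continuous_const (continuous_frob.comp ?_)
      fun_prop
  have e : correlatedEvent A σ i g s =
      {W | OpLe (mask (Matrix.of W) i) g} ∩ Prod.fst '' R := by
    ext W
    constructor
    · rintro ⟨h1, V, ⟨h2, h3⟩, h4⟩
      exact ⟨h1, ⟨(W, ⟨V, h2⟩), ⟨h3, h4⟩, rfl⟩⟩
    · rintro ⟨h1, ⟨⟨W', V⟩, ⟨h3, h4⟩, rfl⟩⟩
      exact ⟨h1, V, ⟨V.2, h3⟩, h4⟩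
  rw [e]
  exact ((isClosed_opLe g).preimage hm).inter (isClosedMap_fst_of_compactSpace R hRc)

lemma measure_correlatedEvent_le {A : Matrix (Fin d) (Fin m) ℝ} {σ a s e B x : ℝ}
    (hA : OpLe A a) (hA' : OpGe Aᵀ s) (hσ : 0 ≤ σ) (hB : 0 < B)
    (sc : Scale n d a s e (σ * B)) (hx : 0 ≤ x) (i : Fin n) :
    stdGaussian (Fin n × Fin d) (Fin m)
      (correlatedEvent A σ i (3.2 * B) (3.2 * B * (d + Real.sqrt (2 * x)))) ≤
        ENNReal.ofReal (Real.exp (-x)) := by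
  set E := correlatedEvent A σ i (3.2 * B) (3.2 * B * (d + Real.sqrt (2 * x))) with hE
  have hEm : MeasurableSet E := (isClosed_correlatedEvent A σ i _ _).measurableSet
  set p : Fin n × Fin d → Prop := fun z => z.1 = i with hp
  have hmp := measurePreserving_piEquivPiSubtypeProd (fun _ : Fin n × Fin d =>
    Measure.pi fun _ : Fin m => ProbabilityTheory.gaussianReal 0 1) p
  set φ := MeasurableEquiv.piEquivPiSubtypeProd (fun _ : Fin n × Fin d => Fin m → ℝ) p with hφ
  change MeasurePreserving φ (stdGaussian (Fin n × Fin d) (Fin m))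
    ((stdGaussian (Subtype p) (Fin m)).prod (stdGaussian {z // ¬ p z} (Fin m))) at hmp
  have h1 := (hmp.symm φ).measure_preimage hEm.nullMeasurableSet
  rw [← h1, Measure.prod_apply_symm (φ.symm.measurable hEm)]
  have h2 : ∀ y₂, stdGaussian (Subtype p) (Fin m) ((fun y₁ => (y₁, y₂)) ⁻¹' (φ.symm ⁻¹' E)) ≤
      ENNReal.ofReal (Real.exp (-x)) := by
    intro y₂
    have hblk : ∀ y₁, blk (Matrix.of (φ.symm (y₁, y₂))) i =
        (Matrix.of fun a j => y₁ ⟨(i, a), rfl⟩ j : Matrix (Fin d) (Fin m) ℝ) := fun y₁ => by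
      ext a j
      simp [blk, φ, MeasurableEquiv.piEquivPiSubtypeProd, Equiv.piEquivPiSubtypeProd, p]
    have hmask : ∀ y₁ y₁', mask (Matrix.of (φ.symm (y₁, y₂))) i =
        mask (Matrix.of (φ.symm (y₁', y₂))) i := fun y₁ y₁' => by
      ext z j
      by_cases h : z.1 = i
      · simp [mask, h]
      · simp [mask, h, φ, MeasurableEquiv.piEquivPiSubtypeProd, Equiv.piEquivPiSubtypeProd, p]
    by_cases hne : ∃ y₁, φ.symm (y₁, y₂) ∈ E
    · obtain ⟨y₀, hM, U, hU, -⟩ := hne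
      set M := mask (Matrix.of (φ.symm (y₀, y₂))) i with hMdef
      have hB' : 0 ≤ 3.2 * B := by positivity
      have hG : OpLe (Mᵀ * U) (3.2 * B) := by
        have := (hM.transpose hB').mul hB' (opLe_one_of_orthonormal hU.1)
        rwa [mul_one] at this
      have hcont : Continuous fun y : Subtype p → Fin m → ℝ =>
          (Matrix.of fun a j => y ⟨(i, a), rfl⟩ j : Matrix (Fin d) (Fin m) ℝ) :=
        continuous_matrix fun a j => by
          simp only [of_apply]
          fun_prop
      have hadj := (adjLe_submatrix (κ := Fin m) (f := fun a : Fin d => (⟨(i, a), rfl⟩ : Subtype p))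
        (fun a b hab => by simpa using hab)).mul_const hB' hG
      rw [one_mul] at hadj
      have hd : (0 : ℝ) < d := by exact_mod_cast sc.one_le
      have ht := frob_tail (hcont.matrix_mul continuous_const) (by positivity) hadj
        (K := (d : ℝ) ^ 2) (by simp [pow_two]) (by positivity) hx
      rw [Real.sqrt_sq hd.le] at ht
      refine (measure_mono ?_).trans ht
      rintro y ⟨-, V, hV, hV'⟩
      simp only at hV hV'
      rw [hmask y y₀] at hV hV'
      obtain ⟨Q, hQ, rfl⟩ := hU.exists_orth_eq hV hA hA' hM hσ hB.le sc
      rw [← Matrix.mul_assoc, frob_mul_orth _ hQ, hblk, Matrix.mul_assoc] at hV'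
      exact hV'
    · have : (fun y₁ => (y₁, y₂)) ⁻¹' (φ.symm ⁻¹' E) = ∅ :=
        Set.eq_empty_of_forall_notMem fun y₁ hy => hne ⟨y₁, hy⟩
      rw [this, measure_empty]
      exact zero_le
  refine (lintegral_mono h2).trans ?_
  simp

end NoiseTail

section NoiseEvent
variable {n d m : ℕ}

lemma bnd1_eq (n d m : ℕ) (γ : ℝ) : bnd1 n d m γ =
    Real.sqrt n * Real.sqrt d + Real.sqrt m + Real.sqrt n * Real.sqrt (2 * (γ * Real.log n)) := by
  rw [bnd1, Real.sqrt_mul (Nat.cast_nonneg n), ← Real.sqrt_mul (Nat.cast_nonneg n)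
    (2 * (γ * Real.log n))]
  congr 2
  ring

lemma measure_not_noise_le {A : Matrix (Fin d) (Fin m) ℝ} {σ a s e γ : ℝ}
    (hA : OpLe A a) (hA' : OpGe Aᵀ s) (hm : 0 < m) (hσ : 0 ≤ σ) (hγ : 0 ≤ γ)
    (sc : Scale n d a s e (σ * bnd1 n d m γ)) :
    stdGaussian (Fin n × Fin d) (Fin m)
      {W | ¬ Noise A (Matrix.of W) σ (bnd1 n d m γ) a} ≤
        (1 + n * 4) * ENNReal.ofReal (Real.exp (-(γ * Real.log n))) := by
  set B := bnd1 n d m γ with hBdef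
  set x := γ * Real.log n with hx
  have hx0 : 0 ≤ x := mul_nonneg hγ (Real.log_natCast_nonneg n)
  have hBeq := bnd1_eq n d m γ
  rw [← hBdef, ← hx] at hBeq
  set L := Real.sqrt (2 * x) with hL
  have ha : 0 < a := sc.s_pos.trans_le sc.s_le
  have hn2 : (2 : ℝ) ≤ n := by exact_mod_cast sc.two_le
  have hd1 : (1 : ℝ) ≤ d := by exact_mod_cast sc.one_le
  have hrn : 1.41 ≤ Real.sqrt n := Real.le_sqrt_of_sq_le (by norm_num; linarith)
  have hrd : 1 ≤ Real.sqrt d := Real.one_le_sqrt.2 hd1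
  have hrm : 0 ≤ Real.sqrt m := Real.sqrt_nonneg _
  have hL0 : 0 ≤ L := Real.sqrt_nonneg _
  have hdd : Real.sqrt d * Real.sqrt d = d := Real.mul_self_sqrt (Nat.cast_nonneg d)
  have hB1 : 1.41 * Real.sqrt d + Real.sqrt m + 1.41 * L ≤ B := by
    rw [hBeq]
    gcongr
  have hB0 : 0 < B := by nlinarith
  have hBn : d + L ≤ Real.sqrt d * (B / Real.sqrt n) := by
    have h1 : Real.sqrt d + L ≤ B / Real.sqrt n := by
      rw [le_div_iff₀ (by linarith), hBeq]
      linarith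
    have h2 := mul_le_mul_of_nonneg_left h1 (Real.sqrt_nonneg d)
    nlinarith
  have hof : Continuous fun W : Fin n × Fin d → Fin m → ℝ =>
      (Matrix.of W : Matrix (Fin n × Fin d) (Fin m) ℝ) := continuous_id
  have hbc : ∀ i : Fin n, Continuous fun W : Fin n × Fin d → Fin m → ℝ =>
      blk (Matrix.of W) i := fun i => (continuous_blk i).comp hof
  have hba : ∀ i : Fin n, AdjLe (fun W : Fin n × Fin d → Fin m → ℝ => blk (Matrix.of W) i) 1 :=
    fun i => adjLe_submatrix (f := fun a : Fin d => (i, a)) (fun a b hab => by simpa using hab)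
  set c := 1.6 * Real.sqrt m + 3.2 * Real.sqrt d + 2 * L with hc
  have hc0 : 0 ≤ c := by positivity
  set E₁ : Set (Fin n × Fin d → Fin m → ℝ) := {W | ¬ OpLe (Matrix.of W) (1.6 * Real.sqrt m +
    3.2 * Real.sqrt ((n * d : ℕ) : ℝ) + 2 * L)} with hE₁
  set E₂ : Fin n → Set (Fin n × Fin d → Fin m → ℝ) := fun i =>
    {W | ¬ OpLe (blk (Matrix.of W) i) c} with hE₂
  set E₃ : Fin n → Set (Fin n × Fin d → Fin m → ℝ) := fun i =>
    {W | 1 * (Real.sqrt (d * m) + L) ≤ frob (blk (Matrix.of W) i)} with hE₃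
  set E₄ : Fin n → Set (Fin n × Fin d → Fin m → ℝ) := fun i =>
    {W | a * (Real.sqrt (d ^ 2) + L) ≤ frob (blk (Matrix.of W) i * Aᵀ)} with hE₄
  set E₅ : Fin n → Set (Fin n × Fin d → Fin m → ℝ) := fun i =>
    correlatedEvent A σ i (3.2 * B) (3.2 * B * (d + L)) with hE₅
  have hsub : {W | ¬ Noise A (Matrix.of W) σ B a} ⊆
      E₁ ∪ ⋃ i, ((E₂ i ∪ E₃ i) ∪ (E₄ i ∪ E₅ i)) := by
    intro W hW
    by_contra hcon
    simp only [Set.mem_union, Set.mem_iUnion, not_or, not_exists, hE₁, hE₂, hE₃, hE₄,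
      Set.mem_ofPred, not_not, not_le] at hcon
    obtain ⟨h1, h2⟩ := hcon
    have hop : OpLe (Matrix.of W) (3.2 * B) := by
      refine h1.mono ?_
      rw [Nat.cast_mul, Real.sqrt_mul (Nat.cast_nonneg n), hBeq]
      nlinarith
    refine hW ⟨hop, fun i => (h2 i).1.1.mono ?_, fun i => ?_, fun i => ?_, fun i V hV => ?_⟩
    · rw [hc]
      linarith
    · refine (h2 i).2.1.le.trans ?_
      rw [Real.sqrt_sq (Nat.cast_nonneg d), mul_assoc]
      exact mul_le_mul_of_nonneg_left hBn ha.le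
    · refine ((h2 i).1.1.frob_mul hc0 _).trans ?_
      rw [frob_transpose]
      refine (mul_le_mul_of_nonneg_left (h2 i).1.2.le hc0).trans ?_
      rw [Real.sqrt_mul (Nat.cast_nonneg d), one_mul, hc]
      have h3 : Real.sqrt d * Real.sqrt m + L ≤ Real.sqrt d * (Real.sqrt m + L) := by nlinarith
      refine (mul_le_mul_of_nonneg_left h3 hc0).trans ?_
      have h4 : c * (Real.sqrt m + L) ≤
          1.7 * (1.41 * Real.sqrt d + Real.sqrt m + 1.41 * L) ^ 2 := by
        rw [hc]
        have h5 : 0 ≤ Real.sqrt d := Real.sqrt_nonneg _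
        nlinarith [mul_nonneg hrm hL0, mul_nonneg h5 hL0, mul_nonneg h5 hrm]
      have h6 := pow_le_pow_left₀ (by positivity) hB1 2
      have h7 : c * (Real.sqrt m + L) ≤ 1.7 * B ^ 2 := by linarith
      have h8 := mul_le_mul_of_nonneg_left h7 (Real.sqrt_nonneg d)
      linarith
    · have h3 : ¬ 3.2 * B * (d + L) ≤ frob (blk (Matrix.of W) i *
          (mask (Matrix.of W) i)ᵀ * V) := fun h =>
        (h2 i).2.2 ⟨opLe_mask hop i, V, hV, h⟩
      refine (not_le.1 h3).le.trans ?_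
      rw [mul_assoc (3.2 * B)]
      exact mul_le_mul_of_nonneg_left hBn (by positivity)
  set η := ENNReal.ofReal (Real.exp (-x)) with hη
  have m₁ : stdGaussian (Fin n × Fin d) (Fin m) E₁ ≤ η := by
    have := op_tail (ι := Fin n × Fin d) (κ := Fin m) hof
      (adjLe_submatrix (f := fun z : Fin n × Fin d => z) fun _ _ h => h) hx0
    simpa only [Fintype.card_prod, Fintype.card_fin] using this
  have m₂ : ∀ i, stdGaussian (Fin n × Fin d) (Fin m) (E₂ i) ≤ η := fun i => by
    simpa only [Fintype.card_fin] using op_tail (hbc i) (hba i) hx0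
  have m₄ : ∀ i, stdGaussian (Fin n × Fin d) (Fin m) (E₄ i) ≤ η := fun i => by
    have h := (hba i).mul_const ha.le (hA.transpose ha.le)
    rw [one_mul] at h
    exact frob_tail ((hbc i).matrix_mul continuous_const) ha h (by simp [pow_two])
      (by positivity) hx0
  have m₅ : ∀ i, stdGaussian (Fin n × Fin d) (Fin m) (E₅ i) ≤ η := fun i =>
    measure_correlatedEvent_le hA hA' hσ hB0 sc hx0 i
  have m₃ : ∀ i, stdGaussian (Fin n × Fin d) (Fin m) (E₃ i) ≤ η := fun i => by
    have hm' : (0 : ℝ) < m := by exact_mod_cast hm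
    exact frob_tail (hbc i) one_pos (hba i) (by simp) (by positivity) hx0
  refine (measure_mono hsub).trans ((measure_union_le _ _).trans ?_)
  rw [add_mul, one_mul]
  refine add_le_add m₁ ((measure_iUnion_le _).trans ?_)
  rw [tsum_fintype]
  have h4 : ∀ i, stdGaussian (Fin n × Fin d) (Fin m) ((E₂ i ∪ E₃ i) ∪ (E₄ i ∪ E₅ i)) ≤ 4 * η :=
    fun i => by
    refine (measure_union_le _ _).trans ?_
    have h5 := (measure_union_le (μ := stdGaussian (Fin n × Fin d) (Fin m)) (E₂ i) (E₃ i)).trans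
      (add_le_add (m₂ i) (m₃ i))
    have h6 := (measure_union_le (μ := stdGaussian (Fin n × Fin d) (Fin m)) (E₄ i) (E₅ i)).trans
      (add_le_add (m₄ i) (m₅ i))
    refine (add_le_add h5 h6).trans (le_of_eq ?_)
    ring
  refine (Finset.sum_le_sum fun i _ => h4 i).trans ?_
  simp [mul_assoc]

end NoiseEvent

/-- Lemma 5.7: conditioned on the leave-one-out bounds, with high probability
the GPM iterates stay close to the leave-one-out iterates, stay in N_{ξ,∞} and N_ε, and the
iteration contracts: d_F(S^{t+1},Sᵗ) ≤ (1/2)d_F(Sᵗ,S^{t−1}) ≤ 2^{−t}d_F(S¹,S⁰) for 1 ≤ t ≤ T. -/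
theorem gpm_iterates_in_basin :
    ∃ C : ℝ, 0 < C ∧
      ∀ (n d m : ℕ), 1 ≤ n → 1 ≤ d → d ≤ m →
      ∀ A : Matrix (Fin d) (Fin m) ℝ, 0 < sigmaMin A →
      ∀ σ γ : ℝ, 0 < σ → 2 ≤ γ →
      ∀ ε ξ δ : ℝ, ε = 1 / (32 * kappa A ^ 2 * Real.sqrt (d : ℝ)) → ξ = 6 →
      δ ≤ (1 - ε ^ 2 * (d : ℝ)) * ε / 12 →
      σ ≤ δ / kappa A ^ 2 * opNorm A * Real.sqrt (n : ℝ) / bnd1 n d m γ →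
      ∀ T : ℕ, 1 ≤ T →
      ENNReal.ofReal (1 - C * (T : ℝ) * (n : ℝ) ^ (-γ + 1)) ≤
        stdGaussian (Fin n × Fin d) (Fin m) {W |
          ∀ S : ℕ → Matrix (Fin n × Fin d) (Fin d) ℝ,
            IsGPM (ZStack n d * A + σ • Matrix.of W) S →
          ∀ Sl : Fin n → ℕ → Matrix (Fin n × Fin d) (Fin d) ℝ,
            (∀ i, IsGPM (ZStack n d * A + σ • mask (Matrix.of W) i) (Sl i)) →
            (∀ i, ∀ t ≤ T,
              frob (blk (Matrix.of W) i * (mask (Matrix.of W) i)ᵀ * Sl i t) ≤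
                Real.sqrt (d : ℝ) * bnd1 n d m γ ^ 2) →
            ∀ t, 1 ≤ t → t ≤ T →
              (∀ i, dF (S t) (Sl i t) ≤ ε * Real.sqrt (d : ℝ)) ∧
              (∀ i, frob (blk (Matrix.of W) i * (Matrix.of W)ᵀ * S t) ≤
                ξ / 2 * Real.sqrt (d : ℝ) * bnd1 n d m γ ^ 2) ∧
              dF (S t) (ZStack n d) ≤ ε * Real.sqrt ((n : ℝ) * d) / 2 ∧
              dF (S (t + 1)) (S t) ≤ 1 / 2 * dF (S t) (S (t - 1)) ∧
              dF (S (t + 1)) (S t) ≤ (1 / 2 : ℝ) ^ t * dF (S 1) (S 0)} := by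
  refine ⟨5, by norm_num, ?_⟩
  intro n d m hn hd hdm A hA σ γ hσ hγ ε ξ δ hε hξ hδ hσ' T hT
  have hT1 : (1 : ℝ) ≤ T := by exact_mod_cast hT
  rcases hn.eq_or_lt with rfl | hn2
  · rw [ENNReal.ofReal_of_nonpos]
    · exact zero_le
    · rw [Nat.cast_one, Real.one_rpow]
      linarith
  have hn0 : (0 : ℝ) < n := by exact_mod_cast (by omega : 0 < n)
  have sc := scale_of_noise_level hn2 hd hA hσ hε hδ hσ'
  have hB : 0 ≤ bnd1 n d m γ := by
    unfold bnd1
    positivity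
  have hbad := measure_not_noise_le (opLe_opNorm A) (opGe_sigmaMin A)
    (by omega) hσ.le (by linarith) sc
  have hle : (1 + n * 4 : ENNReal) * ENNReal.ofReal (Real.exp (-(γ * Real.log n))) ≤
      ENNReal.ofReal (5 * T * (n : ℝ) ^ (-γ + 1)) := by
    have e1 : (1 + n * 4 : ENNReal) = ENNReal.ofReal (1 + n * 4) := by
      rw [ENNReal.ofReal_add zero_le_one (by positivity), ENNReal.ofReal_mul hn0.le]
      simp
    have e2 : Real.exp (-(γ * Real.log n)) = (n : ℝ) ^ (-γ) := by
      rw [Real.rpow_def_of_pos hn0]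
      ring_nf
    rw [e1, e2, ← ENNReal.ofReal_mul (by positivity), Real.rpow_add_one hn0.ne']
    refine ENNReal.ofReal_le_ofReal ?_
    have hp : 0 < (n : ℝ) ^ (-γ) := Real.rpow_pos_of_pos hn0 _
    have hn1 : (1 : ℝ) ≤ n := by exact_mod_cast hn
    have h1 : (1 + n * 4 : ℝ) ≤ 5 * T * n := by nlinarith
    have h2 := mul_le_mul_of_nonneg_right h1 hp.le
    linarith
  set G : Set (Fin n × Fin d → Fin m → ℝ) :=
    {W | Noise A (Matrix.of W) σ (bnd1 n d m γ) (opNorm A)} with hG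
  have hGc : stdGaussian (Fin n × Fin d) (Fin m) Gᶜ ≤
      ENNReal.ofReal (5 * T * (n : ℝ) ^ (-γ + 1)) := hbad.trans hle
  have hone : 1 ≤ stdGaussian (Fin n × Fin d) (Fin m) G +
      stdGaussian (Fin n × Fin d) (Fin m) Gᶜ := by
    rw [← measure_univ (μ := stdGaussian (Fin n × Fin d) (Fin m)), ← Set.union_compl_self G]
    exact measure_union_le _ _
  have hprob : ENNReal.ofReal (1 - 5 * T * (n : ℝ) ^ (-γ + 1)) ≤
      stdGaussian (Fin n × Fin d) (Fin m) G := by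
    rw [ENNReal.ofReal_sub _ (by positivity), ENNReal.ofReal_one]
    exact tsub_le_iff_right.2 (hone.trans (add_le_add_right hGc _))
  refine hprob.trans (measure_mono ?_)
  intro W hW S hS Sl hSl hloo
  have h := hW.iterates (opLe_opNorm A) (opGe_sigmaMin A) hσ.le hB sc hS hSl hloo
  have e1 : ξ / 2 = 3 := by
    rw [hξ]
    norm_num
  have e2 : ε * Real.sqrt ((n : ℝ) * d) / 2 = ε * Real.sqrt d * Real.sqrt n / 2 := by
    rw [Real.sqrt_mul hn0.le]
    ring
  rw [e1, e2]
  exact h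

end GOPP
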